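/- Global systolic estimate via the upper nilradius (Corollary 1.3): For all real P0, r0, δ > 0 there exist constants ε0 > 0, depending only on P0 and r0, and H0 > 0, depending only on P0, r0 and δ, such that the following holds. Let (X,σ) be a δ-hyperbolic GCB-space which is P0-packed at scale r0, let Γ be a torsion-free, non-elementary, discrete group of σ-isometries of X, and let Δ be a real number such that nilrad(Γ,x) ≤ Δ for every point x in the ε0-thin set X_{ε0} = {x ∈ X : there exists g ∈ Γ, g ≠ 1, with d(x, g x) < ε0}. Then the systole satisfies sys(Γ,X) = inf_{x∈X} inf_{g∈Γ, g≠1} d(x, g x) ≥ min{ ε0, (1/H0)·exp(−H0·Δ) }. -/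

import Mathlib

open Metric Filter

/-- Four-points condition for `δ`-hyperbolicity. -/
def IsDeltaHyperbolic (X : Type*) [MetricSpace X] (δ : ℝ) : Prop :=
  ∀ x y z w : X,
    dist x y + dist z w ≤ max (dist x z + dist y w) (dist x w + dist y z) + 2 * δ

/-- `X` is `P₀`-packed at scale `r₀`: any subset of a closed ball of radius `3r₀` whose
points are pairwise at distance `> 2r₀` has cardinality at most `P₀`. -/
def IsPacked (X : Type*) [MetricSpace X] (P₀ r₀ : ℝ) : Prop :=
  ∀ x : X, ∀ S : Finset X, (↑S ⊆ closedBall x (3 * r₀)) →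
    (∀ a ∈ S, ∀ b ∈ S, a ≠ b → 2 * r₀ < dist a b) → (S.card : ℝ) ≤ P₀

/-- A geodesically complete, convex, consistent, reversible geodesic bicombing on `X`.
Together with completeness of `X` this is the notion of GCB-space. -/
structure IsGCB {X : Type*} [MetricSpace X] (σ : X → X → ℝ → X) : Prop where
  source : ∀ x y : X, σ x y 0 = x
  target : ∀ x y : X, σ x y 1 = y
  geodesic : ∀ x y : X, ∀ t ∈ Set.Icc (0:ℝ) 1, ∀ t' ∈ Set.Icc (0:ℝ) 1,
    dist (σ x y t) (σ x y t') = |t - t'| * dist x y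
  convex : ∀ x y x' y' : X,
    ConvexOn ℝ (Set.Icc (0:ℝ) 1) fun t => dist (σ x y t) (σ x' y' t)
  consistent : ∀ x y : X, ∀ s t l : ℝ, 0 ≤ s → s ≤ t → t ≤ 1 → l ∈ Set.Icc (0:ℝ) 1 →
    σ (σ x y s) (σ x y t) l = σ x y ((1 - l) * s + l * t)
  reversible : ∀ x y : X, ∀ t ∈ Set.Icc (0:ℝ) 1, σ x y t = σ y x (1 - t)
  geodComplete : ∀ x y : X, ∃ γ : ℝ → X, Isometry γ ∧
    (∀ s t : ℝ, s ≤ t → ∀ l ∈ Set.Icc (0:ℝ) 1, σ (γ s) (γ t) l = γ (s + l * (t - s))) ∧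
    (∀ t ∈ Set.Icc (0:ℝ) 1, σ x y t = γ (t * dist x y))

/-- `g` is a `σ`-isometry: a surjective isometry preserving the bicombing `σ`. -/
def IsSigmaIsometry {X : Type*} [MetricSpace X] (σ : X → X → ℝ → X) (g : X ≃ᵢ X) : Prop :=
  ∀ x y : X, ∀ t ∈ Set.Icc (0:ℝ) 1, g (σ x y t) = σ (g x) (g y) t

/-- A group of isometries is discrete if for every `x` and `R` only finitely many of its
elements displace `x` at most `R`. -/
def IsDiscreteSubgroup {X : Type*} [MetricSpace X] (Γ : Subgroup (X ≃ᵢ X)) : Prop :=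
  ∀ x : X, ∀ R : ℝ, {g : X ≃ᵢ X | g ∈ Γ ∧ dist x (g x) ≤ R}.Finite

/-- A group is virtually nilpotent if it has a nilpotent subgroup of finite index. -/
def IsVirtuallyNilpotent (G : Type*) [Group G] : Prop :=
  ∃ H : Subgroup G, H.FiniteIndex ∧ Group.IsNilpotent H

/-- `Γ` is non-elementary: it contains two elements generating a subgroup that is not
virtually nilpotent. -/
def IsNonElementary {X : Type*} [MetricSpace X] (Γ : Subgroup (X ≃ᵢ X)) : Prop :=
  ∃ a b : X ≃ᵢ X, a ∈ Γ ∧ b ∈ Γ ∧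
    ¬ IsVirtuallyNilpotent ↥(Subgroup.closure ({a, b} : Set (X ≃ᵢ X)))

/-- An isometry is non-elliptic if its orbits are unbounded. -/
def IsNonElliptic {X : Type*} [MetricSpace X] (g : X ≃ᵢ X) : Prop :=
  ∀ x : X, ¬ Bornology.IsBounded (Set.range fun n : ℤ => (g ^ n) x)

/-- The `r`-almost stabilizer `Γ_r(x)`, generated by the elements of `Γ` displacing `x`
at most `r`. -/
def almostStabilizer {X : Type*} [MetricSpace X] (Γ : Subgroup (X ≃ᵢ X)) (r : ℝ) (x : X) :
    Subgroup (X ≃ᵢ X) :=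
  Subgroup.closure {g : X ≃ᵢ X | g ∈ Γ ∧ dist x (g x) ≤ r}

/-- The nilpotence radius of `Γ` at `x`. -/
noncomputable def nilrad {X : Type*} [MetricSpace X] (Γ : Subgroup (X ≃ᵢ X)) (x : X) : ℝ :=
  sSup {r : ℝ | 0 ≤ r ∧ IsVirtuallyNilpotent ↥(almostStabilizer Γ r x)}

/-- The Margulis domain `M_ε(g)`. -/
def margulisDomain {X : Type*} [MetricSpace X] (g : X ≃ᵢ X) (ε : ℝ) : Set X :=
  {x : X | dist x (g x) ≤ ε}

/-- The generalized Margulis domain `ℳ_ε(g) = ⋃_{i ≠ 0} M_ε(gⁱ)`. -/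
def genMargulisDomain {X : Type*} [MetricSpace X] (g : X ≃ᵢ X) (ε : ℝ) : Set X :=
  ⋃ i ∈ {i : ℤ | i ≠ 0}, margulisDomain (g ^ i) ε

/-- `f` parameterizes a geodesic segment from `x` to `y` on `[0, dist x y]`. -/
def IsGeodesicFrom {X : Type*} [MetricSpace X] (f : ℝ → X) (x y : X) : Prop :=
  f 0 = x ∧ f (dist x y) = y ∧
    ∀ s ∈ Set.Icc 0 (dist x y), ∀ t ∈ Set.Icc 0 (dist x y), dist (f s) (f t) = |s - t|

/-- `X` is a geodesic space. -/
def IsGeodesicSpace (X : Type*) [MetricSpace X] : Prop :=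
  ∀ x y : X, ∃ f : ℝ → X, IsGeodesicFrom f x y

/-- `C` is `lam`-quasiconvex: any two of its points are joined by a geodesic contained in
the closed `lam`-neighbourhood of `C`. -/
def IsQuasiconvex {X : Type*} [MetricSpace X] (lam : ℝ) (C : Set X) : Prop :=
  ∀ x ∈ C, ∀ y ∈ C, ∃ f : ℝ → X, IsGeodesicFrom f x y ∧
    ∀ t ∈ Set.Icc 0 (dist x y), infDist (f t) C ≤ lam

/-- `C` is a convex subset: any two of its points are joined by a geodesic inside `C`. -/
def IsConvexSubset {X : Type*} [MetricSpace X] (C : Set X) : Prop :=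
  ∀ x ∈ C, ∀ y ∈ C, ∃ f : ℝ → X, IsGeodesicFrom f x y ∧
    ∀ t ∈ Set.Icc 0 (dist x y), f t ∈ C

/-- Arc-length concatenation of three paths, of respective lengths `d₁`, `d₂` and the rest. -/
noncomputable def concatPath {X : Type*} (d₁ d₂ : ℝ) (f₁ f₂ f₃ : ℝ → X) : ℝ → X :=
  fun t => if t ≤ d₁ then f₁ t else if t ≤ d₁ + d₂ then f₂ (t - d₁) else f₃ (t - d₁ - d₂)

open scoped Pointwise commutatorElement Topology

theorem Set.Finite.pow_of_finite {G : Type*} [Monoid G] {F : Set G} (hF : F.Finite) (n : ℕ) :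
    (F ^ n).Finite := by
  induction n with
  | zero => rw [pow_zero]; exact Set.finite_one
  | succ n ih => rw [pow_succ]; exact ih.mul hF

/-- Every finite subset of `G` has powers of cardinality growing at most like a polynomial
of degree `D`. -/
def PolyGrowth (D : ℕ) (G : Type*) [Group G] : Prop :=
  ∀ F : Set G, F.Finite → ∃ C : ℕ, ∀ n : ℕ, (F ^ n).ncard ≤ C * (n + 1) ^ D

/-- All subgroups are finitely generated. -/
def AllSubgroupsFG (G : Type*) [Group G] : Prop := ∀ H : Subgroup G, H.FG

theorem PolyGrowth.of_injective {D : ℕ} {G H : Type*} [Group G] [Group H] (hG : PolyGrowth D G)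
    (f : H →* G) (hf : Function.Injective f) : PolyGrowth D H := by
  intro F hF
  obtain ⟨C, hC⟩ := hG (f '' F) (hF.image f)
  refine ⟨C, fun n => ?_⟩
  rw [← Set.ncard_image_of_injective _ hf, Set.image_pow]
  exact hC n

theorem PolyGrowth.subgroup {D : ℕ} {G : Type*} [Group G] (hG : PolyGrowth D G)
    (H : Subgroup G) : PolyGrowth D H := hG.of_injective H.subtype H.subtype_injective

theorem PolyGrowth.of_surjective {D : ℕ} {G H : Type*} [Group G] [Group H] (hG : PolyGrowth D G)
    (f : G →* H) (hf : Function.Surjective f) : PolyGrowth D H := by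
  intro F hF
  choose s hs using hf
  obtain ⟨C, hC⟩ := hG (s '' F) (hF.image s)
  refine ⟨C, fun n => ?_⟩
  have h1 : F = f '' (s '' F) := by
    rw [Set.image_image]; simp [hs]
  rw [h1, ← Set.image_pow]
  exact (Set.ncard_image_le ((hF.image s).pow_of_finite n)).trans (hC n)

theorem exists_lt_two_pow (C D a : ℕ) : ∃ m : ℕ, C * (a * m + 1) ^ D < 2 ^ m := by
  have h : Filter.Tendsto (fun m : ℕ => (m:ℝ) ^ D * (1/2 : ℝ) ^ m) Filter.atTop (nhds 0) := by
    exact tendsto_pow_const_mul_const_pow_of_abs_lt_one D (by norm_num [abs_of_pos])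
  have h2 := h.eventually_lt_const (show (0:ℝ) < 1 / ((C + 1) * (a + 1) ^ D) by positivity)
  obtain ⟨m, hm, hm1⟩ := (h2.and (Filter.eventually_ge_atTop 1)).exists
  refine ⟨m, ?_⟩
  have h3 : ((C:ℝ) + 1) * (((a:ℝ) + 1) * m) ^ D < 2 ^ m := by
    rw [lt_div_iff₀ (by positivity)] at hm
    have : (m:ℝ) ^ D * (1/2) ^ m * ((C + 1) * (a + 1) ^ D) * 2 ^ m < 1 * 2 ^ m := by gcongr
    calc ((C:ℝ) + 1) * (((a:ℝ) + 1) * m) ^ D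
        = (m:ℝ) ^ D * (1/2) ^ m * ((C + 1) * (a + 1) ^ D) * 2 ^ m := by
          rw [mul_pow, one_div, inv_pow]; field_simp
      _ < _ := by simpa using this
  have h4 : C * (a * m + 1) ^ D ≤ (C + 1) * ((a + 1) * m) ^ D := by
    gcongr
    · omega
    · nlinarith
  have h5 : (C + 1) * ((a + 1) * m) ^ D < 2 ^ m := by exact_mod_cast h3
  omega

/-- If `t ^ m e t ^ (-m)` never lies in the subgroup generated by the previous conjugates, the
powers of `{t, e t}` double at each step. -/
theorem exists_conj_relation {D : ℕ} {G : Type*} [Group G] (hG : PolyGrowth D G) (t e : G)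
    (A : ℕ → Set G) (h0 : A 0 = {1})
    (hA : ∀ m, ∀ a ∈ A m, a ∈ A (m + 1) ∧ a * (t ^ m * e * t⁻¹ ^ m) ∈ A (m + 1)) :
    ∃ m : ℕ, ∃ a ∈ A m, ∃ b ∈ A m, a = b * (t ^ m * e * t⁻¹ ^ m) := by
  by_contra hcon
  push Not at hcon
  have key : ∀ m : ℕ, (({t, e * t} : Set G) ^ m ⊆ (fun a => a * t ^ m) '' A m) ∧
      (({t, e * t} : Set G) ^ m).ncard = 2 ^ m := by
    intro m
    induction m with
    | zero =>
      refine ⟨?_, by rw [pow_zero, pow_zero]; exact Set.ncard_singleton 1⟩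
      rw [pow_zero, h0]
      rintro _ rfl
      exact ⟨1, rfl, by simp⟩
    | succ m ih =>
      obtain ⟨ih1, ih2⟩ := ih
      have hfin : (({t, e * t} : Set G) ^ m).Finite := (Set.toFinite _).pow_of_finite m
      have hS : ({t, e * t} : Set G) ^ (m + 1) =
          (fun g => g * t) '' (({t, e * t} : Set G) ^ m) ∪
          (fun g => g * (e * t)) '' (({t, e * t} : Set G) ^ m) := by
        rw [pow_succ, Set.insert_eq, Set.mul_union, Set.mul_singleton, Set.mul_singleton]
      rw [hS]
      constructor
      · apply Set.union_subset
        · rintro _ ⟨g, hg, rfl⟩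
          obtain ⟨a, ha, rfl⟩ := ih1 hg
          exact ⟨a, (hA m a ha).1, by simp [pow_succ, mul_assoc]⟩
        · rintro _ ⟨g, hg, rfl⟩
          obtain ⟨a, ha, rfl⟩ := ih1 hg
          exact ⟨_, (hA m a ha).2, by simp [pow_succ, mul_assoc]⟩
      · rw [Set.ncard_union_eq _ (hfin.image _) (hfin.image _),
          Set.ncard_image_of_injective _ (mul_left_injective _),
          Set.ncard_image_of_injective _ (mul_left_injective _), ih2, pow_succ]
        · ring
        · rw [Set.disjoint_left]
          rintro _ ⟨g, hg, rfl⟩ ⟨g', hg', h⟩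
          obtain ⟨a, ha, rfl⟩ := ih1 hg
          obtain ⟨b, hb, rfl⟩ := ih1 hg'
          apply hcon m a ha b hb
          simp only [] at h
          have h' : b * t ^ m * e = a * t ^ m := by
            apply mul_right_cancel (b := t); simpa [mul_assoc] using h
          rw [eq_comm, inv_pow, ← mul_assoc, ← mul_assoc, h']; simp
  obtain ⟨C, hC⟩ := hG {t, e * t} (Set.toFinite _)
  obtain ⟨m, hm⟩ := exists_lt_two_pow C D 1
  have := hC m
  rw [(key m).2] at this
  rw [one_mul] at hm
  omega

theorem exists_closure_conj {D : ℕ} {G : Type*} [Group G] (hG : PolyGrowth D G) (t e : G) :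
    ∃ M : ℕ, ∀ n : ℕ, t ^ n * e * t⁻¹ ^ n ∈
      Subgroup.closure ((fun j : ℕ => t ^ j * e * t⁻¹ ^ j) '' Set.Iio M) := by
  let x : ℕ → G := fun j => t ^ j * e * t⁻¹ ^ j
  obtain ⟨m, a, ha, b, hb, hab⟩ := exists_conj_relation hG t e
    (fun m => (Subgroup.closure (x '' Set.Iio m) : Set G)) (by ext; simp) (by
      intro m a ha
      have hle : Subgroup.closure (x '' Set.Iio m) ≤ Subgroup.closure (x '' Set.Iio (m + 1)) :=
        Subgroup.closure_mono (Set.image_mono (Set.Iio_subset_Iio (by omega)))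
      exact ⟨hle ha, Subgroup.mul_mem _ (hle ha)
        (Subgroup.subset_closure ⟨m, by simp, rfl⟩)⟩)
  refine ⟨m, fun n => ?_⟩
  have hm : x m ∈ Subgroup.closure (x '' Set.Iio m) := by
    have : x m = b⁻¹ * a := by rw [hab]; simp [x]
    rw [this]
    exact Subgroup.mul_mem _ (Subgroup.inv_mem _ hb) ha
  change x n ∈ Subgroup.closure (x '' Set.Iio m)
  induction n using Nat.strong_induction_on with
  | _ n ih =>
    rcases lt_or_ge n m with h | h
    · exact Subgroup.subset_closure ⟨n, h, rfl⟩
    · have hx : ∀ i j, x (i + j) = MulAut.conj (t ^ i) (x j) := by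
        intro i j
        simp only [x, MulAut.conj_apply, pow_add, inv_pow, mul_assoc]
        rw [← mul_inv_rev, ← pow_add]
      have h1 : x n ∈ (Subgroup.closure (x '' Set.Iio m)).map
          (MulAut.conj (t ^ (n - m))).toMonoidHom := by
        refine ⟨x m, hm, ?_⟩
        have := hx (n - m) m
        rw [Nat.sub_add_cancel h] at this
        exact this.symm
      rw [MonoidHom.map_closure] at h1
      refine (Subgroup.closure_le _).2 ?_ h1
      rintro _ ⟨_, ⟨j, hj, rfl⟩, rfl⟩
      have := hx (n - m) j
      change (MulAut.conj (t ^ (n - m))) (x j) ∈ _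
      rw [← this]
      simp only [Set.mem_Iio] at hj
      exact ih _ (by omega)

/-- The kernel of a homomorphism onto `ℤ` from a finitely generated group of polynomial growth is
finitely generated. -/
theorem ker_fg_of_polyGrowth {D : ℕ} {G : Type*} [Group G] [hfg : Group.FG G]
    (hG : PolyGrowth D G) (φ : G →* Multiplicative ℤ) (t : G) (ht : φ t = Multiplicative.ofAdd 1) :
    φ.ker.FG := by
  obtain ⟨S, hS, hSfin⟩ := Group.fg_iff.1 hfg
  let κ : G → G := fun s => s * t ^ (-(Multiplicative.toAdd (φ s)))
  have hφt : ∀ n : ℤ, φ (t ^ n) = Multiplicative.ofAdd n := by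
    intro n; rw [map_zpow, ht, ← ofAdd_zsmul]; simp
  have hκ : ∀ s, κ s ∈ φ.ker := by
    intro s
    rw [MonoidHom.mem_ker, map_mul, hφt]
    simp
  choose M hM using fun e => exists_closure_conj hG t e
  choose M' hM' using fun e => exists_closure_conj hG t⁻¹ e
  let T : Set G := ⋃ s ∈ S, ((fun j : ℕ => t ^ j * κ s * t⁻¹ ^ j) '' Set.Iio (M (κ s)) ∪
    (fun j : ℕ => t⁻¹ ^ j * κ s * t⁻¹⁻¹ ^ j) '' Set.Iio (M' (κ s)))
  have hTfin : T.Finite := hSfin.biUnion fun s _ =>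
    ((Set.finite_Iio _).image _).union ((Set.finite_Iio _).image _)
  have hconj : ∀ s ∈ S, ∀ n : ℤ, t ^ n * κ s * t ^ (-n) ∈ Subgroup.closure T := by
    intro s hs n
    obtain ⟨k, rfl | rfl⟩ := n.eq_nat_or_neg
    · have := hM (κ s) k
      rw [zpow_neg, zpow_natCast, ← inv_pow]
      refine Subgroup.closure_mono ?_ this
      exact Set.subset_iUnion₂_of_subset s hs Set.subset_union_left
    · have := hM' (κ s) k
      rw [neg_neg, zpow_neg, zpow_natCast, ← inv_pow]
      nth_rw 2 [← inv_inv t]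
      refine Subgroup.closure_mono ?_ this
      exact Set.subset_iUnion₂_of_subset s hs Set.subset_union_right
  have hTK : Subgroup.closure T ≤ φ.ker := by
    rw [Subgroup.closure_le]
    intro g hg
    simp only [T, Set.mem_iUnion] at hg
    obtain ⟨s, hs, ⟨j, hj, rfl⟩ | ⟨j, hj, rfl⟩⟩ := hg
    · have := φ.normal_ker.conj_mem _ (hκ s) (t ^ j); simpa using this
    · have := φ.normal_ker.conj_mem _ (hκ s) (t⁻¹ ^ j); simpa using this
  have hconj' : ∀ (n : ℤ) g, g ∈ Subgroup.closure T → t ^ n * g * t ^ (-n) ∈ Subgroup.closure T := by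
    intro n g hg
    have h1 : MulAut.conj (t ^ n) g ∈ (Subgroup.closure T).map (MulAut.conj (t ^ n)).toMonoidHom :=
      ⟨g, hg, rfl⟩
    rw [MonoidHom.map_closure] at h1
    have h2 : MulAut.conj (t ^ n) g ∈ Subgroup.closure T := by
      refine (Subgroup.closure_le _).2 ?_ h1
      rintro _ ⟨y, hy, rfl⟩
      simp only [T, Set.mem_iUnion] at hy
      obtain ⟨s, hs, ⟨j, hj, rfl⟩ | ⟨j, hj, rfl⟩⟩ := hy
      · have := hconj s hs (n + j)
        have e : (MulAut.conj (t ^ n)).toMonoidHom (t ^ j * κ s * t⁻¹ ^ j) =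
            t ^ (n + j) * κ s * t ^ (-(n + (j:ℤ))) := by
          change t ^ n * (t ^ j * κ s * t⁻¹ ^ j) * (t ^ n)⁻¹ = _
          simp [zpow_add, mul_assoc]
        exact e ▸ this
      · have := hconj s hs (n - j)
        have e : (MulAut.conj (t ^ n)).toMonoidHom (t⁻¹ ^ j * κ s * t⁻¹⁻¹ ^ j) =
            t ^ (n - j) * κ s * t ^ (-(n - (j:ℤ))) := by
          change t ^ n * (t⁻¹ ^ j * κ s * t⁻¹⁻¹ ^ j) * (t ^ n)⁻¹ = _
          simp [zpow_sub, mul_assoc]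
        exact e ▸ this
    rw [MulAut.conj_apply, ← zpow_neg] at h2
    exact h2
  have hall : ∀ g : G, g * t ^ (-(Multiplicative.toAdd (φ g))) ∈ Subgroup.closure T := by
    intro g
    have hg : g ∈ Subgroup.closure S := hS ▸ Subgroup.mem_top g
    induction hg using Subgroup.closure_induction with
    | mem s hs => have := hconj s hs 0; simpa [κ] using this
    | one => simp
    | mul x y _ _ hx hy =>
      have h := Subgroup.mul_mem _ hx (hconj' (Multiplicative.toAdd (φ x)) _ hy)
      convert h using 1
      simp [zpow_add, zpow_neg, mul_assoc]
    | inv x _ hx =>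
      have h := hconj' (-(Multiplicative.toAdd (φ x))) _ (Subgroup.inv_mem _ hx)
      convert h using 1
      simp
  have : φ.ker = Subgroup.closure T := by
    refine le_antisymm (fun g hg => ?_) hTK
    have := hall g
    rw [MonoidHom.mem_ker.1 hg] at this
    simpa using this
  rw [this]
  exact Subgroup.fg_iff _ |>.2 ⟨T, rfl, hTfin⟩

theorem ker_polyGrowth {D : ℕ} {G : Type*} [Group G]
    (hG : PolyGrowth (D + 1) G) (φ : G →* Multiplicative ℤ) (t : G)
    (ht : φ t = Multiplicative.ofAdd 1) : PolyGrowth D φ.ker := by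
  intro F hF
  set F₁ : Set G := Subtype.val '' F ∪ {1, t} with hF₁
  have hF₁fin : F₁.Finite := (hF.image _).union (Set.toFinite _)
  obtain ⟨C, hC⟩ := hG F₁ hF₁fin
  refine ⟨C * 2 ^ (D + 1), fun n => ?_⟩
  have hφt : ∀ n : ℕ, φ (t ^ n) = Multiplicative.ofAdd (n:ℤ) := by
    intro n; rw [map_pow, ht, ← ofAdd_nsmul]; simp
  have h1 : ((F ^ n) ×ˢ (Set.Iic n)).ncard ≤ (F₁ ^ (n + n)).ncard := by
    refine Set.ncard_le_ncard_of_injOn (fun p => (p.1 : G) * t ^ p.2) ?_ ?_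
      (hF₁fin.pow_of_finite _)
    · rintro ⟨f, j⟩ ⟨hf, hj⟩
      rw [pow_add]
      refine Set.mul_mem_mul ?_ ?_
      · have : (f : G) ∈ (Subtype.val '' F) ^ n := by
          have := Set.image_pow (φ.ker.subtype) F n
          rw [show (Subtype.val : φ.ker → G) = φ.ker.subtype from rfl, ← this]
          exact ⟨f, hf, rfl⟩
        exact Set.pow_subset_pow_left Set.subset_union_left this
      · have h1 : (1:G) ∈ F₁ := by simp [hF₁]
        have ht : t ∈ F₁ := by simp [hF₁]
        exact Set.pow_subset_pow_right h1 hj (Set.pow_mem_pow ht)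
    · rintro ⟨f, j⟩ ⟨hf, hj⟩ ⟨f', j'⟩ ⟨hf', hj'⟩ h
      simp only at h
      have hφ := congrArg φ h
      rw [map_mul, map_mul, MonoidHom.mem_ker.1 f.2, MonoidHom.mem_ker.1 f'.2, hφt, hφt] at hφ
      have hjj : j = j' := by simpa using hφ
      subst hjj
      have : f = f' := Subtype.ext (mul_right_cancel h)
      rw [this]
  rw [Set.ncard_prod] at h1
  have h2 : (Set.Iic n).ncard = n + 1 := by simp [Set.ncard_eq_toFinset_card']
  rw [h2] at h1
  have h3 := h1.trans (hC (n + n))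
  have h4 : (F ^ n).ncard * (n + 1) ≤ C * 2 ^ (D + 1) * (n + 1) ^ D * (n + 1) := by
    calc (F ^ n).ncard * (n + 1) ≤ C * (n + n + 1) ^ (D + 1) := h3
      _ ≤ C * (2 * (n + 1)) ^ (D + 1) := by gcongr; omega
      _ = _ := by rw [mul_pow]; ring
  exact Nat.le_of_mul_le_mul_right h4 (Nat.succ_pos n)

theorem not_polyGrowth_zero {G : Type*} [Group G] (φ : G →* Multiplicative ℤ) (t : G)
    (ht : φ t = Multiplicative.ofAdd 1) : ¬ PolyGrowth 0 G := by
  intro hG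
  obtain ⟨C, hC⟩ := hG {1, t} (Set.toFinite _)
  have h1 : (Set.Iic C).ncard ≤ (({1, t} : Set G) ^ C).ncard := by
    refine Set.ncard_le_ncard_of_injOn (fun j => t ^ j) ?_ ?_
      ((Set.toFinite _).pow_of_finite _)
    · intro j hj
      exact Set.pow_subset_pow_right (by simp) hj (Set.pow_mem_pow (by simp))
    · intro i _ j _ h
      have := congrArg φ h
      simpa [ht, ← ofAdd_nsmul] using this
  have h2 : (Set.Iic C).ncard = C + 1 := by simp [Set.ncard_eq_toFinset_card']
  have := hC C
  rw [pow_zero, mul_one] at this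
  omega

open Polynomial in
theorem norm_le_two_of_isRoot {r : ℤ[X]} (hr : r.Monic) (hc : ∀ i, |r.coeff i| ≤ 1) {z : ℂ}
    (hz : aeval z r = 0) : ‖z‖ ≤ 2 := by
  have hm : (r.map (Int.castRingHom ℂ)).Monic := hr.map _
  have h1 : (r.map (Int.castRingHom ℂ)).IsRoot z := by
    rw [IsRoot, eval_map]; exact hz
  have h2 := h1.norm_lt_cauchyBound hm.ne_zero
  have h3 : (r.map (Int.castRingHom ℂ)).cauchyBound ≤ 2 := by
    rw [cauchyBound, hm.leadingCoeff, nnnorm_one, div_one]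
    have : (Finset.range (r.map (Int.castRingHom ℂ)).natDegree).sup
        (fun i => ‖(r.map (Int.castRingHom ℂ)).coeff i‖₊) ≤ 1 := by
      apply Finset.sup_le
      intro i _
      rw [coeff_map, ← NNReal.coe_le_coe, coe_nnnorm]
      simpa using (by exact_mod_cast hc i : (|(r.coeff i : ℝ)|) ≤ 1)
    calc _ ≤ (1 : NNReal) + 1 := by gcongr
      _ = 2 := by norm_num
  have h4 : ((r.map (Int.castRingHom ℂ)).cauchyBound : ℝ) ≤ 2 := by exact_mod_cast h3
  linarith

open Polynomial in
theorem root_eq_zero_or_pow_eq_one {P : ℤ[X]} (hP : P.Monic)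
    (h : ∀ z ∈ P.aroots ℂ, ‖z‖ ≤ 1) : ∀ z ∈ P.aroots ℂ, z = 0 ∨ ∃ n, 0 < n ∧ z ^ n = 1 := by
  intro z hz
  by_cases h0 : z = 0
  · exact Or.inl h0
  right
  refine pow_eq_one_of_mahlerMeasure_eq_one ?_ h0 hz
  rw [mahlerMeasure_eq_leadingCoeff_mul_prod_roots, (hP.map _).leadingCoeff, norm_one, one_mul]
  apply Multiset.prod_eq_one
  intro x hx
  obtain ⟨a, ha, rfl⟩ := Multiset.mem_map.1 hx
  exact max_eq_left (h a ha)

theorem exists_common_exponent (s : Multiset ℂ)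
    (h : ∀ z ∈ s, z = 0 ∨ ∃ n : ℕ, 0 < n ∧ z ^ n = 1) :
    ∃ p : ℕ, 0 < p ∧ ∀ z ∈ s, z = 0 ∨ z ^ p = 1 := by
  induction s using Multiset.induction with
  | empty => exact ⟨1, one_pos, by simp⟩
  | cons a s ih =>
    obtain ⟨p, hp, hps⟩ := ih fun z hz => h z (Multiset.mem_cons_of_mem hz)
    have ha : ∃ n : ℕ, 0 < n ∧ (a = 0 ∨ a ^ n = 1) := by
      rcases h a (Multiset.mem_cons_self _ _) with h0 | ⟨n, hn, h1⟩
      · exact ⟨1, one_pos, Or.inl h0⟩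
      · exact ⟨n, hn, Or.inr h1⟩
    obtain ⟨n, hn, han⟩ := ha
    refine ⟨n * p, by positivity, fun z hz => ?_⟩
    rcases Multiset.mem_cons.1 hz with rfl | hz
    · rcases han with h0 | h1
      · exact Or.inl h0
      · right; rw [pow_mul, h1, one_pow]
    · rcases hps z hz with h0 | h1
      · exact Or.inl h0
      · right; rw [mul_comm, pow_mul, h1, one_pow]

open Polynomial in
theorem exists_quasiunipotent_free {F : Type*} [AddCommGroup F] [Module.Free ℤ F]
    [Module.Finite ℤ F] (f : Module.End ℤ F)
    (h : ∀ q : ℕ, 0 < q → ∀ v : F, ∃ r : ℤ[X], r.Monic ∧ (∀ i, |r.coeff i| ≤ 1) ∧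
      aeval (f ^ q) r v = 0) :
    ∃ p n : ℕ, 0 < p ∧ (f * (f ^ p - 1)) ^ n = 0 := by
  have hroot : ∀ z ∈ f.charpoly.aroots ℂ, ∀ q : ℕ, 0 < q → ‖z ^ q‖ ≤ 2 := by
    intro z hz q hq
    rw [mem_aroots] at hz
    have h1 : (f.baseChange ℂ).charpoly.IsRoot z := by
      rw [LinearMap.charpoly_baseChange, IsRoot, eval_map_algebraMap]; exact hz.2
    obtain ⟨w, hw⟩ := ((Module.End.hasEigenvalue_iff_isRoot_charpoly _ _).2
      h1).exists_hasEigenvector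
    choose r hr1 hr2 hr3 using h q hq
    let b := Module.Free.chooseBasis ℤ F
    let R : ℤ[X] := ∏ i, r (b i)
    have hR : aeval (f ^ q) R = 0 := by
      refine b.ext fun i => ?_
      rw [LinearMap.zero_apply]
      obtain ⟨c, hc⟩ : r (b i) ∣ R := Finset.dvd_prod_of_mem _ (Finset.mem_univ i)
      rw [hc, mul_comm, map_mul, Module.End.mul_apply, hr3, map_zero]
    have hR2 : aeval ((f.baseChange ℂ) ^ q) R = 0 := by
      have := congrArg (Module.End.baseChangeHom ℤ ℂ F) hR
      rw [map_zero, ← aeval_algHom_apply, map_pow] at this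
      exact this
    have hR3 : aeval (f.baseChange ℂ) ((expand ℂ q (R.map (algebraMap ℤ ℂ)))) = 0 := by
      rw [expand_aeval, aeval_map_algebraMap]; exact hR2
    have h4 := Module.End.aeval_apply_of_hasEigenvector (p := expand ℂ q (R.map (algebraMap ℤ ℂ))) hw
    rw [hR3, LinearMap.zero_apply, expand_eval, eval_map_algebraMap, eq_comm, smul_eq_zero,
      or_iff_left hw.2] at h4
    rw [map_prod, Finset.prod_eq_zero_iff] at h4
    obtain ⟨i, _, hi⟩ := h4
    exact norm_le_two_of_isRoot (hr1 _) (hr2 _) hi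
  have hle : ∀ z ∈ f.charpoly.aroots ℂ, ‖z‖ ≤ 1 := by
    intro z hz
    by_contra hgt
    push Not at hgt
    obtain ⟨n, hn⟩ := pow_unbounded_of_one_lt 2 hgt
    have := hroot z hz (n + 1) (Nat.succ_pos n)
    rw [norm_pow, pow_succ] at this
    nlinarith [pow_pos (lt_trans one_pos hgt) n]
  have hmon : f.charpoly.Monic := LinearMap.charpoly_monic f
  obtain ⟨p, hp, hpz⟩ := exists_common_exponent _ (root_eq_zero_or_pow_eq_one hmon hle)
  have hdvd : f.charpoly ∣ (X * (X ^ p - 1)) ^ (Multiset.card (f.charpoly.aroots ℂ)) := by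
    rw [← map_dvd_map (algebraMap ℤ ℂ) (algebraMap ℤ ℂ).injective_int hmon]
    rw [(IsAlgClosed.splits (f.charpoly.map (algebraMap ℤ ℂ))).eq_prod_roots_of_monic
      (hmon.map _)]
    rw [Polynomial.map_pow, ← Multiset.prod_replicate, ← Multiset.map_const']
    refine Multiset.prod_dvd_prod_of_dvd _ _ fun a ha => ?_
    rw [dvd_iff_isRoot]
    rcases hpz a ha with h0 | h1
    · simp [h0]
    · simp [h1]
  refine ⟨p, Multiset.card (f.charpoly.aroots ℂ), hp, ?_⟩
  obtain ⟨c, hc⟩ := hdvd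
  have := congrArg (aeval f) hc
  rw [map_mul, LinearMap.aeval_self_charpoly, zero_mul] at this
  simpa using this

open Polynomial in
theorem exists_unipotent_power {M : Type*} [AddCommGroup M] [Module.Finite ℤ M]
    (α : M ≃ₗ[ℤ] M)
    (h : ∀ q : ℕ, 0 < q → ∀ v : M, ∃ r : ℤ[X], r.Monic ∧ (∀ i, |r.coeff i| ≤ 1) ∧
      aeval ((α : Module.End ℤ M) ^ q) r v = 0) :
    ∃ p n : ℕ, 0 < p ∧ ((α : Module.End ℤ M) ^ p - 1) ^ n = 0 := by
  set f : Module.End ℤ M := (α : Module.End ℤ M) with hf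
  let T := Submodule.torsion ℤ M
  have hmemT : ∀ v, v ∈ T ↔ ∃ a : nonZeroDivisors ℤ, a • v = 0 := fun v =>
    Submodule.mem_torsion_iff v
  have hTf : T ≤ T.comap f := by
    intro v hv
    obtain ⟨a, ha⟩ := (hmemT v).1 hv
    refine (hmemT _).2 ⟨a, ?_⟩
    have := congrArg f ha
    rw [map_zero] at this
    rw [← this]; exact (map_zsmul f a.1 v).symm
  let g : Module.End ℤ (M ⧸ T) := T.mapQ T f hTf
  have hg : ∀ v, g (T.mkQ v) = T.mkQ (f v) := fun v => rfl
  have hgpow : ∀ (r : ℤ[X]) (q : ℕ) v, aeval (g ^ q) r (T.mkQ v) = T.mkQ (aeval (f ^ q) r v) := by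
    intro r q v
    have hp : ∀ (k : ℕ) v, (g ^ k) (T.mkQ v) = T.mkQ ((f ^ k) v) := by
      intro k
      induction k with
      | zero => intro v; rfl
      | succ k ih => intro v; rw [pow_succ, pow_succ, Module.End.mul_apply, hg, ih]; rfl
    rw [aeval_eq_sum_range, aeval_eq_sum_range, LinearMap.sum_apply, LinearMap.sum_apply, map_sum]
    refine Finset.sum_congr rfl fun i _ => ?_
    rw [LinearMap.smul_apply, LinearMap.smul_apply, ← pow_mul, ← pow_mul, hp, map_zsmul]
  obtain ⟨p, n, hp, hpn⟩ := exists_quasiunipotent_free g (by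
    intro q hq v
    obtain ⟨v, rfl⟩ := T.mkQ_surjective v
    obtain ⟨r, h1, h2, h3⟩ := h q hq v
    exact ⟨r, h1, h2, by rw [hgpow, h3, map_zero]⟩)
  have hmap : ∀ v, ((f ^ p - 1) ^ n) v ∈ T := by
    intro v
    have h1 := hgpow ((X * (X ^ p - 1)) ^ n) 1 v
    simp only [pow_one, map_pow, map_mul, map_sub, aeval_X, map_one] at h1
    rw [hpn, LinearMap.zero_apply, eq_comm, Submodule.mkQ_apply, Submodule.Quotient.mk_eq_zero] at h1
    obtain ⟨a, ha⟩ := (hmemT _).1 h1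
    refine (hmemT _).2 ⟨a, ?_⟩
    have hcomm : Commute f (f ^ p - 1) := by
      apply Commute.sub_right (Commute.pow_right rfl p) (Commute.one_right f)
    rw [hcomm.mul_pow, Module.End.mul_apply] at ha
    have hinj : Function.Injective (f ^ n) := by
      rw [Module.End.coe_pow]; exact α.injective.iterate n
    apply hinj
    rw [map_zero, ← ha]
    exact map_zsmul (f ^ n) a.1 _
  have hfin : Finite T := Module.finite_of_fg_torsion T (Submodule.torsion_isTorsion)
  have hrest : ∃ p' : ℕ, 0 < p' ∧ ∀ v ∈ T, (f ^ p') v = v := by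
    have hmem : ∀ v ∈ T, α v ∈ T := fun v hv => hTf hv
    have hinj : Function.Injective (fun v : T => (⟨α v.1, hmem v.1 v.2⟩ : T)) := by
      intro v w hvw
      exact Subtype.ext (α.injective (congrArg Subtype.val hvw))
    let e : Equiv.Perm T := Equiv.ofBijective _ (Finite.injective_iff_bijective.1 hinj)
    refine ⟨orderOf e, orderOf_pos e, fun v hv => ?_⟩
    have h1 : ∀ (k : ℕ) (v : T), ((e ^ k) v : M) = (f ^ k) v.1 := by
      intro k
      induction k with
      | zero => intro v; rfl
      | succ k ih =>
        intro v
        rw [pow_succ, pow_succ, Module.End.mul_apply, Equiv.Perm.mul_apply, ih]; rfl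
    have := h1 (orderOf e) ⟨v, hv⟩
    rw [pow_orderOf_eq_one] at this
    exact this.symm
  obtain ⟨p', hp', hT⟩ := hrest
  refine ⟨p * p', n + 1, by positivity, ?_⟩
  obtain ⟨u, hu⟩ : (X ^ p - 1 : ℤ[X]) ∣ X ^ (p * p') - 1 := by
    rw [pow_mul]; simpa using sub_dvd_pow_sub_pow (X ^ p : ℤ[X]) 1 p'
  have h1 : (X ^ (p * p') - 1 : ℤ[X]) ^ (n + 1) =
      u ^ n * ((X ^ (p * p') - 1) * (X ^ p - 1) ^ n) := by
    rw [pow_succ]; nth_rw 1 [hu]; rw [mul_pow]; ring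
  have h2 := congrArg (aeval f) h1
  simp only [map_mul, map_pow, map_sub, aeval_X, map_one] at h2
  rw [h2]
  ext v
  rw [Module.End.mul_apply, Module.End.mul_apply, LinearMap.sub_apply, Module.End.one_apply,
    mul_comm p p', pow_mul]
  have h3 : ∀ (k : ℕ) w, w ∈ T → ((f ^ p') ^ k) w = w := by
    intro k w hw
    induction k with
    | zero => rfl
    | succ k ih => rw [pow_succ, Module.End.mul_apply, hT w hw, ih]
  rw [h3 p _ (hmap v), sub_self, map_zero, LinearMap.zero_apply]

open Polynomial in
theorem pow_sub_one_pow_eq_zero_of_dvd {R : Type*} [Ring R] (f : R) {p n P : ℕ}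
    (h : (f ^ p - 1) ^ n = 0) (hP : p ∣ P) : (f ^ P - 1) ^ n = 0 := by
  obtain ⟨m, rfl⟩ := hP
  obtain ⟨u, hu⟩ : (X ^ p - 1 : ℤ[X]) ∣ X ^ (p * m) - 1 := by
    rw [pow_mul]; simpa using sub_dvd_pow_sub_pow (X ^ p : ℤ[X]) 1 m
  have h2 := congrArg (fun r => aeval f (r ^ n)) hu
  simpa only [map_mul, map_pow, map_sub, aeval_X, map_one, mul_pow, h, zero_mul] using h2

open Polynomial in
/-- In a group of polynomial growth, every automorphism of a finitely generated abelian subgroup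
which is induced by an inner automorphism has a unipotent power. -/
theorem exists_engel_power {D : ℕ} {A Q : Type*} [CommGroup A] [hfg : Group.FG A] [Group Q]
    (hQ : PolyGrowth D Q) (ι : A →* Q) (hι : Function.Injective ι) (t : Q) (α : MulAut A)
    (hα : ∀ a, ι (α a) = t * ι a * t⁻¹) :
    ∃ p n : ℕ, 0 < p ∧ ∀ P : ℕ, p ∣ P → ∀ a, (fun x => ⁅t ^ P, x⁆)^[n] (ι a) = 1 := by
  have : AddGroup.FG (Additive A) := GroupFG.iff_add_fg.1 hfg
  have : Module.Finite ℤ (Additive A) := Module.Finite.iff_addGroup_fg.2 this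
  let β : Additive A ≃ₗ[ℤ] Additive A := (MulEquiv.toAdditive α).toIntLinearEquiv
  let f : Module.End ℤ (Additive A) := β
  have hf : ∀ (P : ℕ) (v : Additive A), ι ((f ^ P) v).toMul = t ^ P * ι v.toMul * (t ^ P)⁻¹ := by
    intro P
    induction P with
    | zero => intro v; simp
    | succ P ih =>
      intro v
      rw [pow_succ, Module.End.mul_apply, ih, pow_succ]
      have : ι (f v).toMul = t * ι v.toMul * t⁻¹ := hα _
      rw [this]; group
  obtain ⟨p, n, hp, hpn⟩ := exists_unipotent_power β (by
    intro q hq v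
    obtain ⟨m, a, ⟨ε, hε, rfl⟩, b, ⟨ε', hε', rfl⟩, hab⟩ := exists_conj_relation hQ (t ^ q) (ι v.toMul)
      (fun m => {x | ∃ ε : ℕ → ℤ, (∀ i, ε i = 0 ∨ ε i = 1) ∧
        x = ι (∑ i ∈ Finset.range m, ε i • ((f ^ q) ^ i) v : Additive A).toMul}) (by
        ext x
        simp only [Finset.range_zero, Finset.sum_empty, toMul_zero, map_one, Set.mem_ofPred_eq,
          Set.mem_singleton_iff]
        exact ⟨fun ⟨_, _, h⟩ => h, fun h => ⟨0, by simp, h⟩⟩) (by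
        rintro m _ ⟨ε, hε, rfl⟩
        have hsum : ∀ c : ℤ, ∑ i ∈ Finset.range (m + 1), (Function.update ε m c) i • ((f ^ q) ^ i) v
            = ∑ i ∈ Finset.range m, ε i • ((f ^ q) ^ i) v + c • ((f ^ q) ^ m) v := by
          intro c
          rw [Finset.sum_range_succ, Function.update_self]
          congr 1
          refine Finset.sum_congr rfl fun i hi => ?_
          rw [Function.update_of_ne (Finset.mem_range.1 hi).ne]
        have hup : ∀ c : ℤ, (c = 0 ∨ c = 1) → ∀ i, (Function.update ε m c) i = 0 ∨
            (Function.update ε m c) i = 1 := by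
          intro c hc i
          by_cases h : i = m
          · subst h; simpa using hc
          · rw [Function.update_of_ne h]; exact hε i
        refine ⟨⟨Function.update ε m 0, hup 0 (Or.inl rfl), ?_⟩,
          ⟨Function.update ε m 1, hup 1 (Or.inr rfl), ?_⟩⟩
        · rw [hsum, zero_smul, add_zero]
        · rw [hsum, one_smul, toMul_add, map_mul, ← pow_mul f, hf, pow_mul, inv_pow])
    let s : ℤ[X] := ∑ i ∈ Finset.range m, C (ε' i - ε i) * X ^ i
    have hsc : ∀ i, s.coeff i = if i < m then ε' i - ε i else 0 := by
      intro i
      simp only [s, finsetSum_coeff, coeff_C_mul, coeff_X_pow, mul_ite, mul_one, mul_zero,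
        Finset.sum_ite_eq, Finset.mem_range]
    have hs : s.degree < m := by
      rw [degree_lt_iff_coeff_zero]
      intro i hi
      rw [hsc, if_neg (by omega)]
    refine ⟨X ^ m + s, monic_X_pow_add hs, fun i => ?_, ?_⟩
    · rw [coeff_add, coeff_X_pow, hsc]
      rcases lt_trichotomy i m with h | h | h
      · rw [if_neg h.ne, if_pos h]
        rcases hε i with h1 | h1 <;> rcases hε' i with h2 | h2 <;> simp [h1, h2]
      · rw [if_pos h, if_neg (by omega)]; simp
      · rw [if_neg (by omega), if_neg (by omega)]; simp
    · have h1 : (∑ i ∈ Finset.range m, ε i • ((f ^ q) ^ i) v : Additive A) =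
          ∑ i ∈ Finset.range m, ε' i • ((f ^ q) ^ i) v + ((f ^ q) ^ m) v := by
        apply Additive.toMul.injective
        apply hι
        rw [hab, toMul_add, map_mul]
        congr 1
        rw [← pow_mul f, hf, pow_mul, inv_pow]
      have h2 : aeval (f ^ q) s v = ∑ i ∈ Finset.range m, (ε' i - ε i) • ((f ^ q) ^ i) v := by
        simp only [s, map_sum, map_mul, aeval_C, map_pow, aeval_X, LinearMap.sum_apply]
        rfl
      change aeval (f ^ q) (X ^ m + s) v = 0
      rw [map_add, LinearMap.add_apply, h2, map_pow, aeval_X]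
      simp only [sub_smul, Finset.sum_sub_distrib]
      rw [h1]; abel)
  refine ⟨p, n, hp, fun P hP a => ?_⟩
  have h0 : (f ^ P - 1) ^ n = 0 := pow_sub_one_pow_eq_zero_of_dvd f hpn hP
  have h1 : ∀ (n : ℕ) (v : Additive A), (fun x => ⁅t ^ P, x⁆)^[n] (ι v.toMul) =
      ι (((f ^ P - 1) ^ n) v).toMul := by
    intro n
    induction n with
    | zero => intro v; rfl
    | succ n ih =>
      intro v
      rw [Function.iterate_succ_apply, pow_succ, Module.End.mul_apply, ← ih]
      congr 1
      rw [LinearMap.sub_apply, Module.End.one_apply, toMul_sub, _root_.map_div, hf, commutatorElement_def,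
        div_eq_mul_inv]
  have := h1 n (Additive.ofMul a)
  rw [h0] at this
  simpa using this

theorem mem_upperCentralSeries_succ_of_closure {L : Type*} [Group L] {S : Set L}
    (hS : Subgroup.closure S = ⊤) {j : ℕ} {x : L}
    (h : ∀ s ∈ S, ⁅x, s⁆ ∈ Subgroup.upperCentralSeries L j) :
    x ∈ Subgroup.upperCentralSeries L (j + 1) := by
  rw [Subgroup.mem_upperCentralSeries_succ_iff]
  intro y
  have hn : (Subgroup.upperCentralSeries L j).Normal := inferInstance
  have hy : y ∈ Subgroup.closure S := hS ▸ Subgroup.mem_top y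
  induction hy using Subgroup.closure_induction with
  | mem s hs => exact h s hs
  | one => simp
  | mul a b _ _ ha hb =>
    have : ⁅x, a * b⁆ = ⁅x, a⁆ * (a * ⁅x, b⁆ * a⁻¹) := by
      simp only [commutatorElement_def]; group
    rw [this]
    exact Subgroup.mul_mem _ ha (hn.conj_mem _ hb a)
  | inv a _ ha =>
    have : ⁅x, a⁻¹⁆ = a⁻¹ * ⁅x, a⁆⁻¹ * a⁻¹⁻¹ := by
      simp only [commutatorElement_def]; group
    rw [this]
    exact hn.conj_mem _ (Subgroup.inv_mem _ ha) a⁻¹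

theorem isNilpotent_of_chain {L : Type*} [Group L] (N : Subgroup L) (τ : L)
    (hgen : N ⊔ Subgroup.zpowers τ = ⊤) (c : ℕ) (F : ℕ → Subgroup L) (h0 : F 0 = ⊥) (hc : F c = N)
    (hcomm : ∀ i, ∀ x ∈ F (i + 1), ∀ n ∈ N, ⁅x, n⁆ ∈ F i)
    (hτ : ∀ i, ∀ x ∈ F (i + 1), ⁅τ, x⁆ ∈ F (i + 1))
    (hs : ∀ i, ∃ s : ℕ, ∀ x ∈ F (i + 1), (fun y => ⁅τ, y⁆)^[s] x ∈ F i) :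
    Group.IsNilpotent L := by
  have hclos : Subgroup.closure ((N : Set L) ∪ {τ}) = ⊤ := by
    rw [Subgroup.closure_union, Subgroup.closure_eq, ← Subgroup.zpowers_eq_closure, hgen]
  have hmono : ∀ {i j}, i ≤ j → Subgroup.upperCentralSeries L i ≤ Subgroup.upperCentralSeries L j :=
    fun h => Subgroup.upperCentralSeries_mono L h
  have key : ∀ i, ∃ j, F i ≤ Subgroup.upperCentralSeries L j := by
    intro i
    induction i with
    | zero => exact ⟨0, by rw [h0]; exact bot_le⟩
    | succ i ih =>
      obtain ⟨j, hj⟩ := ih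
      have h1 : ∀ s : ℕ, ∀ x ∈ F (i + 1), (fun y => ⁅τ, y⁆)^[s] x ∈ F i →
          x ∈ Subgroup.upperCentralSeries L (j + s) := by
        intro s
        induction s with
        | zero => intro x _ hx; exact hj hx
        | succ s ihs =>
          intro x hx hxs
          rw [Function.iterate_succ_apply] at hxs
          have h2 := ihs _ (hτ i x hx) hxs
          refine mem_upperCentralSeries_succ_of_closure hclos ?_
          rintro y (hy | hy)
          · exact hmono (Nat.le_add_right j s) (hj (hcomm i x hx y hy))
          · rw [Set.mem_singleton_iff] at hy
            subst hy
            rw [← commutatorElement_inv]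
            exact Subgroup.inv_mem _ h2
      obtain ⟨s, hs⟩ := hs i
      exact ⟨j + s, fun x hx => h1 s x hx (hs x hx)⟩
  obtain ⟨j, hj⟩ := key c
  rw [hc] at hj
  have hNτ : ∀ n ∈ N, ⁅τ, n⁆ ∈ Subgroup.upperCentralSeries L j := by
    intro n hn
    have : (Subgroup.upperCentralSeries L j).Normal := inferInstance
    rw [commutatorElement_def]
    exact Subgroup.mul_mem _ (this.conj_mem _ (hj hn) τ) (Subgroup.inv_mem _ (hj hn))
  have hτj : τ ∈ Subgroup.upperCentralSeries L (j + 1) := by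
    refine mem_upperCentralSeries_succ_of_closure hclos ?_
    rintro y (hy | hy)
    · exact hNτ y hy
    · rw [Set.mem_singleton_iff] at hy
      subst hy
      rw [commutatorElement_self]; exact Subgroup.one_mem _
  refine ⟨⟨j + 1, ?_⟩⟩
  rw [eq_top_iff, ← hgen]
  exact sup_le (hj.trans (hmono (Nat.le_succ j))) (Subgroup.zpowers_le.2 hτj)

theorem Subgroup.FG.map_hom {G Q : Type*} [Group G] [Group Q] {H : Subgroup G} (h : H.FG)
    (f : G →* Q) : (H.map f).FG := by
  obtain ⟨S, hS, hSf⟩ := (Subgroup.fg_iff _).1 h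
  exact (Subgroup.fg_iff _).2 ⟨f '' S, by rw [← MonoidHom.map_closure, hS], hSf.image f⟩

theorem exists_engel_power_section {D : ℕ} {G : Type*} [Group G] (hG : PolyGrowth D G)
    (A B : Subgroup G) [hB : B.Normal] [hA : A.Normal] (hfg : A.FG)
    (hcomm : ∀ x ∈ A, ∀ y ∈ A, ⁅x, y⁆ ∈ B) (t : G) :
    ∃ p s : ℕ, 0 < p ∧ ∀ P : ℕ, p ∣ P → ∀ a ∈ A, (fun x => ⁅t ^ P, x⁆)^[s] a ∈ B := by
  let Q := G ⧸ B
  let A' : Subgroup Q := A.map (QuotientGroup.mk' B)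
  have hA' : A'.Normal := hA.map _ (QuotientGroup.mk'_surjective B)
  let _ : CommGroup A' :=
    { (inferInstance : Group A') with
      mul_comm := by
        rintro ⟨_, x, hx, rfl⟩ ⟨_, y, hy, rfl⟩
        apply Subtype.ext
        change QuotientGroup.mk' B x * QuotientGroup.mk' B y =
          QuotientGroup.mk' B y * QuotientGroup.mk' B x
        rw [← commutatorElement_eq_one_iff_mul_comm, ← map_commutatorElement]
        exact (QuotientGroup.eq_one_iff _).2 (hcomm x hx y hy) }
  have hfg' : Group.FG A' := (Group.fg_iff_subgroup_fg _).2 (hfg.map_hom _)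
  obtain ⟨p, s, hp, h⟩ := exists_engel_power
    (hG.of_surjective (QuotientGroup.mk' B) (QuotientGroup.mk'_surjective B)) A'.subtype
    A'.subtype_injective (QuotientGroup.mk' B t) (MulAut.conjNormal (QuotientGroup.mk' B t))
    (fun a => MulAut.conjNormal_apply _ _)
  refine ⟨p, s, hp, fun P hP a ha => ?_⟩
  have h1 := h P hP ⟨QuotientGroup.mk' B a, a, ha, rfl⟩
  have h2 : ∀ (s : ℕ) (a : G), (fun x => ⁅(QuotientGroup.mk' B t) ^ P, x⁆)^[s]
      (QuotientGroup.mk' B a) = QuotientGroup.mk' B ((fun x => ⁅t ^ P, x⁆)^[s] a) := by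
    intro s
    induction s with
    | zero => intro a; rfl
    | succ s ih =>
      intro a
      rw [Function.iterate_succ_apply, Function.iterate_succ_apply, ← ih, map_commutatorElement,
        map_pow]
  exact (QuotientGroup.eq_one_iff _).1 ((h2 s a).symm.trans h1)

theorem exists_isNilpotent_sup_zpowers {D : ℕ} {G : Type*} [Group G] (hG : PolyGrowth D G)
    (N : Subgroup G) [hN : N.Normal] [hnil : Group.IsNilpotent N] (hfg : AllSubgroupsFG N) (t : G) :
    ∃ p : ℕ, 0 < p ∧ Group.IsNilpotent ↥(N ⊔ Subgroup.zpowers (t ^ p)) := by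
  obtain ⟨c, hc⟩ := hnil.nilpotent'
  let F : ℕ → Subgroup G := fun i => (Subgroup.upperCentralSeries N i).map N.subtype
  have hFn : ∀ i, (F i).Normal := fun i => ConjAct.normal_of_characteristic_of_normal
  have hFN : ∀ i, F i ≤ N := fun i => Subgroup.map_subtype_le _
  have hFmono : ∀ i, F i ≤ F (i + 1) := fun i =>
    Subgroup.map_mono (Subgroup.upperCentralSeries_mono N (Nat.le_succ i))
  have hcomm : ∀ i, ∀ x ∈ F (i + 1), ∀ n ∈ N, ⁅x, n⁆ ∈ F i := by
    rintro i _ ⟨x, hx, rfl⟩ n hn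
    exact ⟨⁅x, ⟨n, hn⟩⁆, Subgroup.mem_upperCentralSeries_succ_iff.1 hx _, rfl⟩
  choose p s hp hps using fun i => exists_engel_power_section hG (F (i + 1)) (F i)
    ((hfg _).map_hom _) (fun x hx y hy => hcomm i x hx y (hFN _ hy)) t
  let P := ∏ i ∈ Finset.range c, p i
  refine ⟨P, Finset.prod_pos fun i _ => hp i, ?_⟩
  set L := N ⊔ Subgroup.zpowers (t ^ P) with hL
  have hNL : N ≤ L := le_sup_left
  have htL : t ^ P ∈ L := (le_sup_right : _ ≤ L) (Subgroup.mem_zpowers _)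
  refine isNilpotent_of_chain (N.subgroupOf L) ⟨t ^ P, htL⟩ ?_ c
    (fun i => (F (min i c)).subgroupOf L) ?_ ?_ ?_ ?_ ?_
  · rw [eq_top_iff]
    rintro ⟨x, hx⟩ -
    have h1 : L ≤ (N.subgroupOf L ⊔ Subgroup.zpowers (⟨t ^ P, htL⟩ : L)).map L.subtype := by
      rw [Subgroup.map_sup, Subgroup.subgroupOf_map_subtype, inf_of_le_left hNL,
        MonoidHom.map_zpowers]
      exact le_rfl
    obtain ⟨y, hy, hyx⟩ := h1 hx
    have : y = ⟨x, hx⟩ := Subtype.ext hyx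
    rwa [← this]
  · simp [F]
  · simp only [min_self, F, hc]
    rw [← MonoidHom.range_eq_map, Subgroup.range_subtype]
  · rintro i x hx n hn
    rw [Subgroup.mem_subgroupOf] at *
    rcases le_or_gt (i + 1) c with h | h
    · rw [min_eq_left h] at hx
      rw [min_eq_left (by omega)]
      exact hcomm i _ hx _ hn
    · rw [min_eq_right (by omega)] at hx ⊢
      have := (hFn c)
      change (x : G) * n * (x : G)⁻¹ * (n : G)⁻¹ ∈ F c
      rw [mul_assoc, mul_assoc, ← mul_assoc (n : G)]
      exact Subgroup.mul_mem _ hx (this.conj_mem _ (Subgroup.inv_mem _ hx) _)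
  · rintro i x hx
    rw [Subgroup.mem_subgroupOf] at *
    have := (hFn (min (i + 1) c))
    exact Subgroup.mul_mem _ (this.conj_mem _ hx _) (Subgroup.inv_mem _ hx)
  · intro i
    have hit : ∀ (s : ℕ) (x : L), (((fun y => ⁅(⟨t ^ P, htL⟩ : L), y⁆)^[s] x : L) : G) =
        (fun y => ⁅t ^ P, y⁆)^[s] (x : G) := by
      intro s
      induction s with
      | zero => intro x; rfl
      | succ s ih => intro x; rw [Function.iterate_succ_apply, Function.iterate_succ_apply, ih]; rfl
    by_cases h : i < c
    · refine ⟨s i, fun x hx => ?_⟩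
      rw [Subgroup.mem_subgroupOf] at *
      rw [min_eq_left (by omega)] at hx ⊢
      rw [hit]
      exact hps i P (Finset.dvd_prod_of_mem _ (Finset.mem_range.2 h)) _ hx
    · refine ⟨0, fun x hx => ?_⟩
      rw [min_eq_right (by omega)] at hx ⊢
      exact hx

theorem Subgroup.fg_of_fg_map_of_fg_inf_ker {G Q : Type*} [Group G] [Group Q] (f : G →* Q)
    (H : Subgroup G) (h1 : (H.map f).FG) (h2 : (H ⊓ f.ker).FG) : H.FG := by
  obtain ⟨S, hS, hSf⟩ := (Subgroup.fg_iff _).1 h1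
  have hsub : ∀ s ∈ S, ∃ g ∈ H, f g = s := fun s hs => by
    have : s ∈ H.map f := hS ▸ Subgroup.subset_closure hs
    exact this
  choose! σ hσ1 hσ2 using hsub
  have h3 : (Subgroup.closure (σ '' S)).FG := (Subgroup.fg_iff _).2 ⟨_, rfl, hSf.image _⟩
  have h4 : H = Subgroup.closure (σ '' S) ⊔ (H ⊓ f.ker) := by
    refine le_antisymm (fun g hg => ?_) (sup_le ?_ inf_le_left)
    · have hm : (Subgroup.closure (σ '' S)).map f = H.map f := by
        rw [MonoidHom.map_closure, ← hS, Set.image_image]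
        congr 1
        exact (Set.image_congr hσ2).trans (Set.image_id S)
      obtain ⟨a, ha, hag⟩ : f g ∈ (Subgroup.closure (σ '' S)).map f := hm ▸ ⟨g, hg, rfl⟩
      have haH : a ∈ H := by
        have : Subgroup.closure (σ '' S) ≤ H := by
          rw [Subgroup.closure_le]
          rintro _ ⟨s, hs, rfl⟩
          exact hσ1 s hs
        exact this ha
      have : g = a * (a⁻¹ * g) := by group
      rw [this]
      refine Subgroup.mul_mem_sup ha ⟨Subgroup.mul_mem _ (Subgroup.inv_mem _ haH) hg, ?_⟩
      change a⁻¹ * g ∈ f.ker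
      rw [MonoidHom.mem_ker, map_mul, map_inv, hag]; simp
    · rw [Subgroup.closure_le]
      rintro _ ⟨s, hs, rfl⟩
      exact hσ1 s hs
  rw [h4]
  exact h3.sup h2

theorem AllSubgroupsFG.of_injective {G Q : Type*} [Group G] [Group Q] (h : AllSubgroupsFG Q)
    (f : G →* Q) (hf : Function.Injective f) : AllSubgroupsFG G := by
  intro H
  refine Subgroup.fg_of_fg_map_of_fg_inf_ker f H (h _) ?_
  rw [(MonoidHom.ker_eq_bot_iff f).2 hf, inf_bot_eq]
  exact Subgroup.FG.bot

theorem AllSubgroupsFG.of_hom_int {G : Type*} [Group G] (φ : G →* Multiplicative ℤ)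
    (h : AllSubgroupsFG φ.ker) : AllSubgroupsFG G := by
  intro H
  refine Subgroup.fg_of_fg_map_of_fg_inf_ker φ H ?_ ?_
  · have : IsCyclic (H.map φ) := inferInstance
    obtain ⟨g, hg⟩ := (Subgroup.isCyclic_iff_exists_zpowers_eq_top _).1 this
    rw [← hg]
    exact (Subgroup.fg_iff _).2 ⟨{g}, (Subgroup.zpowers_eq_closure g).symm, Set.finite_singleton _⟩
  · have := (h (H.subgroupOf φ.ker)).map_hom φ.ker.subtype
    rwa [Subgroup.subgroupOf_map_subtype] at this

theorem AllSubgroupsFG.of_finiteIndex {G : Type*} [Group G] (K : Subgroup G) [K.FiniteIndex]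
    (h : AllSubgroupsFG K) : AllSubgroupsFG G := by
  intro H
  have h1 : (H ⊓ K).FG := by
    have := (h (H.subgroupOf K)).map_hom K.subtype
    rwa [Subgroup.subgroupOf_map_subtype] at this
  have : (K.subgroupOf H).FiniteIndex := inferInstance
  have hfin : Finite (H ⧸ K.subgroupOf H) := inferInstance
  let r : H ⧸ K.subgroupOf H → G := fun q => (q.out : H)
  have h2 : (Subgroup.closure (Set.range r)).FG :=
    (Subgroup.fg_iff _).2 ⟨_, rfl, Set.finite_range r⟩
  have h3 : H = Subgroup.closure (Set.range r) ⊔ (H ⊓ K) := by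
    refine le_antisymm (fun g hg => ?_) (sup_le ?_ inf_le_left)
    · let q : H ⧸ K.subgroupOf H := QuotientGroup.mk ⟨g, hg⟩
      have h4 : (q.out)⁻¹ * (⟨g, hg⟩ : H) ∈ K.subgroupOf H :=
        QuotientGroup.eq.1 (QuotientGroup.out_eq' q)
      have h5 : g = r q * ((r q)⁻¹ * g) := by group
      rw [h5]
      exact Subgroup.mul_mem_sup (Subgroup.subset_closure ⟨q, rfl⟩)
        ⟨Subgroup.mul_mem _ (Subgroup.inv_mem _ (q.out).2) hg, h4⟩
    · rw [Subgroup.closure_le]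
      rintro _ ⟨q, rfl⟩
      exact (q.out).2
  rw [h3]
  exact h2.sup h1

theorem finite_monoidHom_of_fg {K Q : Type*} [Group K] [Group Q] [Finite Q] [hK : Group.FG K] :
    Finite (K →* Q) := by
  obtain ⟨S, hS, hSf⟩ := Group.fg_iff.1 hK
  have : Finite S := hSf
  refine Finite.of_injective (fun (f : K →* Q) (s : S) => f s) fun f g hfg => ?_
  exact MonoidHom.eq_of_eqOn_dense hS fun s hs => congrFun hfg ⟨s, hs⟩

theorem exists_characteristic_le {K : Type*} [Group K] [Group.FG K] (H : Subgroup K)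
    [H.FiniteIndex] : ∃ N : Subgroup K, N.Characteristic ∧ N.FiniteIndex ∧ N ≤ H := by
  have : Finite (K →* Equiv.Perm (K ⧸ H)) := finite_monoidHom_of_fg
  refine ⟨⨅ f : K →* Equiv.Perm (K ⧸ H), f.ker, ?_, ?_, ?_⟩
  · rw [Subgroup.characteristic_iff_le_comap]
    intro ϕ x hx
    rw [Subgroup.mem_iInf] at hx
    rw [Subgroup.mem_comap, Subgroup.mem_iInf]
    exact fun f => hx (f.comp ϕ.toMonoidHom)
  · exact Subgroup.finiteIndex_iInf fun f => Subgroup.finiteIndex_ker f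
  · intro x hx
    rw [Subgroup.mem_iInf] at hx
    have h1 := hx (MulAction.toPermHom K (K ⧸ H))
    rw [MonoidHom.mem_ker] at h1
    have h2 : x • ((1 : K) : K ⧸ H) = ((1 : K) : K ⧸ H) := by
      have := congrArg (fun e : Equiv.Perm (K ⧸ H) => e ((1 : K) : K ⧸ H)) h1
      exact this
    have h3 : ((x * 1 : K) : K ⧸ H) = ((1 : K) : K ⧸ H) := h2
    rw [QuotientGroup.eq] at h3
    simpa using h3

theorem Group.isNilpotent_of_injective {G Q : Type*} [Group G] [Group Q] [Group.IsNilpotent Q]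
    (f : G →* Q) (hf : Function.Injective f) : Group.IsNilpotent G :=
  Subgroup.isNilpotent_of_ker_le_center f
    (by rw [(MonoidHom.ker_eq_bot_iff f).2 hf]; exact bot_le)

theorem isVirtuallyNilpotent_of_hom_int {D : ℕ} {G : Type*} [Group G] [Group.FG G]
    (hG : PolyGrowth D G) (φ : G →* Multiplicative ℤ) (t : G) (ht : φ t = Multiplicative.ofAdd 1)
    (hvn : IsVirtuallyNilpotent φ.ker) (hfg : AllSubgroupsFG φ.ker) : IsVirtuallyNilpotent G := by
  have hK : Group.FG φ.ker := (Group.fg_iff_subgroup_fg _).2 (ker_fg_of_polyGrowth hG φ t ht)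
  obtain ⟨H, hH, hHn⟩ := hvn
  obtain ⟨N₀, hN₀, hN₀f, hN₀H⟩ := exists_characteristic_le H
  let N : Subgroup G := N₀.map φ.ker.subtype
  have hN : N.Normal := ConjAct.normal_of_characteristic_of_normal
  have hNK : N ≤ φ.ker := Subgroup.map_subtype_le _
  have hN₀n : Group.IsNilpotent N₀ :=
    Group.isNilpotent_of_injective (Subgroup.inclusion hN₀H) (Subgroup.inclusion_injective _)
  have hNn : Group.IsNilpotent N :=
    Group.nilpotent_of_mulEquiv (N₀.equivMapOfInjective φ.ker.subtype φ.ker.subtype_injective)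
  obtain ⟨p, hp, hL⟩ := exists_isNilpotent_sup_zpowers hG N
    (hfg.of_injective (Subgroup.inclusion hNK) (Subgroup.inclusion_injective _)) t
  refine ⟨_, ?_, hL⟩
  set L := N ⊔ Subgroup.zpowers (t ^ p)
  have hfin : Finite (φ.ker ⧸ N₀) := inferInstance
  let r : Fin p × (φ.ker ⧸ N₀) → G ⧸ L := fun x =>
    QuotientGroup.mk (t ^ (x.1 : ℕ) * ((x.2.out : φ.ker) : G))
  have hr : Function.Surjective r := by
    intro q
    obtain ⟨g, rfl⟩ := QuotientGroup.mk_surjective q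
    let m : ℤ := Multiplicative.toAdd (φ g)
    have hp0 : (p : ℤ) ≠ 0 := by exact_mod_cast hp.ne'
    obtain ⟨b, hb⟩ := Int.eq_ofNat_of_zero_le (Int.emod_nonneg m hp0)
    have hbp : b < p := by
      have := Int.emod_lt_of_pos m (by exact_mod_cast hp : (0 : ℤ) < p)
      omega
    have hφt : ∀ k : ℤ, φ (t ^ k) = Multiplicative.ofAdd k := by
      intro k
      rw [map_zpow, ht, ← ofAdd_zsmul]; simp
    have hm : m = b + p * (m / p) := by rw [← hb]; exact (Int.emod_add_mul_ediv m p).symm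
    let k' : G := t ^ (-(b : ℤ)) * g * t ^ (-((p : ℤ) * (m / p)))
    have hk' : k' ∈ φ.ker := by
      rw [MonoidHom.mem_ker, map_mul, map_mul, hφt, hφt]
      have : φ g = Multiplicative.ofAdd m := rfl
      rw [this, ← ofAdd_add, ← ofAdd_add, ← ofAdd_zero]
      congr 1
      omega
    refine ⟨(⟨b, hbp⟩, QuotientGroup.mk ⟨k', hk'⟩), ?_⟩
    change (QuotientGroup.mk _ : G ⧸ L) = _
    rw [QuotientGroup.eq]
    have h1 : (Quotient.out (QuotientGroup.mk ⟨k', hk'⟩ : φ.ker ⧸ N₀))⁻¹ * ⟨k', hk'⟩ ∈ N₀ :=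
      QuotientGroup.eq.1 (QuotientGroup.out_eq' _)
    set o := Quotient.out (QuotientGroup.mk ⟨k', hk'⟩ : φ.ker ⧸ N₀)
    have h2 : (t ^ b * (o : G))⁻¹ * g = ((o : G)⁻¹ * k') * (t ^ p) ^ (m / p) := by
      simp only [k']
      rw [← zpow_natCast t p, ← zpow_mul]
      group
    change (t ^ b * (o : G))⁻¹ * g ∈ L
    rw [h2]
    exact Subgroup.mul_mem_sup ⟨_, h1, rfl⟩ (Subgroup.zpow_mem _ (Subgroup.mem_zpowers _) _)
  have : Finite (G ⧸ L) := Finite.of_surjective r hr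
  exact Subgroup.finiteIndex_of_finite_quotient

theorem IsVirtuallyNilpotent.of_finiteIndex {G : Type*} [Group G] (K : Subgroup G)
    [hK : K.FiniteIndex] (h : IsVirtuallyNilpotent K) : IsVirtuallyNilpotent G := by
  obtain ⟨H, hH, hn⟩ := h
  refine ⟨H.map K.subtype, ?_, ?_⟩
  · refine ⟨?_⟩
    rw [Subgroup.index_map]
    simp [hH.index_ne_zero, hK.index_ne_zero]
  · exact Group.nilpotent_of_mulEquiv (H.equivMapOfInjective K.subtype K.subtype_injective)

theorem IsVirtuallyNilpotent.of_injective {G Q : Type*} [Group G] [Group Q]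
    (h : IsVirtuallyNilpotent Q) (f : G →* Q) (hf : Function.Injective f) :
    IsVirtuallyNilpotent G := by
  obtain ⟨H, hH, hn⟩ := h
  refine ⟨H.comap f, ⟨?_⟩, ?_⟩
  · rw [Subgroup.index_comap]
    exact (inferInstance : (H.subgroupOf f.range).FiniteIndex).index_ne_zero
  exact Group.isNilpotent_of_injective (f.subgroupComap H)
    fun x y hxy => Subtype.ext (hf (congrArg Subtype.val hxy))

theorem exists_finite_subset_mem_closure {G : Type*} [Group G] {U : Set G} {x : G}
    (hx : x ∈ Subgroup.closure U) : ∃ F ⊆ U, F.Finite ∧ x ∈ Subgroup.closure F := by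
  induction hx using Subgroup.closure_induction with
  | mem s hs => exact ⟨{s}, by simpa, Set.finite_singleton s, Subgroup.subset_closure rfl⟩
  | one => exact ⟨∅, Set.empty_subset _, Set.finite_empty, Subgroup.one_mem _⟩
  | mul a b _ _ ha hb =>
    obtain ⟨F, h1, h2, h3⟩ := ha
    obtain ⟨F', h1', h2', h3'⟩ := hb
    exact ⟨F ∪ F', Set.union_subset h1 h1', h2.union h2', Subgroup.mul_mem _
      (Subgroup.closure_mono Set.subset_union_left h3)
      (Subgroup.closure_mono Set.subset_union_right h3')⟩
  | inv a _ ha =>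
    obtain ⟨F, h1, h2, h3⟩ := ha
    exact ⟨F, h1, h2, Subgroup.inv_mem _ h3⟩

theorem exists_finite_subset_closure_eq {G : Type*} [Group G] {U : Set G}
    (h : (Subgroup.closure U).FG) :
    ∃ F ⊆ U, F.Finite ∧ Subgroup.closure F = Subgroup.closure U := by
  obtain ⟨S, hS, hSf⟩ := (Subgroup.fg_iff _).1 h
  have h1 : ∀ s ∈ S, ∃ F ⊆ U, F.Finite ∧ s ∈ Subgroup.closure F := fun s hs =>
    exists_finite_subset_mem_closure (hS ▸ Subgroup.subset_closure hs)
  choose! F h1 h2 h3 using h1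
  refine ⟨⋃ s ∈ S, F s, Set.iUnion₂_subset h1, hSf.biUnion h2, le_antisymm ?_ ?_⟩
  · exact Subgroup.closure_mono (Set.iUnion₂_subset h1)
  · rw [← hS, Subgroup.closure_le]
    exact fun s hs => Subgroup.closure_mono (Set.subset_biUnion_of_mem hs) (h3 s hs)

section Displacement

variable {G : Type*} [Group G] {A : Type*} [NormedRing A] (ρ : G →* A)

theorem MonoidHom.map_mul_map_inv_cancel (a : G) : ρ a * ρ a⁻¹ = 1 := by
  rw [← map_mul, mul_inv_cancel, map_one]

theorem MonoidHom.map_inv_mul_map_cancel (a : G) : ρ a⁻¹ * ρ a = 1 := by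
  rw [← map_mul, inv_mul_cancel, map_one]

variable {ρ}

theorem norm_map_mul_le (hρ : ∀ g, ‖ρ g‖ ≤ 1) (a : G) (x : A) : ‖ρ a * x‖ ≤ ‖x‖ :=
  (norm_mul_le _ _).trans (mul_le_of_le_one_left (norm_nonneg _) (hρ a))

theorem norm_mul_map_le (hρ : ∀ g, ‖ρ g‖ ≤ 1) (a : G) (x : A) : ‖x * ρ a‖ ≤ ‖x‖ :=
  (norm_mul_le _ _).trans (mul_le_of_le_one_right (norm_nonneg _) (hρ a))

theorem norm_map_inv_sub_one_le (hρ : ∀ g, ‖ρ g‖ ≤ 1) (a : G) : ‖ρ a⁻¹ - 1‖ ≤ ‖ρ a - 1‖ := by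
  have h := norm_map_mul_le hρ a⁻¹ (1 - ρ a)
  rwa [mul_sub, mul_one, ρ.map_inv_mul_map_cancel, norm_sub_rev 1] at h

theorem norm_map_mul_sub_one_le (hρ : ∀ g, ‖ρ g‖ ≤ 1)
    (a b : G) : ‖ρ (a * b) - 1‖ ≤ ‖ρ a - 1‖ + ‖ρ b - 1‖ := by
  have h : ρ (a * b) - 1 = ρ a * (ρ b - 1) + (ρ a - 1) := by rw [map_mul]; noncomm_ring
  rw [h, add_comm ‖ρ a - 1‖]
  exact (norm_add_le _ _).trans (add_le_add_left (norm_map_mul_le hρ a _) _)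

theorem norm_map_pow_sub_one_le (hρ : ∀ g, ‖ρ g‖ ≤ 1)
    (a : G) (n : ℕ) : ‖ρ (a ^ n) - 1‖ ≤ n * ‖ρ a - 1‖ := by
  induction n with
  | zero => simp
  | succ n ih =>
    rw [pow_succ]
    have := norm_map_mul_sub_one_le hρ (a ^ n) a
    push_cast
    linarith

theorem norm_map_commutator_sub_one_le (hρ : ∀ g, ‖ρ g‖ ≤ 1) (a b : G) :
    ‖ρ ⁅a, b⁆ - 1‖ ≤ 2 * ‖ρ a - 1‖ * ‖ρ b - 1‖ := by
  have h1 : ρ ⁅a, b⁆ - 1 =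
      ((ρ a - 1) * (ρ b - 1) - (ρ b - 1) * (ρ a - 1)) * ρ (a⁻¹ * b⁻¹) := by
    have h2 : (ρ a - 1) * (ρ b - 1) - (ρ b - 1) * (ρ a - 1) = ρ a * ρ b - ρ b * ρ a := by
      noncomm_ring
    rw [h2, sub_mul, ← map_mul, ← map_mul, ← map_mul, ← map_mul, commutatorElement_def]
    rw [show b * a * (a⁻¹ * b⁻¹) = 1 by group, map_one]
    simp only [mul_assoc]
  rw [h1]
  refine (norm_mul_map_le hρ _ _).trans ((norm_sub_le _ _).trans ?_)
  have h3 := norm_mul_le (ρ a - 1) (ρ b - 1)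
  have h4 := norm_mul_le (ρ b - 1) (ρ a - 1)
  linarith

theorem norm_map_commutator_sub_one_le' (hρ : ∀ g, ‖ρ g‖ ≤ 1)
    (a b : G) : ‖ρ ⁅a, b⁆ - 1‖ ≤ 2 * ‖ρ b - 1‖ := by
  have h := norm_map_mul_sub_one_le hρ (a * b * a⁻¹) b⁻¹
  have h1 : ρ (a * b * a⁻¹) - 1 = ρ a * (ρ b - 1) * ρ a⁻¹ := by
    rw [map_mul, map_mul, mul_sub, sub_mul, mul_one, ρ.map_mul_map_inv_cancel]
  have h2 := (norm_mul_map_le hρ a⁻¹ (ρ a * (ρ b - 1))).trans (norm_map_mul_le hρ a _)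
  rw [← h1] at h2
  have h3 := norm_map_inv_sub_one_le hρ b
  rw [commutatorElement_def]
  linarith

variable [NormedAlgebra ℝ A]

theorem half_norm_sub_one_le (hρ : ∀ g, ‖ρ g‖ ≤ 1)
    (a : G) (n : ℕ) (hn : 0 < n) (h : n * ‖ρ a - 1‖ ≤ 1 / 2) :
    ‖ρ a - 1‖ / 2 ≤ ‖ρ (a ^ n) - 1‖ := by
  have key : ∀ m : ℕ, m ≤ n → ‖(ρ (a ^ m) - 1) - m • (ρ a - 1)‖ ≤ m * (‖ρ a - 1‖ / 2) := by
    intro m hm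
    induction m with
    | zero => simp
    | succ m ih =>
      have h1 : (ρ (a ^ (m + 1)) - 1) - (m + 1) • (ρ a - 1) =
          (ρ (a ^ m) - 1) * (ρ a - 1) + ((ρ (a ^ m) - 1) - m • (ρ a - 1)) := by
        rw [pow_succ, map_mul, add_smul, one_smul]; noncomm_ring
      rw [h1]
      have h2 := norm_map_pow_sub_one_le hρ a m
      have h3 : (m : ℝ) ≤ n := by exact_mod_cast (Nat.le_succ m).trans hm
      have h4 : ‖ρ (a ^ m) - 1‖ ≤ 1 / 2 :=
        h2.trans ((mul_le_mul_of_nonneg_right h3 (norm_nonneg _)).trans h)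
      have h5 := norm_mul_le (ρ (a ^ m) - 1) (ρ a - 1)
      have h6 := mul_le_mul_of_nonneg_right h4 (norm_nonneg (ρ a - 1))
      refine (norm_add_le _ _).trans ?_
      have := ih (by omega)
      push_cast
      linarith
  have h1 := key n le_rfl
  have h2 : ‖n • (ρ a - 1)‖ = n * ‖ρ a - 1‖ := by
    rw [← Nat.cast_smul_eq_nsmul ℝ, norm_smul]; simp
  have h3 := norm_sub_norm_le (n • (ρ a - 1)) (ρ (a ^ n) - 1)
  rw [norm_sub_rev] at h1
  have h4 : (1 : ℝ) ≤ n := by exact_mod_cast hn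
  have h5 := mul_le_mul_of_nonneg_right h4 (norm_nonneg (ρ a - 1))
  linarith

theorem map_eq_one_of_pow_near (a : G) (h : ∀ n : ℕ, ‖ρ (a ^ n) - 1‖ ≤ 1 / 2) : ρ a = 1 := by
  have key : ∀ k : ℕ, (3 / 2 : ℝ) ^ k * ‖ρ a - 1‖ ≤ ‖ρ (a ^ 2 ^ k) - 1‖ := by
    intro k
    induction k with
    | zero => simp
    | succ k ih =>
      set b := a ^ 2 ^ k with hb
      have h1 : a ^ 2 ^ (k + 1) = b * b := by rw [hb, ← pow_add, pow_succ]; ring_nf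
      have h2 : (2 : ℝ) • (ρ b - 1) = (ρ (b * b) - 1) - (ρ b - 1) * (ρ b - 1) := by
        rw [map_mul, two_smul]; noncomm_ring
      have h3 : ‖(2 : ℝ) • (ρ b - 1)‖ = 2 * ‖ρ b - 1‖ := by rw [norm_smul]; simp
      have h4 := norm_sub_le (ρ (b * b) - 1) ((ρ b - 1) * (ρ b - 1))
      rw [← h2, h3] at h4
      have h5 := norm_mul_le (ρ b - 1) (ρ b - 1)
      have h6 := mul_le_mul_of_nonneg_right (h (2 ^ k)) (norm_nonneg (ρ b - 1))
      rw [← hb] at h6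
      rw [h1, pow_succ]
      linarith
  by_contra hne
  have hpos : 0 < ‖ρ a - 1‖ := norm_pos_iff.2 (sub_ne_zero.2 hne)
  obtain ⟨k, hk⟩ := pow_unbounded_of_one_lt (1 / ‖ρ a - 1‖) (by norm_num : (1 : ℝ) < 3 / 2)
  rw [div_lt_iff₀ hpos] at hk
  linarith [key k, h (2 ^ k)]

theorem exists_finset_words (hρ : ∀ g, ‖ρ g‖ ≤ 1)
    {F : Set G} (h1F : 1 ∈ F) {M : ℕ} {ε : ℝ} (hM : 32 * M * ε ≤ 1)
    (hε : 0 ≤ ε) (m : ℕ) :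
    ∀ (L : ℕ) (h : ℕ → G), (∀ k, h k ∈ F ^ (L * 2 ^ k)) → (∀ k, 0 < ‖ρ (h k) - 1‖) →
      (∀ k, ‖ρ (h (k + 1)) - 1‖ ≤ 2 * ε * ‖ρ (h k) - 1‖) → ‖ρ (h 0) - 1‖ ≤ ε →
      ∃ T : Finset G, T.card = M ^ m ∧
        ∀ w ∈ T, ‖ρ w - 1‖ ≤ 2 * M * ‖ρ (h 0) - 1‖ ∧ w ∈ F ^ (L * M * (2 ^ m - 1)) := by
  classical
  induction m with
  | zero =>
    intro L h _ _ _ _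
    refine ⟨{1}, by simp, fun w hw => ?_⟩
    rw [Finset.mem_singleton] at hw
    subst hw
    simp only [map_one, sub_self, norm_zero]
    exact ⟨by positivity, by simp⟩
  | succ m ih =>
    intro L h hF hpos hstep h0
    rcases Nat.eq_zero_or_pos M with rfl | hMpos
    · exact ⟨∅, by simp, by simp⟩
    have hM1 : (1 : ℝ) ≤ M := by exact_mod_cast hMpos
    have hMε : ε ≤ M * ε := le_mul_of_one_le_left hε hM1
    obtain ⟨T, hTc, hT⟩ := ih (2 * L) (fun k => h (k + 1))
      (fun k => by have := hF (k + 1); rwa [pow_succ', ← mul_assoc, mul_comm L] at this)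
      (fun k => hpos _) (fun k => hstep _) (by
        have := hstep 0
        have h2 := mul_le_mul_of_nonneg_right (by linarith : 2 * ε ≤ 1)
          (norm_nonneg (ρ (h 0) - 1))
        simp only [zero_add] at this ⊢
        linarith)
    have h1 : ‖ρ (h 1) - 1‖ ≤ 2 * ε * ‖ρ (h 0) - 1‖ := hstep 0
    have hMδ : M * (2 * ε * ‖ρ (h 0) - 1‖) ≤ 1 / 16 * ‖ρ (h 0) - 1‖ := by
      have := mul_le_mul_of_nonneg_right (by linarith : M * (2 * ε) ≤ 1 / 16)
          (norm_nonneg (ρ (h 0) - 1))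
      linarith
    have hwT : ∀ w ∈ T, ‖ρ w - 1‖ ≤ 1 / 8 * ‖ρ (h 0) - 1‖ := fun w hw => by
      have h2 := (hT w hw).1
      have h3 := mul_le_mul_of_nonneg_left h1 (by linarith : (0 : ℝ) ≤ M)
      simp only [zero_add] at h2
      linarith
    have hpw : ∀ i : ℕ, i < M → i * ‖ρ (h 0) - 1‖ ≤ 1 / 2 := fun i hi => by
      have h2 : (i : ℝ) ≤ M := by exact_mod_cast hi.le
      have h3 := mul_le_mul h2 h0 (norm_nonneg _) (by linarith)
      linarith
    have hne : ∀ i j : ℕ, j < i → i < M → ∀ w ∈ T, ∀ w' ∈ T, h 0 ^ i * w ≠ h 0 ^ j * w' := by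
      intro i j hij hi w hw w' hw' heq
      have h2 : h 0 ^ (i - j) = w' * w⁻¹ := by
        rw [pow_sub _ hij.le]
        have h3 : w' = (h 0 ^ j)⁻¹ * (h 0 ^ i * w) := by rw [heq]; group
        rw [h3]
        rw [mul_assoc, mul_assoc, mul_inv_cancel, mul_one, ← pow_sub _ hij.le, ← zpow_natCast,
          ← zpow_natCast (h 0) j, ← zpow_natCast (h 0) i, ← zpow_neg, ← zpow_add]
        congr 1
        omega
      have h3 := half_norm_sub_one_le hρ (h 0) (i - j) (by omega) (hpw _ (by omega))
      rw [h2] at h3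
      have h4 := norm_map_mul_sub_one_le hρ w' w⁻¹
      have h5 := norm_map_inv_sub_one_le hρ w
      have h6 := hwT w hw
      have h7 := hwT w' hw'
      have h8 := hpos 0
      linarith
    refine ⟨(Finset.range M ×ˢ T).image fun x => h 0 ^ x.1 * x.2, ?_, ?_⟩
    · rw [Finset.card_image_of_injOn, Finset.card_product, Finset.card_range, hTc, pow_succ']
      rintro ⟨i, w⟩ hx ⟨j, w'⟩ hy heq
      simp only [Finset.coe_product, Set.mem_prod, Finset.mem_coe, Finset.mem_range] at hx hy heq
      rcases lt_trichotomy i j with hij | rfl | hij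
      · exact absurd heq.symm (hne j i hij hy.1 w' hy.2 w hx.2)
      · rw [mul_left_cancel heq]
      · exact absurd heq (hne i j hij hx.1 w hx.2 w' hy.2)
    · intro x hx
      obtain ⟨⟨i, w⟩, hiw, rfl⟩ := Finset.mem_image.1 hx
      rw [Finset.mem_product, Finset.mem_range] at hiw
      constructor
      · have h2 := norm_map_mul_sub_one_le hρ (h 0 ^ i) w
        have h3 := norm_map_pow_sub_one_le hρ (h 0) i
        have h4 : (i : ℝ) * ‖ρ (h 0) - 1‖ ≤ M * ‖ρ (h 0) - 1‖ :=
          mul_le_mul_of_nonneg_right (by exact_mod_cast hiw.1.le) (norm_nonneg _)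
        have h5 := hwT w hiw.2
        have h6 := mul_le_mul_of_nonneg_right hM1 (norm_nonneg (ρ (h 0) - 1))
        have h7 := norm_nonneg (ρ (h 0) - 1)
        simp only
        linarith
      · have h2 : h 0 ^ i ∈ F ^ (L * M) := by
          have h3 : h 0 ^ i ∈ F ^ (L * i) := by
            rw [pow_mul]
            exact Set.pow_mem_pow (by simpa using hF 0)
          exact Set.pow_subset_pow_right h1F (Nat.mul_le_mul_left L hiw.1.le) h3
        have h3 := Set.mul_mem_mul h2 (hT w hiw.2).2
        rw [← pow_add] at h3
        convert h3 using 2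
        obtain ⟨a, ha⟩ : ∃ a, 2 ^ m = a + 1 := ⟨2 ^ m - 1, by have := Nat.one_le_two_pow (n := m); omega⟩
        rw [pow_succ, ha]
        have : (a + 1) * 2 - 1 = 1 + 2 * a := by omega
        rw [this, Nat.add_sub_cancel]
        ring

end Displacement

theorem exists_commuting_closure {D : ℕ} {G : Type*} [Group G] (hG : PolyGrowth D G)
    {A : Type*} [NormedRing A] [NormedAlgebra ℝ A] (ρ : G →* A) (hρ : ∀ g, ‖ρ g‖ ≤ 1) :
    ∃ ε : ℝ, 0 < ε ∧ ∀ F : Set G, F.Finite → (∀ g ∈ F, ‖ρ g - 1‖ ≤ ε) →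
      ∀ g ∈ F, ∀ h ∈ F, ρ ⁅g, h⁆ = 1 := by
  classical
  set M : ℕ := 2 ^ (D + 1) with hM
  have hMpos : (0 : ℝ) < M := by positivity
  refine ⟨1 / (32 * M), by positivity, ?_⟩
  set ε : ℝ := 1 / (32 * M) with hεdef
  have hε : 0 < ε := by positivity
  have hMε : 32 * M * ε ≤ 1 := by rw [hεdef]; field_simp; rfl
  have hε1 : 2 * ε ≤ 1 / 2 := by
    have : (1 : ℝ) ≤ M := by rw [hM]; exact_mod_cast Nat.one_le_two_pow
    nlinarith
  intro F₀ hF₀ hF₀ε g₀ hg₀ h₀ hh₀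
  by_contra hne
  set F : Set G := insert 1 (F₀ ∪ F₀⁻¹) with hF
  have hFfin : F.Finite := (hF₀.union hF₀.inv).insert 1
  have hFinv : F⁻¹ = F := by
    rw [hF, Set.inv_insert, Set.union_inv, inv_inv, inv_one, Set.union_comm]
  have h1F : (1 : G) ∈ F := Set.mem_insert _ _
  have hF₀F : F₀ ⊆ F := fun x hx => Or.inr (Or.inl hx)
  let P : G → Prop := fun h => ‖ρ h - 1‖ ≤ ε ∧ h ∈ Subgroup.closure F₀ ∧
    ∃ g ∈ F₀, ρ ⁅g, h⁆ ≠ 1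
  have hstep : ∀ h : {h // P h}, ∃ g ∈ F₀, P ⁅g, (h : G)⁆ := by
    rintro ⟨h, hhε, hhc, g, hg, hgh⟩
    refine ⟨g, hg, ?_, ?_, ?_⟩
    · refine (norm_map_commutator_sub_one_le hρ g h).trans ?_
      have h1 := hF₀ε g hg
      have h2 := mul_le_mul h1 hhε (norm_nonneg _) hε.le
      nlinarith
    · rw [commutatorElement_def]
      have hgc := Subgroup.subset_closure hg (G := G)
      exact Subgroup.mul_mem _ (Subgroup.mul_mem _ (Subgroup.mul_mem _ hgc hhc)
        (Subgroup.inv_mem _ hgc)) (Subgroup.inv_mem _ hhc)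
    · by_contra! hcon
      set c : G := ⁅g, h⁆ with hc
      have hcomm : ∀ x ∈ Subgroup.closure F₀, ρ x * ρ c = ρ c * ρ x := by
        intro x hx
        induction hx using Subgroup.closure_induction with
        | mem s hs =>
          have h1 := hcon s hs
          rw [← map_mul, ← map_mul]
          have h2 : s * c = ⁅s, c⁆ * (c * s) := by rw [commutatorElement_def]; group
          rw [h2, map_mul, h1, one_mul]
        | one => simp
        | mul a b _ _ ha hb => rw [map_mul, mul_assoc, hb, ← mul_assoc, ha, mul_assoc]
        | inv a _ ha =>
          have h1 : ρ a⁻¹ * (ρ a * ρ c) * ρ a⁻¹ = ρ a⁻¹ * (ρ c * ρ a) * ρ a⁻¹ := by rw [ha]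
          rw [← mul_assoc, ρ.map_inv_mul_map_cancel, one_mul, mul_assoc, mul_assoc,
            ρ.map_mul_map_inv_cancel, mul_one] at h1
          exact h1.symm
      have hgh2 : ρ g * ρ h = ρ c * ρ h * ρ g := by
        rw [← map_mul, ← map_mul, ← map_mul, hc, commutatorElement_def]; congr 1; group
      have hpow : ∀ n : ℕ, ρ (c ^ n) = ρ ⁅g ^ n, h⁆ := by
        intro n
        have h1 : ρ (g ^ n) * ρ h = ρ (c ^ n) * ρ h * ρ (g ^ n) := by
          induction n with
          | zero => simp
          | succ n ih =>
            have hgc : ρ g * ρ (c ^ n) = ρ (c ^ n) * ρ g := by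
              have h3 : Commute (ρ g) (ρ c) := hcomm g (Subgroup.subset_closure hg)
              rw [map_pow]
              exact h3.pow_right n
            calc ρ (g ^ (n + 1)) * ρ h = ρ g * (ρ (g ^ n) * ρ h) := by
                  rw [pow_succ', map_mul, mul_assoc]
              _ = (ρ g * ρ (c ^ n)) * ρ h * ρ (g ^ n) := by rw [ih]; simp only [mul_assoc]
              _ = ρ (c ^ n) * (ρ g * ρ h) * ρ (g ^ n) := by rw [hgc]; simp only [mul_assoc]
              _ = (ρ (c ^ n) * ρ c) * ρ h * (ρ g * ρ (g ^ n)) := by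
                  rw [hgh2]; simp only [mul_assoc]
              _ = _ := by
                  rw [pow_succ c, pow_succ' g, map_mul ρ (c ^ n), map_mul ρ g]
        rw [commutatorElement_def, map_mul, map_mul, map_mul, h1, mul_assoc (ρ (c ^ n) * ρ h),
          ρ.map_mul_map_inv_cancel, mul_one, mul_assoc, ρ.map_mul_map_inv_cancel, mul_one]
      have : ρ c = 1 := map_eq_one_of_pow_near c fun n => by
        rw [hpow n]
        exact (norm_map_commutator_sub_one_le' hρ _ _).trans (by linarith)
      exact hgh this
  choose nxt hnxtF hnxtP using hstep
  have hP₀ : P h₀ := ⟨hF₀ε _ hh₀, Subgroup.subset_closure hh₀, g₀, hg₀, hne⟩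
  let q : ℕ → {h // P h} := fun k => Nat.rec ⟨h₀, hP₀⟩ (fun _ h => ⟨_, hnxtP h⟩) k
  have hq : ∀ k, (q (k + 1)).1 = (⁅nxt (q k), (q k).1⁆ : G) := fun k => rfl
  have hlen : ∀ k, (q k).1 ∈ F ^ (3 * 2 ^ k - 2) := by
    intro k
    induction k with
    | zero => rw [show 3 * 2 ^ 0 - 2 = 1 from rfl, pow_one]; exact hF₀F hh₀
    | succ k ih =>
      rw [hq, commutatorElement_def]
      have hgF : nxt (q k) ∈ F := hF₀F (hnxtF _)
      have hgF' : (nxt (q k))⁻¹ ∈ F := by rw [← hFinv]; exact Set.inv_mem_inv.2 hgF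
      have hqF' : (q k).1⁻¹ ∈ F ^ (3 * 2 ^ k - 2) := by
        rw [← hFinv, inv_pow]; exact Set.inv_mem_inv.2 ih
      have := Set.mul_mem_mul (Set.mul_mem_mul (Set.mul_mem_mul hgF ih) hgF') hqF'
      rw [← pow_succ', ← pow_succ, ← pow_add] at this
      convert this using 2
      have := Nat.one_le_two_pow (n := k)
      rw [pow_succ]
      omega
  have hposq : ∀ k, 0 < ‖ρ (q k).1 - 1‖ := by
    intro k
    rw [norm_pos_iff, sub_ne_zero]
    intro h1
    obtain ⟨g, -, hg⟩ := (q k).2.2.2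
    apply hg
    rw [commutatorElement_def, map_mul, map_mul, map_mul, h1, mul_one, ρ.map_mul_map_inv_cancel,
      one_mul]
    have := ρ.map_mul_map_inv_cancel (q k).1
    rwa [h1, one_mul] at this
  have hdec : ∀ k, ‖ρ (q (k + 1)).1 - 1‖ ≤ 2 * ε * ‖ρ (q k).1 - 1‖ := by
    intro k
    rw [hq]
    refine (norm_map_commutator_sub_one_le hρ _ _).trans ?_
    have := hF₀ε _ (hnxtF (q k))
    gcongr
  obtain ⟨C, hC⟩ := hG F hFfin
  obtain ⟨m, hm⟩ := exists_lt_two_pow (C * (3 * M + 1) ^ D) 0 0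
  obtain ⟨T, hTc, hT⟩ := exists_finset_words hρ h1F hMε hε.le m 3 (fun k => (q k).1)
    (fun k => Set.pow_subset_pow_right h1F (Nat.sub_le _ _) (hlen k)) hposq hdec (q 0).2.1
  have h1 : T.card ≤ (F ^ (3 * M * (2 ^ m - 1))).ncard := by
    rw [← Set.ncard_coe_finset]
    exact Set.ncard_le_ncard (fun w hw => (hT w hw).2) (hFfin.pow_of_finite _)
  have h2 := hC (3 * M * (2 ^ m - 1))
  have h3 : 3 * M * (2 ^ m - 1) + 1 ≤ (3 * M + 1) * 2 ^ m := by
    have := Nat.one_le_two_pow (n := m)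
    have h4 : 3 * M * (2 ^ m - 1) ≤ 3 * M * 2 ^ m := Nat.mul_le_mul_left _ (Nat.sub_le _ _)
    rw [add_mul]; omega
  have h4 : M ^ m ≤ C * (3 * M + 1) ^ D * (2 ^ m) ^ D := by
    rw [hTc] at h1
    refine h1.trans (h2.trans ?_)
    rw [mul_assoc C, ← mul_pow]
    exact Nat.mul_le_mul_left _ (Nat.pow_le_pow_left h3 _)
  have h5 : M ^ m = (2 ^ m) ^ D * 2 ^ m := by
    rw [hM, ← pow_mul, ← pow_mul, ← pow_add]; congr 1; ring
  rw [h5, mul_comm] at h4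
  have h6 := Nat.le_of_mul_le_mul_right h4 (by positivity)
  simp at hm
  omega

theorem exists_finiteIndex_map_commute {D : ℕ} {G : Type*} [Group G] [Group.FG G]
    (hG : PolyGrowth D G) {A : Type*} [NormedRing A] [NormedAlgebra ℝ A] [ProperSpace A]
    (ρ : G →* A) (hρ : ∀ g, ‖ρ g‖ ≤ 1) :
    ∃ H : Subgroup G, H.FiniteIndex ∧ ∀ g ∈ H, ∀ h ∈ H, ρ g * ρ h = ρ h * ρ g := by
  obtain ⟨ε, hε, hcomm⟩ := exists_commuting_closure hG ρ hρ
  let U : Set G := {g | ‖ρ g - 1‖ ≤ ε}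
  set H := Subgroup.closure U with hH
  have hfin : H.FiniteIndex := by
    have hcpt : TotallyBounded (Metric.closedBall (0 : A) 1) :=
      (isCompact_closedBall 0 1).totallyBounded
    obtain ⟨t, htf, ht⟩ := Metric.totallyBounded_iff.1 hcpt (ε / 2) (by positivity)
    have hx : ∀ g : G, ∃ y ∈ t, dist (ρ g) y < ε / 2 := by
      intro g
      have : ρ g ∈ Metric.closedBall (0 : A) 1 := by simpa using hρ g
      simpa using ht this
    choose c hct hc using hx
    have : Finite t := htf
    have : Finite (G ⧸ H) := by
      refine Finite.of_injective (fun q : G ⧸ H => (⟨c q.out, hct _⟩ : t)) fun q q' hqq => ?_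
      have h1 : c q.out = c q'.out := congrArg Subtype.val hqq
      have h2 : dist (ρ q.out) (ρ q'.out) ≤ ε := by
        have h3 := hc q.out
        have h4 := hc q'.out
        rw [h1] at h3
        linarith [dist_triangle_right (ρ q.out) (ρ q'.out) (c q'.out)]
      have h3 : q.out⁻¹ * q'.out ∈ U := by
        have h4 : ρ (q.out⁻¹ * q'.out) - 1 = ρ q.out⁻¹ * (ρ q'.out - ρ q.out) := by
          rw [mul_sub, ρ.map_inv_mul_map_cancel, map_mul]
        change ‖_‖ ≤ ε
        rw [h4]
        refine (norm_map_mul_le hρ _ _).trans ?_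
        rwa [← dist_eq_norm, dist_comm]
      have h4 := QuotientGroup.eq.2 (Subgroup.subset_closure h3 : _ ∈ H)
      rwa [QuotientGroup.out_eq', QuotientGroup.out_eq'] at h4
    exact Subgroup.finiteIndex_of_finite_quotient
  have hfg : H.FG := (Group.fg_iff_subgroup_fg _).1 inferInstance
  obtain ⟨F, hFU, hFf, hFc⟩ := exists_finite_subset_closure_eq hfg
  refine ⟨H, hfin, ?_⟩
  have hone : ∀ g h : G, ρ ⁅g, h⁆ = 1 → ρ g * ρ h = ρ h * ρ g := fun g h hgh => by
    rw [← map_mul, ← map_mul]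
    have h2 : g * h = ⁅g, h⁆ * (h * g) := by rw [commutatorElement_def]; group
    rw [h2, map_mul, hgh, one_mul]
  have hcent : ∀ a : A, (∀ s ∈ F, ρ s * a = a * ρ s) → ∀ g ∈ H, ρ g * a = a * ρ g := by
    intro a ha g hg
    rw [hH, ← hFc] at hg
    induction hg using Subgroup.closure_induction with
    | mem s hs => exact ha s hs
    | one => simp
    | mul x y _ _ hx hy => rw [map_mul, mul_assoc, hy, ← mul_assoc, hx, mul_assoc]
    | inv x _ hx =>
      have h1 : ρ x⁻¹ * (ρ x * a) * ρ x⁻¹ = ρ x⁻¹ * (a * ρ x) * ρ x⁻¹ := by rw [hx]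
      rw [← mul_assoc, ρ.map_inv_mul_map_cancel, one_mul, mul_assoc, mul_assoc,
        ρ.map_mul_map_inv_cancel, mul_one] at h1
      exact h1.symm
  intro g hg h hh
  refine hcent _ (fun s hs => ?_) g hg
  exact (hcent _ (fun s' hs' => hone _ _ (hcomm F hFf hFU s' hs' s hs)) h hh).symm

section Dot

variable {G : Type*}

/-- The standard scalar product of finitely supported functions. -/
noncomputable def Finsupp.dot : (G →₀ ℝ) →ₗ[ℝ] (G →₀ ℝ) →ₗ[ℝ] ℝ :=
  Finsupp.linearCombination ℝ fun x => Finsupp.lapply x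

theorem Finsupp.dot_single_left (x : G) (r : ℝ) (b : G →₀ ℝ) :
    Finsupp.dot (Finsupp.single x r) b = r * b x := by
  simp [Finsupp.dot]

theorem Finsupp.dot_comm (a b : G →₀ ℝ) : Finsupp.dot a b = Finsupp.dot b a := by
  classical
  induction a using Finsupp.induction_linear with
  | zero => simp
  | add a a' h h' => rw [map_add, map_add, LinearMap.add_apply, h, h']
  | single x r =>
    induction b using Finsupp.induction_linear with
    | zero => simp
    | add b b' h h' => rw [map_add, map_add, LinearMap.add_apply, h, h']
    | single y s =>
      rw [Finsupp.dot_single_left, Finsupp.dot_single_left, Finsupp.single_apply,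
        Finsupp.single_apply]
      by_cases h : x = y
      · simp [h, mul_comm]
      · simp [h, Ne.symm h]

theorem Finsupp.dot_single_right (x : G) (r : ℝ) (a : G →₀ ℝ) :
    Finsupp.dot a (Finsupp.single x r) = r * a x := by
  rw [Finsupp.dot_comm, Finsupp.dot_single_left]

theorem Finsupp.dot_eq_sum (a b : G →₀ ℝ) :
    Finsupp.dot a b = ∑ x ∈ a.support, a x * b x := by
  simp [Finsupp.dot, Finsupp.linearCombination_apply, Finsupp.sum, LinearMap.sum_apply]

theorem Finsupp.dot_self_nonneg (a : G →₀ ℝ) : 0 ≤ Finsupp.dot a a := by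
  rw [Finsupp.dot_eq_sum]
  exact Finset.sum_nonneg fun x _ => mul_self_nonneg _

theorem Finsupp.dot_sq_le (a b : G →₀ ℝ) :
    Finsupp.dot a b ^ 2 ≤ Finsupp.dot a a * Finsupp.dot b b := by
  have h := discrim_le_zero (a := Finsupp.dot b b) (b := 2 * Finsupp.dot a b)
    (c := Finsupp.dot a a) fun x => by
      have := Finsupp.dot_self_nonneg (a + x • b)
      simp only [map_add, LinearMap.add_apply, map_smul, LinearMap.smul_apply, smul_eq_mul] at this
      rw [Finsupp.dot_comm b a] at this
      linarith
  rw [discrim] at h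
  linarith

theorem Finsupp.dot_self_sub (a b : G →₀ ℝ) : Finsupp.dot (a - b) (a - b) =
    Finsupp.dot a a - 2 * Finsupp.dot a b + Finsupp.dot b b := by
  simp only [map_sub, LinearMap.sub_apply]
  rw [Finsupp.dot_comm b a]; ring

theorem Finsupp.dot_self_add_le (a b : G →₀ ℝ) : Finsupp.dot (a + b) (a + b) ≤
    2 * Finsupp.dot a a + 2 * Finsupp.dot b b := by
  have h := Finsupp.dot_self_nonneg (a - b)
  rw [Finsupp.dot_self_sub] at h
  simp only [map_add, LinearMap.add_apply]
  rw [Finsupp.dot_comm b a]; linarith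

theorem Finsupp.sq_sum_le_card_mul_dot (a : G →₀ ℝ) :
    (∑ x ∈ a.support, a x) ^ 2 ≤ a.support.card * Finsupp.dot a a := by
  rw [Finsupp.dot_eq_sum]
  have := sq_sum_le_card_mul_sum_sq (s := a.support) (f := fun x => a x)
  simpa only [sq] using this

end Dot

section Translations

variable {G : Type*} [Group G]

/-- Left translation of finitely supported functions. -/
noncomputable abbrev leftTr (x : G) : (G →₀ ℝ) →ₗ[ℝ] (G →₀ ℝ) := Finsupp.lmapDomain ℝ ℝ (x * ·)

/-- Right translation of finitely supported functions. -/
noncomputable abbrev rightTr (x : G) : (G →₀ ℝ) →ₗ[ℝ] (G →₀ ℝ) := Finsupp.lmapDomain ℝ ℝ (· * x)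

theorem leftTr_single (x y : G) (r : ℝ) :
    leftTr x (Finsupp.single y r) = Finsupp.single (x * y) r := by simp

theorem rightTr_single (x y : G) (r : ℝ) :
    rightTr x (Finsupp.single y r) = Finsupp.single (y * x) r := by simp

theorem dot_leftTr (x : G) (a b : G →₀ ℝ) :
    Finsupp.dot (leftTr x a) b = Finsupp.dot a (leftTr x⁻¹ b) := by
  classical
  induction a using Finsupp.induction_linear with
  | zero => simp
  | add a a' h h' => simp only [map_add, LinearMap.add_apply, h, h']
  | single y r =>
    induction b using Finsupp.induction_linear with
    | zero => simp
    | add b b' h h' => simp only [map_add, h, h']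
    | single z s =>
      rw [leftTr_single, leftTr_single, Finsupp.dot_single_left, Finsupp.dot_single_left,
        Finsupp.single_apply, Finsupp.single_apply]
      simp only [inv_mul_eq_iff_eq_mul]

theorem dot_rightTr (x : G) (a b : G →₀ ℝ) :
    Finsupp.dot (rightTr x a) b = Finsupp.dot a (rightTr x⁻¹ b) := by
  classical
  induction a using Finsupp.induction_linear with
  | zero => simp
  | add a a' h h' => simp only [map_add, LinearMap.add_apply, h, h']
  | single y r =>
    induction b using Finsupp.induction_linear with
    | zero => simp
    | add b b' h h' => simp only [map_add, h, h']
    | single z s =>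
      rw [rightTr_single, rightTr_single, Finsupp.dot_single_left, Finsupp.dot_single_left,
        Finsupp.single_apply, Finsupp.single_apply]
      simp only [mul_inv_eq_iff_eq_mul]

theorem leftTr_mul (x y : G) (a : G →₀ ℝ) : leftTr (x * y) a = leftTr x (leftTr y a) := by
  induction a using Finsupp.induction_linear with
  | zero => simp
  | add a a' h h' => rw [map_add, map_add, map_add, h, h']
  | single z r => rw [leftTr_single, leftTr_single, leftTr_single, mul_assoc]

theorem leftTr_one (a : G →₀ ℝ) : leftTr (1 : G) a = a := by
  induction a using Finsupp.induction_linear with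
  | zero => simp
  | add a a' h h' => rw [map_add, h, h']
  | single z r => rw [leftTr_single, one_mul]

theorem leftTr_rightTr (x y : G) (a : G →₀ ℝ) :
    leftTr x (rightTr y a) = rightTr y (leftTr x a) := by
  induction a using Finsupp.induction_linear with
  | zero => simp
  | add a a' h h' => rw [map_add, map_add, map_add, map_add, h, h']
  | single z r => rw [leftTr_single, rightTr_single, rightTr_single, leftTr_single, mul_assoc]

theorem dot_leftTr_leftTr (x : G) (a b : G →₀ ℝ) :
    Finsupp.dot (leftTr x a) (leftTr x b) = Finsupp.dot a b := by
  rw [dot_leftTr, ← leftTr_mul, inv_mul_cancel, leftTr_one]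

variable {ι : Type*} [Fintype ι]

/-- The averaging operator over right translations by the family `S`. -/
noncomputable def avgOp (S : ι → G) : (G →₀ ℝ) →ₗ[ℝ] (G →₀ ℝ) :=
  (Fintype.card ι : ℝ)⁻¹ • ∑ i, rightTr (S i)

/-- The law at time `n` of the simple random walk with uniform steps in the family `S`. -/
noncomputable def walkLaw (S : ι → G) (n : ℕ) : G →₀ ℝ :=
  ((avgOp S) ^ n) (Finsupp.single 1 1)

theorem avgOp_apply (S : ι → G) (a : G →₀ ℝ) :
    avgOp S a = (Fintype.card ι : ℝ)⁻¹ • ∑ i, rightTr (S i) a := by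
  simp [avgOp, LinearMap.sum_apply]

theorem walkLaw_zero (S : ι → G) : walkLaw S 0 = Finsupp.single 1 1 := rfl

theorem walkLaw_succ (S : ι → G) (n : ℕ) : walkLaw S (n + 1) = avgOp S (walkLaw S n) := by
  rw [walkLaw, pow_succ']; rfl

theorem leftTr_avgOp (S : ι → G) (x : G) (a : G →₀ ℝ) :
    leftTr x (avgOp S a) = avgOp S (leftTr x a) := by
  rw [avgOp_apply, avgOp_apply, map_smul, map_sum]
  simp only [leftTr_rightTr]

theorem leftTr_walkLaw (S : ι → G) (n : ℕ) :
    (Fintype.card ι : ℝ)⁻¹ • ∑ i, leftTr (S i) (walkLaw S n) = walkLaw S (n + 1) := by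
  induction n with
  | zero =>
    rw [walkLaw_succ, avgOp_apply, walkLaw_zero]
    simp only [leftTr_single, rightTr_single, mul_one, one_mul]
  | succ n ih =>
    rw [walkLaw_succ S (n + 1), ← ih, map_smul, map_sum, ih]
    congr 1
    refine Finset.sum_congr rfl fun s _ => ?_
    rw [← leftTr_avgOp, ← walkLaw_succ]

theorem walkLaw_nonneg (S : ι → G) (n : ℕ) (x : G) : 0 ≤ walkLaw S n x := by
  classical
  induction n generalizing x with
  | zero => rw [walkLaw_zero, Finsupp.single_apply]; split_ifs <;> norm_num
  | succ n ih =>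
    rw [walkLaw_succ, avgOp_apply, Finsupp.smul_apply, Finsupp.finsetSum_apply, smul_eq_mul]
    refine mul_nonneg (by positivity) (Finset.sum_nonneg fun i _ => ?_)
    have h : rightTr (S i) (walkLaw S n) x = Finsupp.dot (rightTr (S i) (walkLaw S n))
        (Finsupp.single x 1) := by rw [Finsupp.dot_single_right, one_mul]
    rw [h, dot_rightTr, rightTr_single, Finsupp.dot_single_right, one_mul]
    exact ih _

theorem walkLaw_succ_apply (S : ι → G) (n : ℕ) (x : G) :
    walkLaw S (n + 1) x = (Fintype.card ι : ℝ)⁻¹ * ∑ i, walkLaw S n ((S i)⁻¹ * x) := by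
  have h : ∀ s : G, leftTr s (walkLaw S n) x = walkLaw S n (s⁻¹ * x) := fun s => by
    have h : leftTr s (walkLaw S n) x = Finsupp.dot (leftTr s (walkLaw S n))
        (Finsupp.single x 1) := by rw [Finsupp.dot_single_right, one_mul]
    rw [h, dot_leftTr, leftTr_single, Finsupp.dot_single_right, one_mul]
  rw [← leftTr_walkLaw, Finsupp.smul_apply, Finsupp.finsetSum_apply, smul_eq_mul]
  simp only [h]

theorem walkLaw_support_subset (S : ι → G) (n : ℕ) :
    ((walkLaw S n).support : Set G) ⊆ (Set.range S) ^ n := by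
  induction n with
  | zero =>
    intro x hx
    rw [Finset.mem_coe, Finsupp.mem_support_iff] at hx
    rw [walkLaw_zero] at hx
    rw [pow_zero, Set.mem_one]
    by_contra h
    exact hx (Finsupp.single_eq_of_ne h)
  | succ n ih =>
    intro x hx
    rw [Finset.mem_coe, Finsupp.mem_support_iff] at hx
    rw [walkLaw_succ_apply] at hx
    obtain ⟨i, -, hsx⟩ := Finset.exists_ne_zero_of_sum_ne_zero (right_ne_zero_of_mul hx)
    rw [pow_succ']
    exact ⟨S i, ⟨i, rfl⟩, (S i)⁻¹ * x, ih (by simpa using hsx), by group⟩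

theorem linearCombination_walkLaw_succ (S : ι → G) (n : ℕ) (f : G → ℝ) :
    Finsupp.linearCombination ℝ f (walkLaw S (n + 1)) =
      (Fintype.card ι : ℝ)⁻¹ * ∑ i, Finsupp.linearCombination ℝ (fun x => f (S i * x)) (walkLaw S n) := by
  rw [← leftTr_walkLaw, map_smul, map_sum, smul_eq_mul]
  congr 1
  refine Finset.sum_congr rfl fun s _ => ?_
  rw [Finsupp.lmapDomain_apply, Finsupp.linearCombination_mapDomain]
  rfl

theorem linearCombination_walkLaw_succ' (S : ι → G) (n : ℕ) (f : G → ℝ) :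
    Finsupp.linearCombination ℝ f (walkLaw S (n + 1)) =
      Finsupp.linearCombination ℝ (fun x => (Fintype.card ι : ℝ)⁻¹ * ∑ i, f (x * S i)) (walkLaw S n) := by
  rw [walkLaw_succ, avgOp_apply, map_smul, map_sum, smul_eq_mul]
  simp only [Finsupp.lmapDomain_apply, Finsupp.linearCombination_mapDomain]
  simp only [Finsupp.linearCombination_apply, Finsupp.sum, Finset.mul_sum, smul_eq_mul]
  rw [Finset.sum_comm]
  refine Finset.sum_congr rfl fun x _ => Finset.sum_congr rfl fun s _ => ?_
  simp only [Function.comp]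
  ring

theorem linearCombination_walkLaw_const [Nonempty ι] (S : ι → G) (n : ℕ) (c : ℝ) :
    Finsupp.linearCombination ℝ (fun _ => c) (walkLaw S n) = c := by
  induction n with
  | zero => simp [walkLaw_zero]
  | succ n ih =>
    rw [linearCombination_walkLaw_succ']
    have : (Fintype.card ι : ℝ) ≠ 0 := by exact_mod_cast Fintype.card_ne_zero
    simp only [Finset.sum_const, nsmul_eq_mul, Finset.card_univ]
    rw [← mul_assoc, inv_mul_cancel₀ this, one_mul, ih]

theorem sum_walkLaw [Nonempty ι] (S : ι → G) (n : ℕ) :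
    ∑ x ∈ (walkLaw S n).support, walkLaw S n x = 1 := by
  have := linearCombination_walkLaw_const S n 1
  simpa [Finsupp.linearCombination_apply, Finsupp.sum] using this

end Translations

theorem Ultrafilter.exists_tendsto_of_abs_le {α : Type*} (U : Ultrafilter α) {f : α → ℝ} {B : ℝ}
    (h : ∀ a, |f a| ≤ B) : ∃ l, Tendsto f U (nhds l) := by
  obtain ⟨l, -, hl⟩ := (isCompact_Icc (a := -B) (b := B)).ultrafilter_le_nhds (U.map f)
    (by
      rw [Filter.le_principal_iff]
      exact Filter.mem_map.2 (Filter.univ_mem' fun a => abs_le.1 (h a)))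
  exact ⟨l, hl⟩

section Harmonic

variable {G : Type*} [Group G] {ι : Type*} [Fintype ι]

/-- Harmonicity for the random walk with uniform steps in the family `S`. -/
def IsHarmonic (S : ι → G) (f : G → ℝ) : Prop :=
  ∀ x, (Fintype.card ι : ℝ)⁻¹ * ∑ i, f (x * S i) = f x

/-- Lipschitz continuity along the steps of a random walk. -/
def IsStepLipschitz (S : ι → G) (f : G → ℝ) : Prop :=
  ∃ K : ℝ, ∀ x i, |f (x * S i) - f x| ≤ K

/-- The steps performed by two successive steps of the simple random walk on `S`. -/
def twoSteps (S : Finset G) (p : S × S) : G := p.1.1 * p.2.1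

variable {S : Finset G}

theorem dot_avgOp (hsymm : ∀ s ∈ S, s⁻¹ ∈ S) (a b : G →₀ ℝ) :
    Finsupp.dot (avgOp (Subtype.val : S → G) a) b =
      Finsupp.dot a (avgOp (Subtype.val : S → G) b) := by
  rw [avgOp_apply, avgOp_apply, map_smul, map_smul, LinearMap.smul_apply, map_sum, map_sum,
    LinearMap.sum_apply]
  congr 1
  simp only [dot_rightTr]
  exact Finset.sum_bij' (fun s _ => ⟨s.1⁻¹, hsymm _ s.2⟩) (fun s _ => ⟨s.1⁻¹, hsymm _ s.2⟩)
    (by simp) (by simp) (by simp) (by simp) (by simp)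

theorem dot_walkLaw_succ (hsymm : ∀ s ∈ S, s⁻¹ ∈ S) (m k : ℕ) :
    Finsupp.dot (walkLaw (Subtype.val : S → G) (m + 1)) (walkLaw (Subtype.val : S → G) k) =
      Finsupp.dot (walkLaw (Subtype.val : S → G) m) (walkLaw (Subtype.val : S → G) (k + 1)) := by
  rw [walkLaw_succ, walkLaw_succ, dot_avgOp hsymm]

theorem dot_leftTr_walkLaw (hsymm : ∀ s ∈ S, s⁻¹ ∈ S) (x : G) (m k : ℕ) :
    Finsupp.dot (leftTr x (walkLaw (Subtype.val : S → G) m)) (walkLaw (Subtype.val : S → G) k) =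
      walkLaw (Subtype.val : S → G) (m + k) x⁻¹ := by
  induction k generalizing m with
  | zero =>
    rw [walkLaw_zero, dot_leftTr, leftTr_single, Finsupp.dot_single_right, one_mul, mul_one,
      add_zero]
  | succ k ih =>
    rw [walkLaw_succ _ k, ← dot_avgOp hsymm, ← leftTr_avgOp, ← walkLaw_succ, ih]
    rw [Nat.add_right_comm, Nat.add_assoc]

/-- The return probability at even times. -/
noncomputable def returnProb (S : Finset G) (m : ℕ) : ℝ :=
  Finsupp.dot (walkLaw (Subtype.val : S → G) m) (walkLaw (Subtype.val : S → G) m)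

/-- The energy of the law of the random walk. -/
noncomputable def walkEnergy (S : Finset G) (m : ℕ) : ℝ :=
  returnProb S m - returnProb S (m + 1)

theorem dot_walkLaw_add_two (hsymm : ∀ s ∈ S, s⁻¹ ∈ S) (m : ℕ) :
    Finsupp.dot (walkLaw (Subtype.val : S → G) m) (walkLaw (Subtype.val : S → G) (m + 2)) =
      returnProb S (m + 1) := (dot_walkLaw_succ hsymm m (m + 1)).symm

theorem sum_leftTr_twoSteps (m : ℕ) :
    (Fintype.card (S × S) : ℝ)⁻¹ • ∑ p, leftTr (twoSteps S p) (walkLaw (Subtype.val : S → G) m) =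
      walkLaw (Subtype.val : S → G) (m + 2) := by
  rw [← leftTr_walkLaw _ (m + 1), ← leftTr_walkLaw _ m, Fintype.sum_prod_type, Fintype.card_prod,
    Nat.cast_mul, mul_inv, mul_smul]
  simp only [twoSteps, leftTr_mul, map_smul, map_sum, Finset.smul_sum]

theorem sum_dot_twoSteps [Nonempty S] (hsymm : ∀ s ∈ S, s⁻¹ ∈ S) (m : ℕ) :
    (Fintype.card (S × S) : ℝ)⁻¹ * ∑ p, Finsupp.dot
      (leftTr (twoSteps S p) (walkLaw (Subtype.val : S → G) m) - walkLaw (Subtype.val : S → G) m)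
      (leftTr (twoSteps S p) (walkLaw (Subtype.val : S → G) m) - walkLaw (Subtype.val : S → G) m)
      = 2 * walkEnergy S m := by
  have h := congrArg (fun v => Finsupp.dot v (walkLaw (Subtype.val : S → G) m))
    (sum_leftTr_twoSteps (S := S) m)
  simp only [map_smul, LinearMap.smul_apply, map_sum, LinearMap.sum_apply, smul_eq_mul] at h
  rw [Finsupp.dot_comm, dot_walkLaw_add_two hsymm] at h
  simp only [Finsupp.dot_self_sub, dot_leftTr_leftTr, Finset.sum_add_distrib,
    Finset.sum_sub_distrib, ← Finset.mul_sum, Finset.sum_const, Finset.card_univ, nsmul_eq_mul]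
  have h0 : (Fintype.card (S × S) : ℝ) ≠ 0 := by exact_mod_cast Fintype.card_ne_zero
  rw [mul_add, mul_sub, mul_left_comm _ 2, h, ← mul_assoc, inv_mul_cancel₀ h0, walkEnergy]
  simp only [returnProb]
  ring

theorem walkEnergy_nonneg [Nonempty S] (hsymm : ∀ s ∈ S, s⁻¹ ∈ S) (m : ℕ) :
    0 ≤ walkEnergy S m := by
  have h := sum_dot_twoSteps hsymm m
  have : 0 ≤ 2 * walkEnergy S m := h ▸ mul_nonneg (by positivity)
    (Finset.sum_nonneg fun _ _ => Finsupp.dot_self_nonneg _)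
  linarith

theorem walkEnergy_sub_succ (hsymm : ∀ s ∈ S, s⁻¹ ∈ S) (m : ℕ) :
    walkEnergy S m - walkEnergy S (m + 1) = Finsupp.dot
      (walkLaw (Subtype.val : S → G) (m + 2) - walkLaw (Subtype.val : S → G) m)
      (walkLaw (Subtype.val : S → G) (m + 2) - walkLaw (Subtype.val : S → G) m) := by
  rw [Finsupp.dot_self_sub, Finsupp.dot_comm _ (walkLaw _ m), dot_walkLaw_add_two hsymm,
    walkEnergy, walkEnergy, returnProb, returnProb, returnProb]
  ring

theorem exists_dot_leftTr_sub_le [Nonempty S] (hsymm : ∀ s ∈ S, s⁻¹ ∈ S) (h1 : 1 ∈ S)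
    (hgen : Subgroup.closure (S : Set G) = ⊤) (x : G) : ∃ C : ℝ, 0 ≤ C ∧ ∀ m, Finsupp.dot
      (leftTr x (walkLaw (Subtype.val : S → G) m) - walkLaw (Subtype.val : S → G) m)
      (leftTr x (walkLaw (Subtype.val : S → G) m) - walkLaw (Subtype.val : S → G) m)
      ≤ C * walkEnergy S m := by
  have hx : x ∈ Subgroup.closure (S : Set G) := hgen ▸ Subgroup.mem_top x
  induction hx using Subgroup.closure_induction with
  | mem s hs =>
    refine ⟨Fintype.card (S × S) * 2, by positivity, fun m => ?_⟩
    have h := sum_dot_twoSteps hsymm m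
    have h0 : (Fintype.card (S × S) : ℝ) ≠ 0 := by exact_mod_cast Fintype.card_ne_zero
    rw [inv_mul_eq_iff_eq_mul₀ h0] at h
    rw [mul_assoc, ← h]
    have := Finset.single_le_sum (f := fun p : S × S => Finsupp.dot
      (leftTr (twoSteps S p) (walkLaw (Subtype.val : S → G) m) - walkLaw (Subtype.val : S → G) m)
      (leftTr (twoSteps S p) (walkLaw (Subtype.val : S → G) m) - walkLaw (Subtype.val : S → G) m))
      (fun _ _ => Finsupp.dot_self_nonneg _) (Finset.mem_univ (⟨s, hs⟩, ⟨1, h1⟩))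
    simpa only [twoSteps, mul_one] using this
  | one => exact ⟨0, le_rfl, fun m => by simp only [leftTr_one]; simp⟩
  | mul x y _ _ ihx ihy =>
    obtain ⟨C, hC, hx⟩ := ihx
    obtain ⟨C', hC', hy⟩ := ihy
    refine ⟨2 * C' + 2 * C, by positivity, fun m => ?_⟩
    have e : leftTr (x * y) (walkLaw (Subtype.val : S → G) m) - walkLaw (Subtype.val : S → G) m =
        leftTr x (leftTr y (walkLaw (Subtype.val : S → G) m) - walkLaw (Subtype.val : S → G) m) +
        (leftTr x (walkLaw (Subtype.val : S → G) m) - walkLaw (Subtype.val : S → G) m) := by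
      rw [leftTr_mul, map_sub]; abel
    rw [e]
    refine (Finsupp.dot_self_add_le _ _).trans ?_
    rw [dot_leftTr_leftTr]
    nlinarith [hx m, hy m]
  | inv x _ ih =>
    obtain ⟨C, hC, hx⟩ := ih
    refine ⟨C, hC, fun m => ?_⟩
    have e : leftTr x⁻¹ (walkLaw (Subtype.val : S → G) m) - walkLaw (Subtype.val : S → G) m =
        -leftTr x⁻¹ (leftTr x (walkLaw (Subtype.val : S → G) m) -
          walkLaw (Subtype.val : S → G) m) := by
      rw [map_sub, ← leftTr_mul, inv_mul_cancel, leftTr_one]; abel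
    rw [e, LinearMap.map_neg, map_neg, LinearMap.neg_apply, neg_neg, dot_leftTr_leftTr]
    exact hx m

theorem walkEnergy_antitone (hsymm : ∀ s ∈ S, s⁻¹ ∈ S) : Antitone (walkEnergy S) :=
  antitone_nat_of_succ_le fun m => by
    have := walkEnergy_sub_succ hsymm m
    have h0 := Finsupp.dot_self_nonneg
      (walkLaw (Subtype.val : S → G) (m + 2) - walkLaw (Subtype.val : S → G) m)
    linarith

theorem returnProb_antitone [Nonempty S] (hsymm : ∀ s ∈ S, s⁻¹ ∈ S) : Antitone (returnProb S) :=
  antitone_nat_of_succ_le fun m => by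
    have := walkEnergy_nonneg hsymm m
    rw [walkEnergy] at this
    linarith

theorem returnProb_zero : returnProb S 0 = 1 := by
  rw [returnProb, walkLaw_zero, Finsupp.dot_single_left]; simp

theorem mul_walkEnergy_le (hsymm : ∀ s ∈ S, s⁻¹ ∈ S) (m : ℕ) : m * walkEnergy S m ≤ 1 := by
  have h : ∑ k ∈ Finset.range m, walkEnergy S k = 1 - returnProb S m := by
    rw [← returnProb_zero (S := S), ← Finset.sum_range_sub']
    rfl
  have h2 : ∑ _k ∈ Finset.range m, walkEnergy S m ≤ ∑ k ∈ Finset.range m, walkEnergy S k :=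
    Finset.sum_le_sum fun k hk => walkEnergy_antitone hsymm (Finset.mem_range.1 hk).le
  have h3 : 0 ≤ returnProb S m := Finsupp.dot_self_nonneg _
  rw [Finset.sum_const, Finset.card_range, nsmul_eq_mul] at h2
  linarith

theorem tendsto_walkEnergy [Nonempty S] (hsymm : ∀ s ∈ S, s⁻¹ ∈ S) :
    Tendsto (walkEnergy S) atTop (nhds 0) := by
  have h := tendsto_one_div_add_atTop_nhds_zero_nat (𝕜 := ℝ)
  rw [← tendsto_add_atTop_iff_nat 1]
  refine squeeze_zero (fun m => walkEnergy_nonneg hsymm _) (fun m => ?_) h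
  have := mul_walkEnergy_le hsymm (m + 1)
  rw [le_div_iff₀ (by positivity)]
  push_cast at this
  linarith

theorem tendsto_returnProb [Nonempty S] [Infinite G] (hsymm : ∀ s ∈ S, s⁻¹ ∈ S) (h1 : 1 ∈ S)
    (hgen : Subgroup.closure (S : Set G) = ⊤) : Tendsto (returnProb S) atTop (nhds 0) := by
  have hb : BddBelow (Set.range (returnProb S)) :=
    ⟨0, by rintro _ ⟨m, rfl⟩; exact Finsupp.dot_self_nonneg _⟩
  have hlim := tendsto_atTop_ciInf (returnProb_antitone hsymm) hb
  set α := ⨅ m, returnProb S m with hα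
  have hle : ∀ m, α ≤ returnProb S m := fun m => ciInf_le hb m
  have h0 : 0 ≤ α := le_ciInf fun m => Finsupp.dot_self_nonneg _
  rcases h0.eq_or_lt with h | hpos
  · rwa [← h] at hlim
  exfalso
  obtain ⟨k, hk⟩ := exists_nat_gt (2 / α)
  obtain ⟨F, hF⟩ := Infinite.exists_subset_card_eq G k
  have hev : ∀ x ∈ F, ∀ᶠ m in atTop,
      α / 2 ≤ walkLaw (Subtype.val : S → G) (m + m) x := by
    intro x _
    obtain ⟨C, hC, hx⟩ := exists_dot_leftTr_sub_le hsymm h1 hgen x⁻¹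
    have ht : Tendsto (fun m => C * walkEnergy S m) atTop (nhds 0) := by
      simpa using (tendsto_walkEnergy hsymm).const_mul C
    filter_upwards [ht.eventually (gt_mem_nhds hpos)] with m hm
    have := hx m
    rw [Finsupp.dot_self_sub, dot_leftTr_leftTr, dot_leftTr_walkLaw hsymm, inv_inv] at this
    have h2 := hle m
    rw [returnProb] at h2
    linarith
  obtain ⟨m, hm⟩ := ((Filter.eventually_all_finset F).2 hev).exists
  have hsum : ∑ x ∈ F, walkLaw (Subtype.val : S → G) (m + m) x ≤ 1 := by
    classical
    rw [← sum_walkLaw (Subtype.val : S → G) (m + m)]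
    have hsub : ∑ x ∈ F, walkLaw (Subtype.val : S → G) (m + m) x ≤
        ∑ x ∈ F ∪ (walkLaw (Subtype.val : S → G) (m + m)).support,
          walkLaw (Subtype.val : S → G) (m + m) x :=
      Finset.sum_le_sum_of_subset_of_nonneg Finset.subset_union_left
        fun x _ _ => walkLaw_nonneg _ _ x
    refine hsub.trans_eq (Finset.sum_subset Finset.subset_union_right ?_).symm
    intro x _ hx
    simpa using hx
  have h2 : ∑ _x ∈ F, α / 2 ≤ 1 := (Finset.sum_le_sum hm).trans hsum
  rw [Finset.sum_const, hF, nsmul_eq_mul] at h2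
  rw [div_lt_iff₀ hpos] at hk
  linarith

theorem exists_walkLaw_support_card_le {D : ℕ} (hG : PolyGrowth D G) (S : ι → G) :
    ∃ C : ℕ, ∀ m : ℕ, (walkLaw S m).support.card ≤ C * (m + 1) ^ D := by
  obtain ⟨C, hC⟩ := hG (Set.range S) (Set.finite_range S)
  refine ⟨C, fun m => ?_⟩
  refine le_trans ?_ (hC m)
  rw [← Set.ncard_coe_finset]
  exact Set.ncard_le_ncard (walkLaw_support_subset S m) ((Set.finite_range S).pow_of_finite m)

theorem exists_one_le_mul_returnProb [Nonempty S] {D : ℕ} (hG : PolyGrowth D G) :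
    ∃ C : ℕ, ∀ m : ℕ, 1 ≤ C * (m + 1 : ℝ) ^ D * returnProb S m := by
  obtain ⟨C, hC⟩ := exists_walkLaw_support_card_le hG (Subtype.val : S → G)
  refine ⟨C, fun m => ?_⟩
  have h := Finsupp.sq_sum_le_card_mul_dot (walkLaw (Subtype.val : S → G) m)
  rw [sum_walkLaw, one_pow] at h
  refine h.trans (mul_le_mul_of_nonneg_right ?_ (Finsupp.dot_self_nonneg _))
  exact_mod_cast hC m

theorem exists_walkEnergy_succ_ge [Nonempty S] [Infinite G] {D : ℕ} (hG : PolyGrowth D G)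
    (hsymm : ∀ s ∈ S, s⁻¹ ∈ S) (h1 : 1 ∈ S) (hgen : Subgroup.closure (S : Set G) = ⊤)
    {η : ℝ} (h0 : 0 < η) (hη : η < 1) : ∃ m, (1 - η) * walkEnergy S m ≤ walkEnergy S (m + 1) := by
  by_contra! hcon
  have hstep : ∀ m, η * returnProb S m ≤ walkEnergy S m := by
    intro m
    have hn : ∀ n, m ≤ n → η * (returnProb S m - returnProb S n) ≤
        walkEnergy S m - walkEnergy S n := by
      intro n hn
      induction n, hn using Nat.le_induction with
      | base => simp
      | succ n hn ih =>
        have := hcon n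
        have e : walkEnergy S n = returnProb S n - returnProb S (n + 1) := rfl
        nlinarith
    have hlim : Tendsto (fun n => η * (returnProb S m - returnProb S n)) atTop
        (nhds (η * (returnProb S m - 0))) :=
      ((tendsto_returnProb hsymm h1 hgen).const_sub _).const_mul _
    rw [sub_zero] at hlim
    refine le_of_tendsto hlim ?_
    filter_upwards [eventually_ge_atTop m] with n hmn
    linarith [hn n hmn, walkEnergy_nonneg hsymm n]
  have hpow : ∀ m, returnProb S m ≤ (1 - η) ^ m := by
    intro m
    induction m with
    | zero => rw [returnProb_zero, pow_zero]
    | succ m ih =>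
      have := hstep m
      rw [walkEnergy] at this
      rw [pow_succ]
      nlinarith
  obtain ⟨C, hC⟩ := exists_one_le_mul_returnProb (S := S) hG
  have ht := tendsto_pow_const_mul_const_pow_of_abs_lt_one D (r := 1 - η)
    (by rw [abs_lt]; constructor <;> linarith)
  have ht2 : Tendsto (fun m : ℕ => C * (1 - η)⁻¹ * (((m + 1 : ℕ) : ℝ) ^ D * (1 - η) ^ (m + 1)))
      atTop (nhds 0) := by
    simpa using ((tendsto_add_atTop_iff_nat 1).2 ht).const_mul (C * (1 - η)⁻¹)
  obtain ⟨m, hm⟩ := (ht2.eventually (gt_mem_nhds one_pos)).exists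
  have h2 := (hC m).trans (mul_le_mul_of_nonneg_left (hpow m) (by positivity))
  have e : (C : ℝ) * (1 - η)⁻¹ * (((m + 1 : ℕ) : ℝ) ^ D * (1 - η) ^ (m + 1)) =
      C * (m + 1 : ℝ) ^ D * (1 - η) ^ m := by
    have : (1 - η) ≠ 0 := by linarith
    rw [pow_succ]
    push_cast
    field_simp
  linarith

theorem walkEnergy_pos [Nonempty S] [Infinite G] {D : ℕ} (hG : PolyGrowth D G)
    (hsymm : ∀ s ∈ S, s⁻¹ ∈ S) (h1 : 1 ∈ S) (hgen : Subgroup.closure (S : Set G) = ⊤) (m : ℕ) :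
    0 < walkEnergy S m := by
  refine lt_of_le_of_ne (walkEnergy_nonneg hsymm m) fun h => ?_
  have hn : ∀ n, m ≤ n → returnProb S n = returnProb S m := by
    intro n hn
    induction n, hn using Nat.le_induction with
    | base => rfl
    | succ n hn ih =>
      have h2 := walkEnergy_nonneg hsymm n
      have h3 := walkEnergy_antitone hsymm hn
      have e : walkEnergy S n = returnProb S n - returnProb S (n + 1) := rfl
      linarith
  have h0 : returnProb S m = 0 := by
    refine tendsto_nhds_unique (tendsto_const_nhds.congr' ?_) (tendsto_returnProb hsymm h1 hgen)
    filter_upwards [eventually_ge_atTop m] with n h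
    rw [hn n h]
  obtain ⟨C, hC⟩ := exists_one_le_mul_returnProb (S := S) hG
  have := hC m
  rw [h0, mul_zero] at this
  linarith

theorem exists_nonconstant_harmonic [Nonempty S] [Infinite G] {D : ℕ} (hG : PolyGrowth D G)
    (hsymm : ∀ s ∈ S, s⁻¹ ∈ S) (h1 : 1 ∈ S) (hgen : Subgroup.closure (S : Set G) = ⊤) :
    ∃ f : G → ℝ, IsHarmonic (twoSteps S) f ∧ IsStepLipschitz (twoSteps S) f ∧ f 1 = 0 ∧
      ∃ x, f x ≠ 0 := by
  have hη : ∀ j : ℕ, ∃ m, (1 - 1 / ((j : ℝ) + 2)) * walkEnergy S m ≤ walkEnergy S (m + 1) :=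
    fun j => exists_walkEnergy_succ_ge hG hsymm h1 hgen (by positivity)
      (by rw [div_lt_one (by positivity)]; linarith [(Nat.cast_nonneg j : (0:ℝ) ≤ j)])
  choose m hm using hη
  have hpos := walkEnergy_pos hG hsymm h1 hgen
  choose C hC0 hC using exists_dot_leftTr_sub_le hsymm h1 hgen
  set u : ℕ → G →₀ ℝ := fun j => walkLaw (Subtype.val : S → G) (m j) with hu
  set e : ℕ → ℝ := fun j => walkEnergy S (m j) with he
  have hCS : ∀ j (v w : G →₀ ℝ) (A B : ℝ), 0 ≤ A → 0 ≤ B → Finsupp.dot v v ≤ A * e j →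
      Finsupp.dot w w ≤ B * e j → |Finsupp.dot v w / e j| ≤ Real.sqrt (A * B) := by
    intro j v w A B hA hB hv hw
    apply Real.abs_le_sqrt
    rw [div_pow, div_le_iff₀ (pow_pos (hpos _) 2)]
    refine (Finsupp.dot_sq_le v w).trans ?_
    calc _ ≤ (A * e j) * (B * e j) := mul_le_mul hv hw (Finsupp.dot_self_nonneg _)
          (mul_nonneg hA (hpos _).le)
      _ = _ := by ring
  set Φ : G → G → ℕ → ℝ := fun t x j =>
    Finsupp.dot (leftTr x (u j) - u j) (leftTr t (u j) - u j) / e j with hΦ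
  have hbd : ∀ t x j, |Φ t x j| ≤ Real.sqrt (C x * C t) := fun t x j =>
    hCS j _ _ _ _ (hC0 x) (hC0 t) (hC x _) (hC t _)
  choose F hF using fun t x => (hyperfilter ℕ).exists_tendsto_of_abs_le (hbd t x)
  have hF1 : ∀ t, F t 1 = 0 := by
    intro t
    refine tendsto_nhds_unique (hF t 1) ?_
    have : Φ t 1 = fun _ => 0 := by
      funext j
      simp only [hΦ, leftTr_one, sub_self, map_zero, LinearMap.zero_apply, zero_div]
    rw [this]
    exact tendsto_const_nhds
  obtain ⟨p, hp⟩ : ∃ p : S × S, F (twoSteps S p) (twoSteps S p) ≠ 0 := by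
    by_contra! hcon
    have h2 : Tendsto (fun j => (Fintype.card (S × S) : ℝ)⁻¹ *
        ∑ p, Φ (twoSteps S p) (twoSteps S p) j) (hyperfilter ℕ)
        (nhds ((Fintype.card (S × S) : ℝ)⁻¹ * ∑ p, F (twoSteps S p) (twoSteps S p))) :=
      (tendsto_finsetSum _ fun p _ => hF _ _).const_mul _
    have h3 : (fun j => (Fintype.card (S × S) : ℝ)⁻¹ *
        ∑ p, Φ (twoSteps S p) (twoSteps S p) j) = fun _ => 2 := by
      funext j
      simp only [hΦ]
      rw [← Finset.sum_div, ← mul_div_assoc, sum_dot_twoSteps hsymm,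
        mul_div_assoc, div_self (hpos _).ne', mul_one]
    rw [h3] at h2
    have := tendsto_nhds_unique h2 tendsto_const_nhds
    simp only [hcon, Finset.sum_const_zero, mul_zero] at this
    norm_num at this
  set t := twoSteps S p with ht
  refine ⟨F t, fun x => ?_, ?_, hF1 t, t, hp⟩
  · have h2 : Tendsto (fun j => (Fintype.card (S × S) : ℝ)⁻¹ *
        ∑ q, Φ t (x * twoSteps S q) j - Φ t x j) (hyperfilter ℕ)
        (nhds ((Fintype.card (S × S) : ℝ)⁻¹ * ∑ q, F t (x * twoSteps S q) - F t x)) :=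
      ((tendsto_finsetSum _ fun p _ => hF _ _).const_mul _).sub (hF _ _)
    have h3 : ∀ j, |(Fintype.card (S × S) : ℝ)⁻¹ *
        ∑ q, Φ t (x * twoSteps S q) j - Φ t x j| ≤ Real.sqrt (1 / ((j : ℝ) + 2) * C t) := by
      intro j
      have e1 : (Fintype.card (S × S) : ℝ)⁻¹ * ∑ q, Φ t (x * twoSteps S q) j - Φ t x j =
          Finsupp.dot (leftTr x (walkLaw (Subtype.val : S → G) (m j + 2) - u j))
            (leftTr t (u j) - u j) / e j := by
        have h0 : (Fintype.card (S × S) : ℝ) ≠ 0 := by exact_mod_cast Fintype.card_ne_zero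
        simp only [hΦ, ← Finset.sum_div]
        rw [← mul_div_assoc, ← sub_div]
        congr 1
        rw [← sum_leftTr_twoSteps]
        simp only [map_sub, map_smul, map_sum, LinearMap.sub_apply, LinearMap.smul_apply,
          LinearMap.sum_apply, smul_eq_mul, leftTr_mul, Finset.sum_sub_distrib, Finset.sum_const,
          Finset.card_univ, nsmul_eq_mul]
        field_simp
        ring
      rw [e1]
      refine hCS j _ _ _ _ (by positivity) (hC0 t) ?_ (hC t _)
      rw [dot_leftTr_leftTr, ← walkEnergy_sub_succ hsymm]
      have := hm j
      simp only [he]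
      linarith
    have h4 : Tendsto (fun j : ℕ => Real.sqrt (1 / ((j : ℝ) + 2) * C t)) atTop (nhds 0) := by
      have h5 : Tendsto (fun j : ℕ => 1 / ((j : ℝ) + 2)) atTop (nhds 0) := by
        have := (tendsto_add_atTop_iff_nat 1).2 (tendsto_one_div_add_atTop_nhds_zero_nat (𝕜 := ℝ))
        refine this.congr fun j => ?_
        push_cast
        ring
      have h6 := (h5.mul_const (C t)).sqrt
      simpa using h6
    have h7 := squeeze_zero_norm (fun j => (Real.norm_eq_abs _).trans_le (h3 j)) h4
    have h8 := tendsto_nhds_unique h2 (h7.mono_left (Nat.hyperfilter_le_atTop))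
    linarith
  · refine ⟨∑ q, Real.sqrt (C (twoSteps S q) * C t), fun x q => ?_⟩
    refine le_trans ?_ (Finset.single_le_sum (f := fun q : S × S =>
      Real.sqrt (C (twoSteps S q) * C t)) (fun _ _ => Real.sqrt_nonneg _) (Finset.mem_univ q))
    refine le_of_tendsto ((hF t (x * twoSteps S q)).sub (hF t x)).abs (Filter.Eventually.of_forall
      fun j => ?_)
    have e1 : Φ t (x * twoSteps S q) j - Φ t x j =
        Finsupp.dot (leftTr x (leftTr (twoSteps S q) (u j) - u j)) (leftTr t (u j) - u j) / e j := by
      simp only [hΦ]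
      rw [← sub_div, leftTr_mul]
      congr 1
      simp only [map_sub, LinearMap.sub_apply]
      ring
    rw [e1]
    refine hCS j _ _ _ _ (hC0 _) (hC0 t) ?_ (hC t _)
    rw [dot_leftTr_leftTr]
    exact hC _ _

end Harmonic

theorem two_mul_sub_sqrt_le_mul_log {t : ℝ} (ht : 0 ≤ t) : 2 * t - 2 * √t ≤ t * Real.log t := by
  rcases ht.eq_or_lt with rfl | ht
  · simp
  have hs : 0 < √t := Real.sqrt_pos.2 ht
  have h := Real.one_sub_inv_le_log_of_pos hs
  have e : Real.log t = 2 * Real.log (√t) := by rw [Real.log_sqrt ht.le]; ring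
  have h2 : t * (√t)⁻¹ = √t := by
    rw [← div_eq_mul_inv, div_eq_iff hs.ne', Real.mul_self_sqrt ht.le]
  rw [e]
  nlinarith

theorem sq_sub_div_le_mul_log {a b K : ℝ} (ha : 0 ≤ a) (hb : 0 < b) (hab : a ≤ K * b) :
    (a - b) ^ 2 / b ≤ 2 * (K + 1) * (a * Real.log a - a * Real.log b - a + b) := by
  obtain ⟨t, rfl⟩ : ∃ t, a = t * b := ⟨a / b, by field_simp⟩
  have ht : 0 ≤ t := nonneg_of_mul_nonneg_left ha hb
  have htK : t ≤ K := le_of_mul_le_mul_right hab hb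
  have e : t * b * Real.log (t * b) - t * b * Real.log b - t * b + b =
      b * (t * Real.log t - t + 1) := by
    rcases ht.eq_or_lt with rfl | ht
    · simp
    · rw [Real.log_mul ht.ne' hb.ne']; ring
  have e2 : (t * b - b) ^ 2 / b = b * (t - 1) ^ 2 := by field_simp
  rw [e, e2]
  have h1 := two_mul_sub_sqrt_le_mul_log ht
  have hs := Real.sq_sqrt ht
  have hs0 := Real.sqrt_nonneg t
  set r := √t
  have h2 : (t - 1) ^ 2 ≤ 2 * (K + 1) * (r - 1) ^ 2 := by
    have : (t - 1) ^ 2 = (r + 1) ^ 2 * (r - 1) ^ 2 := by rw [← hs]; ring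
    rw [this]
    refine mul_le_mul_of_nonneg_right ?_ (sq_nonneg _)
    nlinarith [sq_nonneg (r - 1)]
  have h3 : (r - 1) ^ 2 ≤ t * Real.log t - t + 1 := by nlinarith
  have h4 : 0 ≤ K + 1 := by linarith
  nlinarith [mul_le_mul_of_nonneg_left h3 (by positivity : 0 ≤ 2 * (K + 1)),
    mul_le_mul_of_nonneg_left h2 hb.le]

section Entropy

variable {G : Type*} {ι : Type*} [Fintype ι]

/-- The entropy of a finitely supported probability. -/
noncomputable def entropy (a : G →₀ ℝ) : ℝ := a.sum fun _ r => Real.negMulLog r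

theorem entropy_le_log_card (a : G →₀ ℝ) (h0 : ∀ x, 0 ≤ a x) (h1 : ∑ x ∈ a.support, a x = 1) :
    entropy a ≤ Real.log a.support.card := by
  have hne : a.support.Nonempty := by
    rw [Finset.nonempty_iff_ne_empty]
    rintro h
    rw [h, Finset.sum_empty] at h1
    exact one_ne_zero h1.symm
  have hN : (0 : ℝ) < a.support.card := by exact_mod_cast hne.card_pos
  have h : ∀ x ∈ a.support, Real.negMulLog (a x) ≤
      a x * Real.log a.support.card + ((a.support.card : ℝ)⁻¹ - a x) := by
    intro x hx
    have hx0 : 0 < a x := (h0 x).lt_of_ne (Finsupp.mem_support_iff.1 hx).symm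
    have h2 := Real.one_sub_inv_le_log_of_pos (mul_pos hx0 hN)
    rw [Real.log_mul hx0.ne' hN.ne'] at h2
    have h3 := mul_le_mul_of_nonneg_left h2 hx0.le
    have e : a x * (1 - (a x * a.support.card)⁻¹) = a x - (a.support.card : ℝ)⁻¹ := by
      field_simp
    rw [e] at h3
    rw [Real.negMulLog]
    linarith
  refine (Finset.sum_le_sum h).trans_eq ?_
  rw [Finset.sum_add_distrib, ← Finset.sum_mul, h1, Finset.sum_sub_distrib, h1, Finset.sum_const,
    nsmul_eq_mul, mul_inv_cancel₀ hN.ne']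
  ring

variable [Group G]

theorem entropy_leftTr (x : G) (a : G →₀ ℝ) : entropy (leftTr x a) = entropy a :=
  Finsupp.sum_mapDomain_index_inj (mul_right_injective x)

theorem leftTr_apply (x y : G) (a : G →₀ ℝ) : leftTr x a y = a (x⁻¹ * y) := by
  have h : leftTr x a y = Finsupp.dot (leftTr x a) (Finsupp.single y 1) := by
    rw [Finsupp.dot_single_right, one_mul]
  rw [h, dot_leftTr, leftTr_single, Finsupp.dot_single_right, one_mul]

theorem linearCombination_leftTr (f : G → ℝ) (x : G) (a : G →₀ ℝ) :
    Finsupp.linearCombination ℝ f (leftTr x a) =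
      Finsupp.linearCombination ℝ (fun y => f (x * y)) a := by
  rw [Finsupp.lmapDomain_apply, Finsupp.linearCombination_mapDomain]
  rfl

theorem IsHarmonic.linearCombination_walkLaw {S : ι → G} {f : G → ℝ} (hf : IsHarmonic S f)
    (n : ℕ) : Finsupp.linearCombination ℝ f (walkLaw S n) = f 1 := by
  induction n with
  | zero => simp [walkLaw_zero]
  | succ n ih =>
    rw [linearCombination_walkLaw_succ']
    simp only [hf _]
    exact ih

theorem IsHarmonic.comp_mul_left {S : ι → G} {f : G → ℝ} (hf : IsHarmonic S f) (g : G) :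
    IsHarmonic S fun x => f (g * x) := fun x => by
  simp only [← mul_assoc]
  exact hf (g * x)

theorem leftTr_walkLaw_le [Nonempty ι] (S : ι → G) (n : ℕ) (i : ι) (x : G) :
    leftTr (S i) (walkLaw S n) x ≤ Fintype.card ι * walkLaw S (n + 1) x := by
  have hK : (0 : ℝ) < Fintype.card ι := by exact_mod_cast Fintype.card_pos
  rw [← leftTr_walkLaw, Finsupp.smul_apply, Finsupp.finsetSum_apply, smul_eq_mul, ← mul_assoc,
    mul_inv_cancel₀ hK.ne', one_mul]
  refine Finset.single_le_sum (f := fun i => leftTr (S i) (walkLaw S n) x) (fun j _ => ?_)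
    (Finset.mem_univ i)
  rw [leftTr_apply]
  exact walkLaw_nonneg _ _ _

theorem sum_relEntropy_eq [Nonempty ι] (S : ι → G) (n : ℕ) :
    (Fintype.card ι : ℝ)⁻¹ * ∑ i, ∑ x ∈ (walkLaw S (n + 1)).support,
      (leftTr (S i) (walkLaw S n) x * Real.log (leftTr (S i) (walkLaw S n) x) -
        leftTr (S i) (walkLaw S n) x * Real.log (walkLaw S (n + 1) x) -
        leftTr (S i) (walkLaw S n) x + walkLaw S (n + 1) x) =
      entropy (walkLaw S (n + 1)) - entropy (walkLaw S n) := by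
  have hK : (0 : ℝ) < Fintype.card ι := by exact_mod_cast Fintype.card_pos
  have hsub : ∀ i, (leftTr (S i) (walkLaw S n)).support ⊆ (walkLaw S (n + 1)).support := by
    intro i x hx
    rw [Finsupp.mem_support_iff] at hx ⊢
    intro h
    have h2 := leftTr_walkLaw_le S n i x
    rw [h, mul_zero] at h2
    refine hx (le_antisymm h2 ?_)
    rw [leftTr_apply]
    exact walkLaw_nonneg _ _ _
  have h1 : ∀ i, ∑ x ∈ (walkLaw S (n + 1)).support,
      leftTr (S i) (walkLaw S n) x * Real.log (leftTr (S i) (walkLaw S n) x) =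
        -entropy (walkLaw S n) := by
    intro i
    rw [← entropy_leftTr (S i), entropy, Finsupp.sum_of_support_subset _ (hsub i) _ (by simp),
      ← Finset.sum_neg_distrib]
    simp [Real.negMulLog]
  have h2 : ∀ i, ∑ x ∈ (walkLaw S (n + 1)).support, leftTr (S i) (walkLaw S n) x = 1 := by
    intro i
    rw [← sum_walkLaw S n]
    have e : (leftTr (S i) (walkLaw S n)).sum (fun _ r => r) = (walkLaw S n).sum fun _ r => r :=
      Finsupp.sum_mapDomain_index_inj (mul_right_injective _)
    rw [Finsupp.sum_of_support_subset _ (hsub i) _ (by simp)] at e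
    exact e
  have h3 : ∑ i, ∑ x ∈ (walkLaw S (n + 1)).support,
      leftTr (S i) (walkLaw S n) x * Real.log (walkLaw S (n + 1) x) =
        -(Fintype.card ι * entropy (walkLaw S (n + 1))) := by
    rw [Finset.sum_comm, entropy, Finsupp.sum, Finset.mul_sum, ← Finset.sum_neg_distrib]
    refine Finset.sum_congr rfl fun x _ => ?_
    have e : ∑ i, leftTr (S i) (walkLaw S n) x = Fintype.card ι * walkLaw S (n + 1) x := by
      rw [← leftTr_walkLaw, Finsupp.smul_apply, Finsupp.finsetSum_apply, smul_eq_mul, ← mul_assoc,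
        mul_inv_cancel₀ hK.ne', one_mul]
    rw [← Finset.sum_mul, e, Real.negMulLog]
    ring
  simp only [Finset.sum_add_distrib, Finset.sum_sub_distrib, h1, h2, h3, sum_walkLaw,
    Finset.sum_const, Finset.card_univ, nsmul_eq_mul]
  field_simp
  ring

theorem IsHarmonic.sq_sub_le [Nonempty ι] {S : ι → G} {f : G → ℝ} (hf : IsHarmonic S f) (n : ℕ)
    (i : ι) : (f (S i) - f 1) ^ 2 ≤ 2 * (Fintype.card ι + 1) * Fintype.card ι *
      (entropy (walkLaw S (n + 1)) - entropy (walkLaw S n)) *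
      Finsupp.linearCombination ℝ (fun x => f x ^ 2) (walkLaw S (n + 1)) := by
  have hK : (0 : ℝ) < Fintype.card ι := by exact_mod_cast Fintype.card_pos
  set T := (walkLaw S (n + 1)).support with hT
  set p := walkLaw S (n + 1) with hp
  set q := fun i => leftTr (S i) (walkLaw S n) with hq
  have hq0 : ∀ i x, 0 ≤ q i x := fun i x => by
    simp only [hq, leftTr_apply]; exact walkLaw_nonneg _ _ _
  have hqp : ∀ i x, q i x ≤ Fintype.card ι * p x := leftTr_walkLaw_le S n
  have hp0 : ∀ x ∈ T, 0 < p x := fun x hx =>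
    (walkLaw_nonneg _ _ _).lt_of_ne (Finsupp.mem_support_iff.1 hx).symm
  have hpt : ∀ i, ∀ x ∈ T, (q i x - p x) ^ 2 / p x ≤ 2 * (Fintype.card ι + 1) *
      (q i x * Real.log (q i x) - q i x * Real.log (p x) - q i x + p x) := fun i x hx =>
    sq_sub_div_le_mul_log (hq0 i x) (hp0 x hx) (hqp i x)
  have hsum : ∑ x ∈ T, (q i x - p x) ^ 2 / p x ≤ 2 * (Fintype.card ι + 1) * Fintype.card ι *
      (entropy p - entropy (walkLaw S n)) := by
    have h1 : ∑ x ∈ T, (q i x - p x) ^ 2 / p x ≤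
        ∑ i, ∑ x ∈ T, (q i x - p x) ^ 2 / p x :=
      Finset.single_le_sum (f := fun i => ∑ x ∈ T, (q i x - p x) ^ 2 / p x)
        (fun j _ => Finset.sum_nonneg fun x hx => div_nonneg (sq_nonneg _) (hp0 x hx).le)
        (Finset.mem_univ i)
    refine h1.trans ((Finset.sum_le_sum fun i _ => Finset.sum_le_sum (hpt i)).trans_eq ?_)
    have := sum_relEntropy_eq S n
    rw [inv_mul_eq_iff_eq_mul₀ hK.ne'] at this
    simp only [← Finset.mul_sum]
    rw [this]
    ring
  have hfi : f (S i) - f 1 = ∑ x ∈ T, (q i x - p x) * f x := by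
    have h1 := hf.linearCombination_walkLaw (n + 1)
    have h2 := (hf.comp_mul_left (S i)).linearCombination_walkLaw n
    rw [mul_one, ← linearCombination_leftTr, Finsupp.linearCombination_apply] at h2
    rw [Finsupp.linearCombination_apply] at h1
    rw [Finsupp.sum_of_support_subset _ (s := T) _ _ (by simp)] at h2
    · rw [← h1, ← h2, Finsupp.sum, ← Finset.sum_sub_distrib]
      refine Finset.sum_congr rfl fun x _ => ?_
      simp only [smul_eq_mul, hq, hp]
      ring
    · intro x hx
      rw [Finsupp.mem_support_iff] at hx
      rw [hT, Finsupp.mem_support_iff]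
      intro h
      have := hqp i x
      rw [h, mul_zero] at this
      exact hx (le_antisymm this (hq0 i x))
  have hE : Finsupp.linearCombination ℝ (fun x => f x ^ 2) p = ∑ x ∈ T, p x * f x ^ 2 := by
    rw [Finsupp.linearCombination_apply]; rfl
  have hCS : (∑ x ∈ T, (q i x - p x) * f x) ^ 2 ≤
      (∑ x ∈ T, (q i x - p x) ^ 2 / p x) * ∑ x ∈ T, p x * f x ^ 2 := by
    refine Finset.sum_sq_le_sum_mul_sum_of_sq_le_mul T
      (fun x hx => div_nonneg (sq_nonneg _) (hp0 x hx).le)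
      (fun x hx => mul_nonneg (hp0 x hx).le (sq_nonneg _)) fun x hx => ?_
    have := (hp0 x hx).ne'
    refine le_of_eq ?_
    field_simp
  rw [hfi, hE]
  exact hCS.trans (mul_le_mul_of_nonneg_right hsum
    (Finset.sum_nonneg fun x hx => mul_nonneg (hp0 x hx).le (sq_nonneg _)))

theorem frequently_entropy_sub_le [Nonempty ι] {D : ℕ} (hG : PolyGrowth D G) (S : ι → G) :
    ∃ᶠ n : ℕ in atTop, entropy (walkLaw S (n + 1)) - entropy (walkLaw S n) ≤
      (D + 1) / (n + 1 : ℝ) := by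
  intro hev
  simp only [not_le] at hev
  obtain ⟨N, hN⟩ := eventually_atTop.1 hev
  obtain ⟨C, hC⟩ := exists_walkLaw_support_card_le hG S
  have hup : ∀ n : ℕ, entropy (walkLaw S n) ≤ Real.log (C + 1) + D * Real.log (n + 1) := by
    intro n
    refine (entropy_le_log_card _ (walkLaw_nonneg S n) (sum_walkLaw S n)).trans ?_
    rw [← Real.log_pow, ← Real.log_mul (by positivity) (by positivity)]
    have h1 : (1 : ℝ) ≤ (walkLaw S n).support.card := by
      have : (walkLaw S n).support.Nonempty := by
        rw [Finset.nonempty_iff_ne_empty]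
        intro h
        have := sum_walkLaw S n
        rw [h, Finset.sum_empty] at this
        exact one_ne_zero this.symm
      exact_mod_cast this.card_pos
    refine Real.log_le_log (by linarith) ?_
    have h2 : ((walkLaw S n).support.card : ℝ) ≤ C * (n + 1) ^ D := by exact_mod_cast hC n
    have h3 : (0 : ℝ) ≤ (n + 1) ^ D := by positivity
    nlinarith
  have hlow : ∀ n, N ≤ n → entropy (walkLaw S N) + (D + 1) * (Real.log (n + 1) - Real.log (N + 1))
      ≤ entropy (walkLaw S n) := by
    intro n hn
    induction n, hn using Nat.le_induction with
    | base => simp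
    | succ n hn ih =>
      have h1 := hN n hn
      have h2 : Real.log ((n + 1 : ℕ) + 1) - Real.log (n + 1) ≤ 1 / (n + 1 : ℝ) := by
        rw [← Real.log_div (by positivity) (by positivity)]
        refine (Real.log_le_sub_one_of_pos (by positivity)).trans_eq ?_
        push_cast
        field_simp
        ring
      have h3 := mul_le_mul_of_nonneg_left h2 (by positivity : (0 : ℝ) ≤ D + 1)
      rw [mul_one_div] at h3
      linarith
  have ht : Tendsto (fun n : ℕ => Real.log ((n : ℝ) + 1)) atTop atTop :=
    Real.tendsto_log_atTop.comp (tendsto_atTop_add_const_right _ _ tendsto_natCast_atTop_atTop)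
  obtain ⟨n, hn, hn2⟩ := ((eventually_ge_atTop N).and (ht.eventually_gt_atTop
    (Real.log (C + 1) - entropy (walkLaw S N) + (D + 1) * Real.log (N + 1)))).exists
  have := hlow n hn
  have := hup n
  linarith

theorem exists_frequently_sq_sub_le [Nonempty ι] {D : ℕ} (hG : PolyGrowth D G) (S : ι → G) :
    ∃ C : ℝ, 0 ≤ C ∧ ∃ᶠ n : ℕ in atTop, 0 < n ∧ ∀ f, IsHarmonic S f → ∀ i, (f (S i) - f 1) ^ 2 ≤
      C * (Finsupp.linearCombination ℝ (fun x => f x ^ 2) (walkLaw S n) / n) := by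
  refine ⟨2 * (Fintype.card ι + 1) * Fintype.card ι * (D + 1), by positivity, ?_⟩
  refine Filter.Tendsto.frequently (tendsto_add_atTop_nat 1)
    ((frequently_entropy_sub_le hG S).mono fun n hn => ⟨n.succ_pos, fun f hf i => ?_⟩)
  refine (hf.sq_sub_le n i).trans ?_
  have h0 : 0 ≤ Finsupp.linearCombination ℝ (fun x => f x ^ 2) (walkLaw S (n + 1)) := by
    rw [Finsupp.linearCombination_apply]
    exact Finset.sum_nonneg fun x _ => mul_nonneg (walkLaw_nonneg _ _ _) (sq_nonneg _)
  calc _ ≤ 2 * (Fintype.card ι + 1) * Fintype.card ι * ((D + 1) / (n + 1 : ℝ)) *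
      Finsupp.linearCombination ℝ (fun x => f x ^ 2) (walkLaw S (n + 1)) := by gcongr
    _ = _ := by push_cast; ring

theorem IsHarmonic.eq_of_bounded [Nonempty ι] {D : ℕ} (hG : PolyGrowth D G) {S : ι → G}
    (hgen : Subgroup.closure (Set.range S) = ⊤) {f : G → ℝ} (hf : IsHarmonic S f) {M : ℝ}
    (hM : ∀ x, |f x| ≤ M) (x : G) : f x = f 1 := by
  obtain ⟨C, hC0, hC⟩ := exists_frequently_sq_sub_le hG S
  have key : ∀ x i, f (x * S i) = f x := by
    intro x i
    by_contra hne
    have hpos : 0 < (f (x * S i) - f x) ^ 2 := sq_pos_of_ne_zero (sub_ne_zero.2 hne)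
    have ht : Tendsto (fun n : ℕ => C * (M ^ 2 / n)) atTop (nhds 0) := by
      simpa using (tendsto_const_div_atTop_nhds_zero_nat (M ^ 2)).const_mul C
    obtain ⟨n, ⟨hn0, hn⟩, hn2⟩ := (hC.and_eventually (ht.eventually (gt_mem_nhds hpos))).exists
    have h1 := hn _ (hf.comp_mul_left x) i
    simp only [mul_one] at h1
    have h2 : Finsupp.linearCombination ℝ (fun y => f (x * y) ^ 2) (walkLaw S n) ≤ M ^ 2 := by
      rw [← linearCombination_walkLaw_const S n (M ^ 2), Finsupp.linearCombination_apply,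
        Finsupp.linearCombination_apply]
      exact Finset.sum_le_sum fun y _ => mul_le_mul_of_nonneg_left
        (sq_le_sq' (abs_le.1 (hM _)).1 (abs_le.1 (hM _)).2) (walkLaw_nonneg _ _ _)
    have h3 : C * (Finsupp.linearCombination ℝ (fun y => f (x * y) ^ 2) (walkLaw S n) / n) ≤
        C * (M ^ 2 / n) := by gcongr
    linarith
  have hx : x ∈ Subgroup.closure (Set.range S) := hgen ▸ Subgroup.mem_top x
  have hall : ∀ y, f (y * x) = f y := by
    induction hx using Subgroup.closure_induction with
    | mem s hs =>
      obtain ⟨i, rfl⟩ := hs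
      exact fun y => key y i
    | one => simp
    | mul a b _ _ ha hb => intro y; rw [← mul_assoc, hb, ha]
    | inv a _ ha => intro y; rw [← ha (y * a⁻¹), inv_mul_cancel_right]
  simpa using hall 1

end Entropy

section Bounded

variable {G : Type*}

/-- Boundedness of a real function. -/
def IsBdd (f : G → ℝ) : Prop := ∃ B, ∀ x, |f x| ≤ B

theorem IsBdd.add {f g : G → ℝ} (hf : IsBdd f) (hg : IsBdd g) : IsBdd (f + g) := by
  obtain ⟨B, hB⟩ := hf
  obtain ⟨B', hB'⟩ := hg
  exact ⟨B + B', fun x => (abs_add_le _ _).trans (add_le_add (hB x) (hB' x))⟩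

theorem IsBdd.smul {f : G → ℝ} (hf : IsBdd f) (r : ℝ) : IsBdd (r • f) := by
  obtain ⟨B, hB⟩ := hf
  refine ⟨|r| * B, fun x => ?_⟩
  rw [Pi.smul_apply, smul_eq_mul, abs_mul]
  exact mul_le_mul_of_nonneg_left (hB x) (abs_nonneg _)

theorem isBdd_sum {κ : Type*} (s : Finset κ) {f : κ → G → ℝ} (h : ∀ i, IsBdd (f i)) :
    IsBdd (∑ i ∈ s, f i) := by
  classical
  induction s using Finset.induction_on with
  | empty => exact ⟨0, by simp⟩
  | insert a s ha ih => rw [Finset.sum_insert ha]; exact (h a).add ih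

theorem IsBdd.comp_mul_left [Group G] {f : G → ℝ} (hf : IsBdd f) (g : G) : IsBdd fun x => f (g * x) :=
  hf.imp fun _ h x => h (g * x)

end Bounded

section Mean

variable {G : Type*} [Group G] {ι : Type*} [Fintype ι]

/-- Expectation of a function at time `n` of the random walk. -/
noncomputable def walkExp (S : ι → G) (n : ℕ) : (G → ℝ) →ₗ[ℝ] ℝ :=
  ∑ x ∈ (walkLaw S n).support, walkLaw S n x • LinearMap.proj x

theorem walkExp_eq (S : ι → G) (n : ℕ) (f : G → ℝ) :
    walkExp S n f = Finsupp.linearCombination ℝ f (walkLaw S n) := by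
  simp [walkExp, Finsupp.linearCombination_apply, Finsupp.sum, LinearMap.sum_apply]

theorem walkExp_apply (S : ι → G) (n : ℕ) (f : G → ℝ) :
    walkExp S n f = ∑ x ∈ (walkLaw S n).support, walkLaw S n x * f x := by
  simp [walkExp, LinearMap.sum_apply]

theorem walkExp_mono (S : ι → G) (n : ℕ) {f g : G → ℝ} (h : ∀ x, f x ≤ g x) :
    walkExp S n f ≤ walkExp S n g := by
  rw [walkExp_apply, walkExp_apply]
  exact Finset.sum_le_sum fun x _ => mul_le_mul_of_nonneg_left (h x) (walkLaw_nonneg _ _ _)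

theorem walkExp_const [Nonempty ι] (S : ι → G) (n : ℕ) (c : ℝ) :
    walkExp S n (fun _ => c) = c := by
  rw [walkExp_eq, linearCombination_walkLaw_const]

theorem abs_walkExp_le [Nonempty ι] (S : ι → G) (n : ℕ) {f : G → ℝ} {B : ℝ}
    (h : ∀ x, |f x| ≤ B) : |walkExp S n f| ≤ B := by
  rw [abs_le]
  constructor
  · rw [← walkExp_const S n (-B)]
    exact walkExp_mono S n fun x => (abs_le.1 (h x)).1
  · rw [← walkExp_const S n B]
    exact walkExp_mono S n fun x => (abs_le.1 (h x)).2

theorem walkExp_zero (S : ι → G) (f : G → ℝ) : walkExp S 0 f = f 1 := by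
  rw [walkExp_eq, walkLaw_zero]; simp

theorem walkExp_succ (S : ι → G) (n : ℕ) (f : G → ℝ) : walkExp S (n + 1) f =
    (Fintype.card ι : ℝ)⁻¹ * ∑ i, walkExp S n (fun x => f (S i * x)) := by
  simp only [walkExp_eq, linearCombination_walkLaw_succ]

theorem walkExp_succ' (S : ι → G) (n : ℕ) (f : G → ℝ) : walkExp S (n + 1) f =
    walkExp S n (fun x => (Fintype.card ι : ℝ)⁻¹ * ∑ i, f (x * S i)) := by
  simp only [walkExp_eq, linearCombination_walkLaw_succ']

/-- Time averages of the expectation of a function along the random walk. -/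
noncomputable def walkAvg (S : ι → G) (n : ℕ) : (G → ℝ) →ₗ[ℝ] ℝ :=
  (n : ℝ)⁻¹ • ∑ k ∈ Finset.range n, walkExp S k

theorem walkAvg_apply (S : ι → G) (n : ℕ) (f : G → ℝ) :
    walkAvg S n f = (n : ℝ)⁻¹ * ∑ k ∈ Finset.range n, walkExp S k f := by
  simp [walkAvg, LinearMap.sum_apply]

theorem walkAvg_mono (S : ι → G) (n : ℕ) {f g : G → ℝ} (h : ∀ x, f x ≤ g x) :
    walkAvg S n f ≤ walkAvg S n g := by
  rw [walkAvg_apply, walkAvg_apply]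
  exact mul_le_mul_of_nonneg_left (Finset.sum_le_sum fun k _ => walkExp_mono S k h) (by positivity)

theorem walkAvg_const [Nonempty ι] (S : ι → G) {n : ℕ} (hn : n ≠ 0) (c : ℝ) :
    walkAvg S n (fun _ => c) = c := by
  have : (n : ℝ) ≠ 0 := by exact_mod_cast hn
  rw [walkAvg_apply]
  simp only [walkExp_const, Finset.sum_const, Finset.card_range, nsmul_eq_mul]
  rw [← mul_assoc, inv_mul_cancel₀ this, one_mul]

theorem abs_walkAvg_le [Nonempty ι] (S : ι → G) (n : ℕ) {f : G → ℝ} {B : ℝ}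
    (h : ∀ x, |f x| ≤ B) : |walkAvg S n f| ≤ B := by
  rcases eq_or_ne n 0 with rfl | hn
  · rw [walkAvg_apply]
    simpa using (abs_nonneg _).trans (h 1)
  rw [abs_le]
  constructor
  · rw [← walkAvg_const S hn (-B)]
    exact walkAvg_mono S n fun x => (abs_le.1 (h x)).1
  · rw [← walkAvg_const S hn B]
    exact walkAvg_mono S n fun x => (abs_le.1 (h x)).2

/-- The asymptotic mean of a bounded function along the random walk. -/
noncomputable def walkMean (S : ι → G) (U : Ultrafilter ℕ) (f : G → ℝ) : ℝ :=
  limUnder (U : Filter ℕ) fun n => walkAvg S n f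

theorem tendsto_walkMean [Nonempty ι] (S : ι → G) (U : Ultrafilter ℕ) {f : G → ℝ} (hf : IsBdd f) :
    Tendsto (fun n => walkAvg S n f) U (nhds (walkMean S U f)) := by
  obtain ⟨B, hB⟩ := hf
  exact tendsto_nhds_limUnder (U.exists_tendsto_of_abs_le fun n => abs_walkAvg_le S n hB)

variable [Nonempty ι] (S : ι → G) (U : Ultrafilter ℕ)

theorem walkMean_add {f g : G → ℝ} (hf : IsBdd f) (hg : IsBdd g) :
    walkMean S U (f + g) = walkMean S U f + walkMean S U g := by
  refine tendsto_nhds_unique (tendsto_walkMean S U (hf.add hg)) ?_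
  simp only [map_add]
  exact (tendsto_walkMean S U hf).add (tendsto_walkMean S U hg)

theorem walkMean_smul {f : G → ℝ} (hf : IsBdd f) (r : ℝ) :
    walkMean S U (r • f) = r * walkMean S U f := by
  refine tendsto_nhds_unique (tendsto_walkMean S U (hf.smul r)) ?_
  simp only [map_smul, smul_eq_mul]
  exact (tendsto_walkMean S U hf).const_mul r

theorem walkMean_const (hU : (U : Filter ℕ) ≤ atTop) (c : ℝ) :
    walkMean S U (fun _ => c) = c := by
  refine tendsto_nhds_unique (tendsto_walkMean S U ⟨|c|, fun _ => le_rfl⟩)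
    (tendsto_const_nhds.congr' ?_)
  filter_upwards [hU (eventually_gt_atTop 0)] with n hn
  rw [walkAvg_const S (Nat.pos_iff_ne_zero.1 hn)]

theorem walkMean_mono {f g : G → ℝ} (hf : IsBdd f) (hg : IsBdd g) (h : ∀ x, f x ≤ g x) :
    walkMean S U f ≤ walkMean S U g :=
  le_of_tendsto_of_tendsto' (tendsto_walkMean S U hf) (tendsto_walkMean S U hg)
    fun n => walkAvg_mono S n h

theorem walkMean_sum {κ : Type*} (s : Finset κ) {f : κ → G → ℝ} (h : ∀ i, IsBdd (f i)) :
    walkMean S U (∑ i ∈ s, f i) = ∑ i ∈ s, walkMean S U (f i) := by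
  refine tendsto_nhds_unique (tendsto_walkMean S U (isBdd_sum s h)) ?_
  simp only [map_sum]
  exact tendsto_finsetSum _ fun i _ => tendsto_walkMean S U (h i)

theorem walkMean_comp_mul_left {D : ℕ} (hG : PolyGrowth D G)
    (hgen : Subgroup.closure (Set.range S) = ⊤) (hU : (U : Filter ℕ) ≤ atTop) {f : G → ℝ}
    (hf : IsBdd f) (g : G) : walkMean S U (fun x => f (g * x)) = walkMean S U f := by
  obtain ⟨B, hB⟩ := hf
  have hfg : ∀ g, IsBdd fun x => f (g * x) := fun g => IsBdd.comp_mul_left ⟨B, hB⟩ g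
  have hharm : IsHarmonic S fun g => walkMean S U (fun x => f (g * x)) := by
    intro g
    have h1 : Tendsto (fun n => (Fintype.card ι : ℝ)⁻¹ * ∑ i, walkAvg S n
        (fun x => f (g * S i * x)) - walkAvg S n (fun x => f (g * x))) U
        (nhds ((Fintype.card ι : ℝ)⁻¹ * ∑ i, walkMean S U (fun x => f (g * S i * x)) -
          walkMean S U (fun x => f (g * x)))) :=
      ((tendsto_finsetSum _ fun i _ => tendsto_walkMean S U (hfg _)).const_mul _).sub
        (tendsto_walkMean S U (hfg _))
    have h2 : ∀ n, (Fintype.card ι : ℝ)⁻¹ * ∑ i, walkAvg S n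
        (fun x => f (g * S i * x)) - walkAvg S n (fun x => f (g * x)) =
        (n : ℝ)⁻¹ * (walkExp S n (fun x => f (g * x)) - walkExp S 0 (fun x => f (g * x))) := by
      intro n
      rw [← Finset.sum_range_sub (fun n => walkExp S n (fun x => f (g * x)))]
      simp only [walkAvg_apply, ← Finset.mul_sum, walkExp_succ, Finset.sum_sub_distrib,
        ← mul_assoc]
      rw [Finset.sum_comm]
      ring
    have h3 : Tendsto (fun n : ℕ => (2 * B) / n) U (nhds 0) :=
      (tendsto_const_div_atTop_nhds_zero_nat (2 * B)).mono_left hU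
    have h4 := squeeze_zero_norm (fun n => ?_) h3 (f := fun n => (Fintype.card ι : ℝ)⁻¹ *
      ∑ i, walkAvg S n (fun x => f (g * S i * x)) - walkAvg S n (fun x => f (g * x)))
    · exact sub_eq_zero.1 (tendsto_nhds_unique h1 h4)
    · rw [h2, Real.norm_eq_abs, abs_mul, abs_inv, Nat.abs_cast, div_eq_inv_mul]
      refine mul_le_mul_of_nonneg_left ?_ (by positivity)
      refine (abs_sub _ _).trans ?_
      have := abs_walkExp_le S n (f := fun x => f (g * x)) fun x => hB _
      have := abs_walkExp_le S 0 (f := fun x => f (g * x)) fun x => hB _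
      linarith
  have hbd : ∀ g, |walkMean S U (fun x => f (g * x))| ≤ B := fun g =>
    le_of_tendsto (tendsto_walkMean S U (hfg g)).abs
      (Eventually.of_forall fun n => abs_walkAvg_le S n fun x => hB _)
  simpa using hharm.eq_of_bounded hG hgen hbd g

end Mean

theorem finiteDimensional_of_orthonormal_card_le {V : Type*} [NormedAddCommGroup V]
    [InnerProductSpace ℝ V] (N : ℕ) (h : ∀ (n : ℕ) (v : Fin n → V), Orthonormal ℝ v → n ≤ N) :
    FiniteDimensional ℝ V := by
  by_contra hinf
  have hrank : ((N + 1 : ℕ) : Cardinal) ≤ Module.rank ℝ V := by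
    refine (Cardinal.natCast_lt_aleph0 (n := N + 1)).le.trans ?_
    rw [← not_lt, Module.rank_lt_aleph0_iff]
    exact hinf
  obtain ⟨v, hv⟩ := exists_linearIndependent_of_le_rank hrank
  have := h _ _ (InnerProductSpace.gramSchmidtNormed_orthonormal hv)
  omega

theorem exists_finiteIndex_commute_of_isometric {D : ℕ} {G : Type*} [Group G] [Group.FG G]
    (hG : PolyGrowth D G) {V : Type*} [AddCommGroup V] [Module ℝ V]
    (c : InnerProductSpace.Core ℝ V) (N : ℕ)
    (hN : ∀ (n : ℕ) (v : Fin n → V), (∀ i j, c.inner (v i) (v j) = if i = j then 1 else 0) → n ≤ N)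
    (ρ : G →* Module.End ℝ V) (hρ : ∀ g v, c.inner (ρ g v) (ρ g v) = c.inner v v) :
    ∃ H : Subgroup G, H.FiniteIndex ∧ ∀ g ∈ H, ∀ h ∈ H, ρ g * ρ h = ρ h * ρ g := by
  let : NormedAddCommGroup V := c.toNormedAddCommGroup
  let : InnerProductSpace ℝ V := InnerProductSpace.ofCore c.toCore
  have : FiniteDimensional ℝ V := finiteDimensional_of_orthonormal_card_le N fun n v hv =>
    hN n v fun i j => orthonormal_iff_ite.1 hv i j
  let T : Module.End ℝ V ≃ₐ[ℝ] (V →L[ℝ] V) := Module.End.toContinuousLinearMap V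
  have : FiniteDimensional ℝ (V →L[ℝ] V) := T.toLinearEquiv.finiteDimensional
  have : ProperSpace (V →L[ℝ] V) := FiniteDimensional.proper_real (V →L[ℝ] V)
  obtain ⟨H, hH, hcomm⟩ := exists_finiteIndex_map_commute hG (A := V →L[ℝ] V)
    ((T : Module.End ℝ V →* (V →L[ℝ] V)).comp ρ) fun g => by
      refine ContinuousLinearMap.opNorm_le_bound _ zero_le_one fun v => ?_
      rw [one_mul]
      refine le_of_eq ?_
      change ‖ρ g v‖ = ‖v‖
      rw [@norm_eq_sqrt_real_inner V, @norm_eq_sqrt_real_inner V]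
      exact congrArg Real.sqrt (hρ g v)
  refine ⟨H, hH, fun g hg h hh => T.injective ?_⟩
  rw [map_mul, map_mul]
  exact hcomm g hg h hh

section HarmonicSpace

variable {G : Type*} [Group G] {ι : Type*} [Fintype ι]

/-- Harmonic functions which are Lipschitz along the walk and vanish at the identity. -/
def harmonicSubmodule (S : ι → G) : Submodule ℝ (G → ℝ) where
  carrier := {f | IsHarmonic S f ∧ IsStepLipschitz S f ∧ f 1 = 0}
  zero_mem' := ⟨fun x => by simp, ⟨0, by simp⟩, rfl⟩
  add_mem' := by
    rintro f g ⟨hf, ⟨K, hK⟩, hf1⟩ ⟨hg, ⟨K', hK'⟩, hg1⟩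
    refine ⟨fun x => ?_, ⟨K + K', fun x i => ?_⟩, ?_⟩
    · simp only [Pi.add_apply, Finset.sum_add_distrib, mul_add, hf x, hg x]
    · rw [Pi.add_apply, Pi.add_apply, add_sub_add_comm]
      exact (abs_add_le _ _).trans (add_le_add (hK x i) (hK' x i))
    · rw [Pi.add_apply, hf1, hg1, add_zero]
  smul_mem' := by
    rintro r f ⟨hf, ⟨K, hK⟩, hf1⟩
    refine ⟨fun x => ?_, ⟨|r| * K, fun x i => ?_⟩, ?_⟩
    · simp only [Pi.smul_apply, smul_eq_mul, ← Finset.mul_sum]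
      rw [mul_left_comm, hf x]
    · rw [Pi.smul_apply, Pi.smul_apply, ← smul_sub, smul_eq_mul, abs_mul]
      exact mul_le_mul_of_nonneg_left (hK x i) (abs_nonneg _)
    · rw [Pi.smul_apply, hf1, smul_zero]

/-- The averaged product of increments of two functions. -/
noncomputable def gradForm (S : ι → G) (f g : G → ℝ) (x : G) : ℝ :=
  (Fintype.card ι : ℝ)⁻¹ * ∑ i, (f (x * S i) - f x) * (g (x * S i) - g x)

theorem gradForm_comm (S : ι → G) (f g : G → ℝ) : gradForm S f g = gradForm S g f := by
  funext x
  simp only [gradForm, mul_comm]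

theorem gradForm_add_left (S : ι → G) (f f' g : G → ℝ) :
    gradForm S (f + f') g = gradForm S f g + gradForm S f' g := by
  funext x
  simp only [gradForm, Pi.add_apply, ← mul_add, ← Finset.sum_add_distrib]
  congr 1
  exact Finset.sum_congr rfl fun i _ => by ring

theorem gradForm_smul_left (S : ι → G) (r : ℝ) (f g : G → ℝ) :
    gradForm S (r • f) g = r • gradForm S f g := by
  funext x
  simp only [gradForm, Pi.smul_apply, smul_eq_mul]
  rw [mul_left_comm r, Finset.mul_sum _ _ r]
  congr 1
  exact Finset.sum_congr rfl fun i _ => by ring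

theorem gradForm_self_nonneg (S : ι → G) (f : G → ℝ) (x : G) : 0 ≤ gradForm S f f x :=
  mul_nonneg (by positivity) (Finset.sum_nonneg fun _ _ => mul_self_nonneg _)

theorem isBdd_gradForm {S : ι → G} {f g : G → ℝ} (hf : IsStepLipschitz S f)
    (hg : IsStepLipschitz S g) : IsBdd (gradForm S f g) := by
  obtain ⟨K, hK⟩ := hf
  obtain ⟨K', hK'⟩ := hg
  refine ⟨(Fintype.card ι : ℝ)⁻¹ * ∑ _i : ι, K * K', fun x => ?_⟩
  rw [gradForm, abs_mul, abs_of_nonneg (by positivity : 0 ≤ (Fintype.card ι : ℝ)⁻¹)]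
  refine mul_le_mul_of_nonneg_left ((Finset.abs_sum_le_sum_abs _ _).trans
    (Finset.sum_le_sum fun i _ => ?_)) (by positivity)
  rw [abs_mul]
  exact mul_le_mul (hK x i) (hK' x i) (abs_nonneg _) ((abs_nonneg _).trans (hK x i))

/-- Left translation of functions vanishing at the identity. -/
def translateFun (g : G) : (G → ℝ) →ₗ[ℝ] (G → ℝ) where
  toFun f x := f (g⁻¹ * x) - f g⁻¹
  map_add' f f' := by funext x; simp only [Pi.add_apply]; ring
  map_smul' r f := by
    funext x; simp only [Pi.smul_apply, smul_eq_mul, RingHom.id_apply]; ring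

theorem gradForm_translateFun (S : ι → G) (g : G) (f f' : G → ℝ) :
    gradForm S (translateFun g f) (translateFun g f') = fun x => gradForm S f f' (g⁻¹ * x) := by
  funext x
  simp [gradForm, translateFun, mul_assoc]

variable [Nonempty ι]

theorem walkExp_sq {S : ι → G} {f : G → ℝ} (hf : IsHarmonic S f) (n : ℕ) :
    walkExp S n (fun x => f x ^ 2) =
      f 1 ^ 2 + ∑ k ∈ Finset.range n, walkExp S k (gradForm S f f) := by
  induction n with
  | zero => rw [walkExp_zero]; simp
  | succ n ih =>
    rw [Finset.sum_range_succ, ← add_assoc, ← ih, walkExp_succ', ← map_add]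
    congr 1
    funext x
    have h0 : (Fintype.card ι : ℝ) ≠ 0 := by exact_mod_cast Fintype.card_ne_zero
    have h := hf x
    rw [inv_mul_eq_iff_eq_mul₀ h0] at h
    have e : ∀ i, (f (x * S i) - f x) * (f (x * S i) - f x) =
        f (x * S i) ^ 2 - 2 * f x * f (x * S i) + f x ^ 2 := fun i => by ring
    simp only [Pi.add_apply, gradForm, e, Finset.sum_add_distrib, Finset.sum_sub_distrib,
      ← Finset.mul_sum, h, Finset.sum_const, Finset.card_univ, nsmul_eq_mul]
    field_simp
    ring

theorem exists_ultrafilter_sq_le {D : ℕ} (hG : PolyGrowth D G) (S : ι → G) :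
    ∃ C : ℝ, 0 ≤ C ∧ ∃ U : Ultrafilter ℕ, (U : Filter ℕ) ≤ atTop ∧
      ∀ f ∈ harmonicSubmodule S, ∀ i, f (S i) ^ 2 ≤ C * walkMean S U (gradForm S f f) := by
  obtain ⟨C, hC, hfr⟩ := exists_frequently_sq_sub_le hG S
  rw [Filter.frequently_iff_neBot] at hfr
  set P : Set ℕ := {n : ℕ | _} with hP
  let U : Ultrafilter ℕ := @Ultrafilter.of _ (atTop ⊓ 𝓟 P) hfr
  have hU : (U : Filter ℕ) ≤ atTop ⊓ 𝓟 P := @Ultrafilter.of_le _ _ hfr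
  refine ⟨C, hC, U, hU.trans inf_le_left, ?_⟩
  have hev : ∀ᶠ n in (U : Filter ℕ), n ∈ P :=
    hU.trans inf_le_right (Filter.mem_principal_self P)
  rintro f ⟨hf, hL, hf1⟩ i
  refine ge_of_tendsto ((tendsto_walkMean S _ (isBdd_gradForm hL hL)).const_mul C) ?_
  filter_upwards [hev] with n hn
  have := hn.2 f hf i
  rw [← walkExp_eq, walkExp_sq hf, hf1, div_eq_inv_mul] at this
  simpa [walkAvg_apply] using this

theorem translateFun_mem {S : ι → G} (g : G) {f : G → ℝ} (hf : f ∈ harmonicSubmodule S) :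
    translateFun g f ∈ harmonicSubmodule S := by
  obtain ⟨hf, ⟨K, hK⟩, hf1⟩ := hf
  refine ⟨fun x => ?_, ⟨K, fun x i => ?_⟩, by simp [translateFun]⟩
  · have h0 : (Fintype.card ι : ℝ) ≠ 0 := by exact_mod_cast Fintype.card_ne_zero
    have h := hf (g⁻¹ * x)
    rw [inv_mul_eq_iff_eq_mul₀ h0] at h
    simp only [translateFun, LinearMap.coe_mk, AddHom.coe_mk, ← mul_assoc, Finset.sum_sub_distrib,
      h, Finset.sum_const, Finset.card_univ, nsmul_eq_mul]
    field_simp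
  · simpa [translateFun, mul_assoc] using hK (g⁻¹ * x) i

/-- The action by translations on the space of Lipschitz harmonic functions. -/
noncomputable def harmonicRep (S : ι → G) : G →* Module.End ℝ (harmonicSubmodule S) where
  toFun g := (translateFun g).restrict fun _ hf => translateFun_mem g hf
  map_one' := by
    ext f x
    have : f.1 1 = 0 := f.2.2.2
    simp [LinearMap.restrict_apply, translateFun, this]
  map_mul' g h := by
    ext f x
    simp [LinearMap.restrict_apply, translateFun, mul_assoc]

theorem harmonicRep_apply (S : ι → G) (g : G) (f : harmonicSubmodule S) (x : G) :
    (harmonicRep S g f).1 x = f.1 (g⁻¹ * x) - f.1 g⁻¹ := rfl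

theorem exists_finiteIndex_harmonicRep_commute [Group.FG G] {D : ℕ} (hG : PolyGrowth D G)
    {S : ι → G} (hgen : Subgroup.closure (Set.range S) = ⊤) :
    ∃ H : Subgroup G, H.FiniteIndex ∧ ∀ g ∈ H, ∀ h ∈ H,
      harmonicRep S g * harmonicRep S h = harmonicRep S h * harmonicRep S g := by
  obtain ⟨C, hC0, U, hU, hC⟩ := exists_ultrafilter_sq_le hG S
  have hbd : ∀ f f' : harmonicSubmodule S, IsBdd (gradForm S f.1 f'.1) := fun f f' =>
    isBdd_gradForm f.2.2.1 f'.2.2.1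
  have hinv : ∀ g (f f' : harmonicSubmodule S), walkMean S U
      (gradForm S (translateFun g f.1) (translateFun g f'.1)) =
        walkMean S U (gradForm S f.1 f'.1) := fun g f f' => by
    rw [gradForm_translateFun]
    exact walkMean_comp_mul_left S U hG hgen hU (hbd f f') _
  have hsq : ∀ (f : harmonicSubmodule S) x i, (f.1 (x * S i) - f.1 x) ^ 2 ≤
      C * walkMean S U (gradForm S f.1 f.1) := by
    intro f x i
    have h := hC _ (translateFun_mem x⁻¹ f.2) i
    rw [hinv] at h
    simpa [translateFun] using h
  have hnn : ∀ f : harmonicSubmodule S, 0 ≤ walkMean S U (gradForm S f.1 f.1) := fun f => by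
    rw [← walkMean_const S U hU 0]
    exact walkMean_mono S U ⟨0, by simp⟩ (hbd f f) (gradForm_self_nonneg S _)
  let c : InnerProductSpace.Core ℝ (harmonicSubmodule S) :=
    { inner := fun f f' => walkMean S U (gradForm S f.1 f'.1)
      conj_inner_symm := fun f f' => by
        change walkMean S U (gradForm S f'.1 f.1) = walkMean S U (gradForm S f.1 f'.1)
        rw [gradForm_comm]
      re_inner_nonneg := hnn
      add_left := fun f f' f'' => by
        change walkMean S U (gradForm S (f.1 + f'.1) f''.1) = _
        rw [gradForm_add_left, walkMean_add S U (hbd _ _) (hbd _ _)]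
      smul_left := fun f f' r => by
        change walkMean S U (gradForm S (r • f.1) f'.1) = _
        rw [gradForm_smul_left, walkMean_smul S U (hbd _ _)]
        rfl
      definite := fun f hf => by
        change walkMean S U (gradForm S f.1 f.1) = 0 at hf
        have h1 : ∀ x i, f.1 (x * S i) = f.1 x := by
          intro x i
          have := hsq f x i
          rw [hf, mul_zero] at this
          have h2 := pow_eq_zero_iff (two_ne_zero) |>.1 (le_antisymm this (sq_nonneg _))
          linarith
        ext x
        have hb : IsBdd f.1 := by
          have hall : ∀ x, f.1 x = f.1 1 := by
            intro x
            have hx : x ∈ Subgroup.closure (Set.range S) := hgen ▸ Subgroup.mem_top x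
            suffices h : ∀ y, f.1 (y * x) = f.1 y by simpa using h 1
            induction hx using Subgroup.closure_induction with
            | mem s hs =>
              obtain ⟨i, rfl⟩ := hs
              exact fun y => h1 y i
            | one => simp
            | mul a b _ _ ha hb => intro y; rw [← mul_assoc, hb, ha]
            | inv a _ ha => intro y; rw [← ha (y * a⁻¹), inv_mul_cancel_right]
          exact ⟨|f.1 1|, fun x => by rw [hall x]⟩
        obtain ⟨M, hM⟩ := hb
        rw [f.2.1.eq_of_bounded hG hgen hM x, f.2.2.2]
        rfl }
  have hinner : ∀ f f', c.inner f f' = walkMean S U (gradForm S f.1 f'.1) := fun _ _ => rfl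
  refine exists_finiteIndex_commute_of_isometric hG c ⌊C⌋₊ ?_ (harmonicRep S) fun g f => ?_
  · intro n v hv
    refine Nat.le_floor ?_
    have hpt : ∀ x i, ∑ j, (((v j).1 (x * S i) - (v j).1 x) * ((v j).1 (x * S i) - (v j).1 x)) ≤
        C := by
      intro x i
      set a : Fin n → ℝ := fun j => (v j).1 (x * S i) - (v j).1 x with ha
      have h1 : c.inner (∑ j, a j • v j) (∑ j, a j • v j) = ∑ j, a j * a j := by
        let : NormedAddCommGroup (harmonicSubmodule S) := c.toNormedAddCommGroup
        let : InnerProductSpace ℝ (harmonicSubmodule S) := InnerProductSpace.ofCore c.toCore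
        have ho : Orthonormal ℝ v := orthonormal_iff_ite.2 hv
        have := ho.inner_sum a a Finset.univ
        simpa using this
      have h2 := hsq (∑ j, a j • v j) x i
      rw [← hinner, h1] at h2
      have e : ∀ y, (∑ j, a j • v j : harmonicSubmodule S).1 y = ∑ j, a j * (v j).1 y := by
        intro y
        simp [Finset.sum_apply]
      rw [e, e, ← Finset.sum_sub_distrib] at h2
      simp only [← mul_sub] at h2
      change (∑ j, a j * a j) ^ 2 ≤ _ at h2
      change ∑ j, a j * a j ≤ C
      by_contra! hlt
      nlinarith
    have h1 : (n : ℝ) = walkMean S U (∑ j, gradForm S (v j).1 (v j).1) := by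
      rw [walkMean_sum S U _ fun j => hbd _ _]
      simp only [← hinner, hv]
      simp
    rw [h1, ← walkMean_const S U hU C]
    refine walkMean_mono S U (isBdd_sum _ fun j => hbd _ _) ⟨|C|, fun _ => le_rfl⟩ fun x => ?_
    have h0 : (0 : ℝ) < Fintype.card ι := by exact_mod_cast Fintype.card_pos
    rw [Finset.sum_apply]
    simp only [gradForm]
    rw [← Finset.mul_sum, Finset.sum_comm, inv_mul_le_iff₀ h0]
    refine (Finset.sum_le_sum fun i _ => hpt x i).trans_eq ?_
    simp
  · rw [hinner, hinner]
    exact hinv g f f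

end HarmonicSpace

open DirectSum in
theorem exists_hom_int_of_not_finiteIndex {K : Type*} [Group K] [Group.FG K] (N : Subgroup K)
    (hN : commutator K ≤ N) (hinf : ¬ N.FiniteIndex) :
    ∃ (φ : K →* Multiplicative ℤ) (t : K), φ t = Multiplicative.ofAdd 1 := by
  have hfg : Group.FG (Abelianization K) := Group.fg_of_surjective (f := Abelianization.of)
    (QuotientGroup.mk'_surjective _)
  have hfg' : AddGroup.FG (Additive (Abelianization K)) := inferInstance
  obtain ⟨n, ι, _, p, hp, e, ⟨E⟩⟩ :=
    AddCommGroup.equiv_free_prod_directSum_zmod (Additive (Abelianization K))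
  rcases Nat.eq_zero_or_pos n with rfl | hn
  · have h1 : ∀ i, NeZero (p i ^ e i) := fun i => ⟨pow_ne_zero _ (hp i).ne_zero⟩
    have h2 : Finite (⨁ i : ι, ZMod (p i ^ e i)) :=
      Finite.of_equiv _ (DirectSum.addEquivProd fun i => ZMod (p i ^ e i)).toEquiv.symm
    have h3 : Finite (Abelianization K) := Finite.of_equiv _ (E.toEquiv.trans (Equiv.refl _)).symm
    have h4 : (commutator K).FiniteIndex := Subgroup.finiteIndex_iff_finite_quotient.2 h3
    exact absurd (Subgroup.finiteIndex_of_le hN) hinf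
  · let i : Fin n := ⟨0, hn⟩
    let ψ : Additive (Abelianization K) →+ ℤ :=
      (Finsupp.applyAddHom i).comp ((AddMonoidHom.fst _ _).comp E.toAddMonoidHom)
    have hsurj : Function.Surjective (Abelianization.of (G := K)) :=
      QuotientGroup.mk'_surjective _
    obtain ⟨t, ht⟩ := hsurj (E.symm (Finsupp.single i 1, 0)).toMul
    refine ⟨(AddMonoidHom.toMultiplicativeRight ψ).comp Abelianization.of, t, ?_⟩
    rw [MonoidHom.comp_apply, ht]
    change Multiplicative.ofAdd (ψ (E.symm (Finsupp.single i 1, 0))) = _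
    simp [ψ]

theorem exists_finiteIndex_hom_int {D : ℕ} {G : Type*} [Group G] [hfg : Group.FG G] [Infinite G]
    (hG : PolyGrowth D G) :
    ∃ H : Subgroup G, H.FiniteIndex ∧ ∃ (φ : H →* Multiplicative ℤ) (t : H),
      φ t = Multiplicative.ofAdd 1 := by
  classical
  obtain ⟨S₀, hS₀⟩ := Group.fg_def.1 hfg
  let S : Finset G := insert 1 (S₀ ∪ S₀⁻¹)
  have h1 : 1 ∈ S := Finset.mem_insert_self _ _
  have hsymm : ∀ s ∈ S, s⁻¹ ∈ S := by
    intro s hs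
    simp only [S, Finset.mem_insert, Finset.mem_union, Finset.mem_inv'] at hs ⊢
    rcases hs with rfl | h | h
    · simp
    · right; right; simpa using h
    · right; left; exact h
  have hgen : Subgroup.closure (S : Set G) = ⊤ := by
    rw [eq_top_iff, ← hS₀]
    exact Subgroup.closure_mono fun s hs => by
      simp only [S, Finset.coe_insert, Finset.coe_union]
      exact Or.inr (Or.inl hs)
  have hne : Nonempty S := ⟨⟨1, h1⟩⟩
  have hgen' : Subgroup.closure (Set.range (twoSteps S)) = ⊤ := by
    rw [eq_top_iff, ← hgen]
    exact Subgroup.closure_mono fun s hs => ⟨(⟨s, hs⟩, ⟨1, h1⟩), mul_one s⟩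
  obtain ⟨f, hf, hL, hf1, x₀, hx₀⟩ := exists_nonconstant_harmonic hG hsymm h1 hgen
  obtain ⟨H, hH, hcomm⟩ := exists_finiteIndex_harmonicRep_commute hG hgen'
  by_cases hker : (harmonicRep (twoSteps S)).ker.FiniteIndex
  · set K := (harmonicRep (twoSteps S)).ker with hKdef
    have hadd : ∀ k ∈ K, ∀ y, f (k * y) = f k + f y := by
      intro k hk y
      have hk' : harmonicRep (twoSteps S) k⁻¹ = 1 := K.inv_mem hk
      have := harmonicRep_apply (twoSteps S) k⁻¹ ⟨f, hf, hL, hf1⟩ y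
      rw [hk'] at this
      simp only [Module.End.one_apply, inv_inv] at this
      linarith
    let l : K →* Multiplicative ℝ :=
      { toFun := fun k => Multiplicative.ofAdd (f k.1)
        map_one' := by simp [hf1]
        map_mul' := fun a b => by
          rw [Subgroup.coe_mul, hadd a.1 a.2, ofAdd_add] }
    have hl : ∀ k ∈ l.ker, f k.1 = 0 := fun k hk => congrArg Multiplicative.toAdd hk
    refine ⟨K, hker, exists_hom_int_of_not_finiteIndex l.ker
      (Abelianization.commutator_subset_ker l) fun hfin => hx₀ ?_⟩
    have hM : (l.ker.map K.subtype).FiniteIndex := by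
      refine ⟨?_⟩
      rw [Subgroup.index_map_subtype]
      exact mul_ne_zero hfin.index_ne_zero hker.index_ne_zero
    have hfinq : Finite (G ⧸ l.ker.map K.subtype) := Subgroup.finiteIndex_iff_finite_quotient.1 hM
    let F : G ⧸ l.ker.map K.subtype → ℝ := Quotient.lift (fun x => f x⁻¹) (by
      intro a b hab
      rw [← Quotient.eq_iff_equiv] at hab
      obtain ⟨k, hk, hk'⟩ := QuotientGroup.eq.1 hab
      have hb : b⁻¹ = (k⁻¹ : K).1 * a⁻¹ := by
        have : k.1 = a⁻¹ * b := hk'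
        rw [Subgroup.coe_inv, this]; group
      change f a⁻¹ = f b⁻¹
      rw [hb, hadd _ (k⁻¹).2, hl _ (l.ker.inv_mem hk), zero_add])
    obtain ⟨M, hM⟩ := (Set.finite_range fun q => |F q|).bddAbove
    rw [hf.eq_of_bounded hG hgen' (M := M) fun x => ?_, hf1]
    have := hM ⟨QuotientGroup.mk x⁻¹, rfl⟩
    simpa [F, QuotientGroup.mk] using this
  · have hHfg : Group.FG H := Subgroup.fg_of_index_ne_zero H
    refine ⟨H, hH, exists_hom_int_of_not_finiteIndex
      ((harmonicRep (twoSteps S)).ker.subgroupOf H) ?_ fun hfin => hker ?_⟩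
    · rw [commutator_def, Subgroup.commutator_le]
      intro a _ b _
      rw [Subgroup.mem_subgroupOf, MonoidHom.mem_ker]
      have h : harmonicRep (twoSteps S) (a.1 * b.1) = harmonicRep (twoSteps S) (b.1 * a.1) := by
        rw [map_mul, map_mul, hcomm _ a.2 _ b.2]
      have e : ((⁅a, b⁆ : H) : G) = (a.1 * b.1) * (b.1 * a.1)⁻¹ := by
        simp [commutatorElement_def, mul_assoc]
      rw [e, map_mul, h, ← map_mul, mul_inv_cancel, map_one]
    · refine ⟨fun h0 => ?_⟩
      have h2 := Subgroup.relIndex_mul_index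
        (inf_le_right : (harmonicRep (twoSteps S)).ker ⊓ H ≤ H)
      have h3 : ((harmonicRep (twoSteps S)).ker ⊓ H).FiniteIndex := by
        refine ⟨?_⟩
        rw [← h2, Subgroup.inf_relIndex_right]
        exact mul_ne_zero hfin.index_ne_zero hH.index_ne_zero
      exact (Subgroup.finiteIndex_of_le
        (inf_le_left : (harmonicRep (twoSteps S)).ker ⊓ H ≤ _)).index_ne_zero h0

/-- **Gromov's theorem** on groups of polynomial growth. -/
theorem gromov_polynomial_growth (D : ℕ) : ∀ {G : Type*} [Group G] [Group.FG G],
    PolyGrowth D G → IsVirtuallyNilpotent G ∧ AllSubgroupsFG G := by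
  induction D with
  | zero =>
    intro G _ _ hG
    rcases finite_or_infinite G with hfin | hinf
    · exact ⟨⟨⊥, inferInstance, inferInstance⟩, fun H => (Group.fg_iff_subgroup_fg H).1 inferInstance⟩
    · obtain ⟨H, hH, φ, t, ht⟩ := exists_finiteIndex_hom_int hG
      exact absurd (hG.subgroup H) (not_polyGrowth_zero φ t ht)
  | succ D ih =>
    intro G _ _ hG
    rcases finite_or_infinite G with hfin | hinf
    · exact ⟨⟨⊥, inferInstance, inferInstance⟩, fun H => (Group.fg_iff_subgroup_fg H).1 inferInstance⟩
    · obtain ⟨H, hH, φ, t, ht⟩ := exists_finiteIndex_hom_int hG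
      have hHfg : Group.FG H := Subgroup.fg_of_index_ne_zero H
      have hGH := hG.subgroup H
      have hk : Group.FG φ.ker := (Group.fg_iff_subgroup_fg _).2 (ker_fg_of_polyGrowth hGH φ t ht)
      obtain ⟨h1, h2⟩ := ih (ker_polyGrowth hGH φ t ht)
      exact ⟨.of_finiteIndex H (isVirtuallyNilpotent_of_hom_int hGH φ t ht h1 h2),
        .of_finiteIndex H (.of_hom_int φ h2)⟩

theorem PolyGrowth.of_pow_ncard_le {D C : ℕ} {G : Type*} [Group G] {T : Set G} (hT : T.Finite)
    (h1 : 1 ∈ T) (hgen : ∀ g, ∃ k, g ∈ T ^ k) (hC : ∀ n, (T ^ n).ncard ≤ C * (n + 1) ^ D) :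
    PolyGrowth D G := by
  intro F hF
  choose k hk using hgen
  obtain ⟨K, hK⟩ := (hF.image k).bddAbove
  refine ⟨C * (K + 1) ^ D, fun n => ?_⟩
  have hsub : F ⊆ T ^ K := fun g hg =>
    Set.pow_subset_pow_right h1 (hK ⟨g, hg, rfl⟩) (hk g)
  calc (F ^ n).ncard ≤ (T ^ (K * n)).ncard := by
        refine Set.ncard_le_ncard ?_ (hT.pow_of_finite _)
        rw [pow_mul]
        exact Set.pow_subset_pow_left hsub
    _ ≤ C * (K * n + 1) ^ D := hC _
    _ ≤ C * ((K + 1) * (n + 1)) ^ D := by gcongr; nlinarith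
    _ = _ := by rw [mul_pow, mul_assoc]

theorem iterate_commutator_mem_lowerCentralSeries {G : Type*} [Group G] (u v : G) (n : ℕ) :
    (fun x => ⁅u, x⁆)^[n] v ∈ (⊤ : Subgroup G).lowerCentralSeries n := by
  induction n with
  | zero => simp
  | succ n ih =>
    rw [Function.iterate_succ_apply', Subgroup.lowerCentralSeries_succ, Subgroup.commutator_comm]
    exact Subgroup.commutator_mem_commutator (Subgroup.mem_top _) ih

theorem map_iterate_commutator {G H : Type*} [Group G] [Group H] (f : G →* H) (u v : G) (n : ℕ) :
    f ((fun x => ⁅u, x⁆)^[n] v) = (fun x => ⁅f u, x⁆)^[n] (f v) := by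
  induction n with
  | zero => rfl
  | succ n ih =>
    rw [Function.iterate_succ_apply', Function.iterate_succ_apply', map_commutatorElement, ih]

theorem IsVirtuallyNilpotent.exists_engel {G : Type*} [Group G] (h : IsVirtuallyNilpotent G)
    (u v : G) : ∃ m c : ℕ, 0 < m ∧ (fun x => ⁅u ^ m, x⁆)^[c] (v ^ m) = 1 := by
  obtain ⟨H, hH, hn⟩ := h
  have hm : H.normalCore.index ≠ 0 := Subgroup.FiniteIndex.index_ne_zero
  have hu := H.normalCore_le (Subgroup.pow_index_mem H.normalCore u)
  have hv := H.normalCore_le (Subgroup.pow_index_mem H.normalCore v)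
  obtain ⟨c, hc⟩ := Subgroup.nilpotent_iff_lowerCentralSeries.1 hn
  refine ⟨_, c, Nat.pos_of_ne_zero hm, ?_⟩
  have := iterate_commutator_mem_lowerCentralSeries (⟨_, hu⟩ : H) ⟨_, hv⟩ c
  rw [hc, Subgroup.mem_bot] at this
  have h2 := congrArg H.subtype this
  rwa [map_iterate_commutator, map_one] at h2

theorem exists_mem_pow_of_closure {G : Type*} [Group G] {T : Set G}
    (hinv : ∀ t ∈ T, t⁻¹ ∈ T) {g : G} (hg : g ∈ Subgroup.closure T) : ∃ k, g ∈ T ^ k := by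
  have hinv' : T⁻¹ = T := by
    ext t
    exact ⟨fun h => by simpa using hinv _ h, fun h => hinv _ h⟩
  induction hg using Subgroup.closure_induction with
  | mem x hx => exact ⟨1, by simpa using hx⟩
  | one => exact ⟨0, by simp⟩
  | mul x y _ _ hx hy =>
    obtain ⟨k, hk⟩ := hx
    obtain ⟨l, hl⟩ := hy
    exact ⟨k + l, by rw [pow_add]; exact Set.mul_mem_mul hk hl⟩
  | inv x _ hx =>
    obtain ⟨k, hk⟩ := hx
    refine ⟨k, ?_⟩
    rw [← hinv', inv_pow, Set.mem_inv, inv_inv]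
    exact hk

/-- A finitary consequence of Gromov's theorem for two-generated groups. -/
theorem exists_engel_of_growth (C D : ℕ) : ∃ n₀ : ℕ, ∀ (G : Type*) [Group G] (u v : G),
    (∀ n ≤ n₀, (({1, u, u⁻¹, v, v⁻¹} : Set G) ^ n).ncard ≤ C * (n + 1) ^ D) →
    ∃ m c : ℕ, 0 < m ∧ (fun x => ⁅u ^ m, x⁆)^[c] (v ^ m) = 1 := by
  by_contra! hcon
  choose G hG u v hgrowth hne using hcon
  let a : FreeGroup (Fin 2) := FreeGroup.of 0
  let b : FreeGroup (Fin 2) := FreeGroup.of 1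
  let φ : ∀ i, FreeGroup (Fin 2) →* G i := fun i => FreeGroup.lift ![u i, v i]
  have hφa : ∀ i, φ i a = u i := fun i => by simp [φ, a]
  have hφb : ∀ i, φ i b = v i := fun i => by simp [φ, b]
  let U : Filter ℕ := hyperfilter ℕ
  let N : Subgroup (FreeGroup (Fin 2)) :=
    { carrier := {w | ∀ᶠ i in U, φ i w = 1}
      one_mem' := Eventually.of_forall fun i => map_one _
      mul_mem' := fun {x y} hx hy => by
        filter_upwards [hx, hy] with i h1 h2
        rw [map_mul, h1, h2, one_mul]
      inv_mem' := fun {x} hx => by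
        filter_upwards [hx] with i h1
        rw [map_inv, h1, inv_one] }
  have hNmem : ∀ w, w ∈ N ↔ ∀ᶠ i in U, φ i w = 1 := fun w => Iff.rfl
  have hNn : N.Normal := ⟨fun w hw g => by
    filter_upwards [hw] with i h
    rw [map_mul, map_mul, h, mul_one, map_inv, mul_inv_cancel]⟩
  let Q := FreeGroup (Fin 2) ⧸ N
  let π : FreeGroup (Fin 2) →* Q := QuotientGroup.mk' N
  have hπ : Function.Surjective π := QuotientGroup.mk'_surjective N
  have hQfg : Group.FG Q := Group.fg_of_surjective hπ
  let T : Set (FreeGroup (Fin 2)) := {1, a, a⁻¹, b, b⁻¹}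
  have hT : T.Finite := Set.toFinite _
  have h1T : (1 : FreeGroup (Fin 2)) ∈ T := Or.inl rfl
  have hTgen : ∀ w, ∃ k, w ∈ T ^ k := by
    intro w
    refine exists_mem_pow_of_closure ?_ ?_
    · rintro t (rfl | rfl | rfl | rfl | rfl) <;> simp [T]
    · have : w ∈ Subgroup.closure (Set.range (FreeGroup.of : Fin 2 → _)) := by
        rw [FreeGroup.closure_range_of]; trivial
      refine Subgroup.closure_mono ?_ this
      rintro _ ⟨i, rfl⟩
      fin_cases i
      · exact Or.inr (Or.inl rfl)
      · exact Or.inr (Or.inr (Or.inr (Or.inl rfl)))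
  have hpoly : PolyGrowth D Q := by
    refine PolyGrowth.of_pow_ncard_le (C := C) (T := π '' T) (hT.image _) ⟨1, h1T, map_one _⟩
      (fun g => ?_) fun n => ?_
    · obtain ⟨w, rfl⟩ := hπ g
      obtain ⟨k, hk⟩ := hTgen w
      exact ⟨k, by rw [← Set.image_pow]; exact ⟨w, hk, rfl⟩⟩
    · rw [← Set.image_pow]
      have hTn : (T ^ n).Finite := hT.pow_of_finite n
      obtain ⟨A, hAT, hA⟩ := Set.SurjOn.exists_bijOn_subset (Set.surjOn_image π (T ^ n))
      have hAfin : A.Finite := hTn.subset hAT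
      have hev : ∀ᶠ i in U, Set.InjOn (φ i) A := by
        have : ∀ᶠ i in U, ∀ x ∈ A, ∀ y ∈ A, x ≠ y → φ i x ≠ φ i y := by
          rw [hAfin.eventually_all]
          intro x hx
          rw [hAfin.eventually_all]
          intro y hy
          by_cases hxy : x = y
          · exact Eventually.of_forall fun i h => absurd hxy h
          · have hn : x⁻¹ * y ∉ N := fun hmem =>
              hxy (hA.injOn hx hy (QuotientGroup.eq.2 hmem))
            rw [hNmem] at hn
            filter_upwards [Ultrafilter.eventually_not.2 hn] with i hi _ heq
            exact hi (by rw [map_mul, map_inv, heq, inv_mul_cancel])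
        filter_upwards [this] with i hi x hx y hy hxy
        by_contra hne
        exact hi x hx y hy hne hxy
      have hge : ∀ᶠ i in U, n ≤ i := Nat.hyperfilter_le_atTop (eventually_ge_atTop n)
      obtain ⟨i, hinj, hni⟩ := (hev.and hge).exists
      refine le_trans ?_ (hgrowth i n hni)
      rw [← hA.image_eq, hA.injOn.ncard_image, ← hinj.ncard_image]
      refine Set.ncard_le_ncard ?_ ((Set.toFinite _).pow_of_finite n)
      refine (Set.image_mono hAT).trans ?_
      rw [Set.image_pow]
      refine Set.pow_subset_pow_left ?_
      rintro _ ⟨t, ht, rfl⟩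
      rcases ht with rfl | rfl | rfl | rfl | rfl <;> simp [hφa, hφb]
  obtain ⟨m, c, hm, hmc⟩ := (gromov_polynomial_growth D hpoly).1.exists_engel (π a) (π b)
  rw [← map_pow, ← map_pow, ← map_iterate_commutator] at hmc
  have hmem : (fun x => ⁅a ^ m, x⁆)^[c] (b ^ m) ∈ N := (QuotientGroup.eq_one_iff _).1 hmc
  obtain ⟨i, hi⟩ := ((hNmem _).1 hmem).exists
  rw [map_iterate_commutator, map_pow, map_pow, hφa, hφb] at hi
  exact hne i m c hm hi

/-- A proper length function on a group, such that the induced left-invariant pseudometric is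
`δ`-hyperbolic. -/
structure IsHypLength {G : Type*} [Group G] (ℓ : G → ℝ) (δ : ℝ) : Prop where
  map_one : ℓ 1 = 0
  map_inv : ∀ a, ℓ a⁻¹ = ℓ a
  map_mul_le : ∀ a b, ℓ (a * b) ≤ ℓ a + ℓ b
  four_point : ∀ a b c d, ℓ (a⁻¹ * b) + ℓ (c⁻¹ * d) ≤
    max (ℓ (a⁻¹ * c) + ℓ (b⁻¹ * d)) (ℓ (a⁻¹ * d) + ℓ (b⁻¹ * c)) + 2 * δ
  finite : ∀ R, {a | ℓ a ≤ R}.Finite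

/-- The Gromov product with respect to a length function. -/
noncomputable def gromovProd {G : Type*} [Group G] (ℓ : G → ℝ) (a b : G) : ℝ :=
  (ℓ a + ℓ b - ℓ (a⁻¹ * b)) / 2

/-- The stable length of a group element. -/
noncomputable def stableLength {G : Type*} [Group G] (ℓ : G → ℝ) (a : G) : ℝ :=
  sInf ((fun n : ℕ => ℓ (a ^ n) / n) '' Set.Ici 1)

namespace IsHypLength

variable {G : Type*} [Group G] {ℓ : G → ℝ} {δ : ℝ}

theorem delta_nonneg (h : IsHypLength ℓ δ) : 0 ≤ δ := by
  have := h.four_point 1 1 1 1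
  simp only [inv_one, mul_one, h.map_one, add_zero, max_self] at this
  linarith

theorem nonneg (h : IsHypLength ℓ δ) (a : G) : 0 ≤ ℓ a := by
  have := h.map_mul_le a a⁻¹
  rw [mul_inv_cancel, h.map_one, h.map_inv] at this
  linarith

theorem dist_comm (h : IsHypLength ℓ δ) (a b : G) : ℓ (a⁻¹ * b) = ℓ (b⁻¹ * a) := by
  rw [← h.map_inv, mul_inv_rev, inv_inv]

theorem le_mul_add (h : IsHypLength ℓ δ) (a b : G) : ℓ b ≤ ℓ (a * b) + ℓ a := by
  have := h.map_mul_le a⁻¹ (a * b)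
  rw [inv_mul_cancel_left, h.map_inv] at this
  linarith

theorem le_mul_add' (h : IsHypLength ℓ δ) (a b : G) : ℓ a ≤ ℓ (a * b) + ℓ b := by
  have := h.map_mul_le (a * b) b⁻¹
  rwa [mul_inv_cancel_right, h.map_inv] at this

theorem comp_injective (h : IsHypLength ℓ δ) {H : Type*} [Group H] (f : H →* G)
    (hf : Function.Injective f) : IsHypLength (fun a => ℓ (f a)) δ where
  map_one := by rw [_root_.map_one, h.map_one]
  map_inv a := by rw [_root_.map_inv, h.map_inv]
  map_mul_le a b := by rw [map_mul]; exact h.map_mul_le _ _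
  four_point a b c d := by
    simp only [map_mul, _root_.map_inv]
    exact h.four_point _ _ _ _
  finite R := (h.finite R).preimage hf.injOn

theorem gromovProd_comm (h : IsHypLength ℓ δ) (a b : G) : gromovProd ℓ a b = gromovProd ℓ b a := by
  rw [gromovProd, gromovProd, h.dist_comm, add_comm (ℓ a)]

theorem min_gromovProd_le (h : IsHypLength ℓ δ) (a b c : G) :
    min (gromovProd ℓ a b) (gromovProd ℓ b c) - δ ≤ gromovProd ℓ a c := by
  have h4 := h.four_point a c b 1
  have e : ∀ a : G, ℓ (a⁻¹ * 1) = ℓ a := fun a => by rw [mul_one, h.map_inv]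
  rw [e, e, e, h.dist_comm c b] at h4
  simp only [gromovProd]
  rcases le_total (ℓ (a⁻¹ * b) + ℓ c) (ℓ a + ℓ (b⁻¹ * c)) with h1 | h1
  · rw [max_eq_right h1] at h4
    have := min_le_right ((ℓ a + ℓ b - ℓ (a⁻¹ * b)) / 2) ((ℓ b + ℓ c - ℓ (b⁻¹ * c)) / 2)
    linarith
  · rw [max_eq_left h1] at h4
    have := min_le_left ((ℓ a + ℓ b - ℓ (a⁻¹ * b)) / 2) ((ℓ b + ℓ c - ℓ (b⁻¹ * c)) / 2)
    linarith

theorem le_gromovProd (h : IsHypLength ℓ δ) {r : ℝ} {a b c : G} (hab : r ≤ gromovProd ℓ a b)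
    (hbc : r ≤ gromovProd ℓ b c) : r - δ ≤ gromovProd ℓ a c :=
  (sub_le_sub_right (le_min hab hbc) δ).trans (h.min_gromovProd_le a b c)

theorem gromovProd_mul_left (h : IsHypLength ℓ δ) (a b c : G) :
    gromovProd ℓ b c - ℓ a ≤ gromovProd ℓ (a * b) (a * c) := by
  have h1 := h.le_mul_add a b
  have h2 := h.le_mul_add a c
  have e : (a * b)⁻¹ * (a * c) = b⁻¹ * c := by group
  rw [gromovProd, gromovProd, e]
  linarith

theorem gromovProd_self_mul (h : IsHypLength ℓ δ) (a b : G) :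
    ℓ a - ℓ b ≤ gromovProd ℓ a (a * b) := by
  have h1 := h.le_mul_add' a b
  rw [gromovProd, inv_mul_cancel_left]
  linarith

theorem subadditive (h : IsHypLength ℓ δ) (a : G) : Subadditive fun n => ℓ (a ^ n) := fun m n => by
  simp only [pow_add]
  exact h.map_mul_le _ _

theorem subadditive_lim (h : IsHypLength ℓ δ) (a : G) :
    (h.subadditive a).lim = stableLength ℓ a := by
  rw [Subadditive.lim, stableLength]

theorem bddBelow_div (h : IsHypLength ℓ δ) (a : G) :
    BddBelow (Set.range fun n : ℕ => ℓ (a ^ n) / n) :=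
  ⟨0, by
    rintro _ ⟨n, rfl⟩
    exact div_nonneg (h.nonneg _) (Nat.cast_nonneg _)⟩

theorem tendsto_stableLength (h : IsHypLength ℓ δ) (a : G) :
    Tendsto (fun n : ℕ => ℓ (a ^ n) / n) atTop (𝓝 (stableLength ℓ a)) := by
  rw [← h.subadditive_lim]
  exact (h.subadditive a).tendsto_lim (h.bddBelow_div a)

theorem stableLength_nonneg (h : IsHypLength ℓ δ) (a : G) : 0 ≤ stableLength ℓ a :=
  ge_of_tendsto' (h.tendsto_stableLength a) fun _ => div_nonneg (h.nonneg _) (Nat.cast_nonneg _)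

theorem mul_stableLength_le (h : IsHypLength ℓ δ) (a : G) (n : ℕ) :
    n * stableLength ℓ a ≤ ℓ (a ^ n) := by
  rcases Nat.eq_zero_or_pos n with rfl | hn
  · simp [h.map_one]
  · have : stableLength ℓ a ≤ ℓ (a ^ n) / n := by
      rw [← h.subadditive_lim]
      exact (h.subadditive a).lim_le_div (h.bddBelow_div a) hn.ne'
    rwa [le_div_iff₀ (by exact_mod_cast hn), mul_comm] at this

theorem stableLength_pow (h : IsHypLength ℓ δ) (a : G) (k : ℕ) :
    stableLength ℓ (a ^ k) = k * stableLength ℓ a := by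
  rcases Nat.eq_zero_or_pos k with rfl | hk
  · refine tendsto_nhds_unique (h.tendsto_stableLength _) ?_
    simp [h.map_one]
  · refine tendsto_nhds_unique (h.tendsto_stableLength _) ?_
    have h1 := ((h.tendsto_stableLength a).comp
      (tendsto_id.const_mul_atTop' hk : Tendsto (fun n : ℕ => k * n) atTop atTop)).const_mul (k : ℝ)
    refine h1.congr fun n => ?_
    have hk' : (k : ℝ) ≠ 0 := by exact_mod_cast hk.ne'
    simp only [Function.comp, pow_mul, Nat.cast_mul]
    rw [mul_div_assoc', mul_div_mul_left _ _ hk']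

theorem stableLength_inv (h : IsHypLength ℓ δ) (a : G) :
    stableLength ℓ a⁻¹ = stableLength ℓ a := by
  simp only [stableLength, inv_pow, h.map_inv]

theorem stableLength_zpow (h : IsHypLength ℓ δ) (a : G) (k : ℤ) :
    stableLength ℓ (a ^ k) = |(k : ℝ)| * stableLength ℓ a := by
  obtain ⟨n, rfl | rfl⟩ := k.eq_nat_or_neg
  · rw [zpow_natCast, h.stableLength_pow]
    simp
  · rw [zpow_neg, zpow_natCast, h.stableLength_inv, h.stableLength_pow]
    simp

theorem stableLength_conj (h : IsHypLength ℓ δ) (a b : G) :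
    stableLength ℓ (b * a * b⁻¹) = stableLength ℓ a := by
  have key : ∀ a b : G, stableLength ℓ (b * a * b⁻¹) ≤ stableLength ℓ a := by
    intro a b
    have h1 : Tendsto (fun n : ℕ => ℓ (a ^ n) / n + 2 * ℓ b / n) atTop
        (𝓝 (stableLength ℓ a + 0)) :=
      (h.tendsto_stableLength a).add (tendsto_const_div_atTop_nhds_zero_nat _)
    rw [add_zero] at h1
    refine le_of_tendsto_of_tendsto' (h.tendsto_stableLength _) h1 fun n => ?_
    rw [conj_pow, ← add_div]
    refine div_le_div_of_nonneg_right ?_ (Nat.cast_nonneg _)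
    have h2 := h.map_mul_le (b * a ^ n) b⁻¹
    have h3 := h.map_mul_le b (a ^ n)
    rw [h.map_inv] at h2
    linarith
  refine le_antisymm (key a b) ?_
  have := key (b * a * b⁻¹) b⁻¹
  rwa [inv_inv, show b⁻¹ * (b * a * b⁻¹) * b = a by group] at this

theorem pow_succ_ge (h : IsHypLength ℓ δ) {a : G} {t : ℝ} (ht : 0 < t)
    (ha : ℓ a + 2 * δ + t ≤ ℓ (a ^ 2)) (n : ℕ) : ℓ (a ^ n) + t ≤ ℓ (a ^ (n + 1)) := by
  have hδ := h.delta_nonneg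
  induction n with
  | zero =>
    have := h.map_mul_le a a
    rw [← sq] at this
    simp only [pow_zero, h.map_one, zero_add, pow_one]
    linarith
  | succ n ih =>
    have h4 := h.four_point 1 (a ^ 2) a (a ^ (n + 2))
    have e1 : (1 : G)⁻¹ * a ^ 2 = a ^ 2 := by group
    have e2 : a⁻¹ * a ^ (n + 2) = a ^ (n + 1) := by rw [pow_succ' a (n + 1), inv_mul_cancel_left]
    have e3 : (1 : G)⁻¹ * a = a := by group
    have e4 : (a ^ 2)⁻¹ * a ^ (n + 2) = a ^ n := by
      rw [add_comm n 2, pow_add, inv_mul_cancel_left]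
    have e5 : (1 : G)⁻¹ * a ^ (n + 2) = a ^ (n + 2) := by group
    have e6 : ℓ ((a ^ 2)⁻¹ * a) = ℓ a := by
      rw [h.dist_comm, sq, inv_mul_cancel_left]
    rw [e1, e2, e3, e4, e5, e6] at h4
    rcases le_total (ℓ a + ℓ (a ^ n)) (ℓ (a ^ (n + 2)) + ℓ a) with h1 | h1
    · rw [max_eq_right h1] at h4
      change _ ≤ ℓ (a ^ (n + 2))
      linarith
    · rw [max_eq_left h1] at h4
      linarith

theorem sq_le_of_stableLength_eq_zero (h : IsHypLength ℓ δ) {a : G} (ha : stableLength ℓ a = 0) :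
    ℓ (a ^ 2) ≤ ℓ a + 2 * δ := by
  by_contra! hlt
  set t := ℓ (a ^ 2) - ℓ a - 2 * δ with ht
  have ht0 : 0 < t := by rw [ht]; linarith
  have h1 : ∀ n : ℕ, n * t ≤ ℓ (a ^ n) := by
    intro n
    induction n with
    | zero => simp [h.map_one]
    | succ n ih =>
      have := h.pow_succ_ge (a := a) ht0 (by rw [ht]; linarith) n
      push_cast
      linarith
  have h2 : t ≤ stableLength ℓ a := by
    refine ge_of_tendsto (h.tendsto_stableLength a) ?_
    filter_upwards [eventually_gt_atTop 0] with n hn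
    rw [le_div_iff₀ (by exact_mod_cast hn), mul_comm]
    exact h1 n
  linarith

theorem mul_le_max_add (h : IsHypLength ℓ δ) {a b : G} (ha : ℓ (a ^ 2) ≤ ℓ a + 2 * δ)
    (hb : ℓ (b ^ 2) ≤ ℓ b + 2 * δ) (hab : ℓ ((a * b) ^ 2) ≤ ℓ (a * b) + 2 * δ) :
    ℓ (a * b) ≤ max (ℓ a) (ℓ b) + 6 * δ := by
  by_contra! hlt
  have hδ := h.delta_nonneg
  have hA : ℓ a + 6 * δ < ℓ (a * b) := lt_of_le_of_lt (by gcongr; exact le_max_left _ _) hlt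
  have hB : ℓ b + 6 * δ < ℓ (a * b) := lt_of_le_of_lt (by gcongr; exact le_max_right _ _) hlt
  have h1 : ℓ (a * b) - 2 * δ ≤ ℓ (b⁻¹ * a) := by
    have h4 := h.four_point a⁻¹ b 1 a
    simp only [inv_inv, inv_one, one_mul, mul_one, h.map_inv] at h4
    rw [← sq] at h4
    rcases le_max_iff.1 (sub_le_iff_le_add.2 h4) with h5 | h5 <;> linarith
  have h2 : ℓ (a * b) - 4 * δ ≤ ℓ (b * a) := by
    have h4 := h.four_point b a 1 b⁻¹
    have e1 : ℓ (b⁻¹ * b⁻¹) = ℓ (b ^ 2) := by rw [← mul_inv_rev, h.map_inv, sq]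
    have e2 : ℓ (a⁻¹ * b⁻¹) = ℓ (b * a) := by rw [← mul_inv_rev, h.map_inv]
    simp only [inv_one, one_mul, mul_one, h.map_inv, e1, e2] at h4
    rcases le_max_iff.1 (sub_le_iff_le_add.2 h4) with h5 | h5 <;> linarith
  have h3 : 2 * ℓ (a * b) - ℓ b - 6 * δ ≤ ℓ (a * b * a) := by
    have h4 := h.four_point 1 (a * b) a (a * b * a)
    have e1 : a⁻¹ * (a * b * a) = b * a := by group
    have e2 : (a * b)⁻¹ * (a * b * a) = a := by group
    have e3 : (a * b)⁻¹ * a = b⁻¹ := by group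
    simp only [inv_one, one_mul, e1, e2, e3, h.map_inv] at h4
    rcases le_max_iff.1 (sub_le_iff_le_add.2 h4) with h5 | h5 <;> linarith
  have h5 : 3 * ℓ (a * b) - ℓ a - ℓ b - 8 * δ ≤ ℓ ((a * b) ^ 2) := by
    have h4 := h.four_point 1 (a * b * a) (a * b) ((a * b) ^ 2)
    have e1 : (a * b)⁻¹ * (a * b) ^ 2 = a * b := by rw [sq, inv_mul_cancel_left]
    have e2 : (a * b * a)⁻¹ * (a * b) ^ 2 = b := by rw [sq]; group
    have e3 : (a * b * a)⁻¹ * (a * b) = a⁻¹ := by group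
    simp only [inv_one, one_mul, e1, e2, e3, h.map_inv] at h4
    rcases le_max_iff.1 (sub_le_iff_le_add.2 h4) with h5 | h5 <;> linarith
  linarith

end IsHypLength

namespace IsHypLength

variable {G : Type*} [Group G] {ℓ : G → ℝ} {δ : ℝ}

theorem polyGrowth_of_stableLength_eq_zero (h : IsHypLength ℓ δ) {A b : ℕ}
    (hA : ∀ R : ℕ, {a | ℓ a ≤ R}.ncard ≤ A * 2 ^ (b * R)) (h0 : ∀ a, stableLength ℓ a = 0) :
    ∃ D, PolyGrowth D G := by
  have hδ := h.delta_nonneg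
  set q := ⌈6 * δ⌉₊ with hq
  have hqδ : 6 * δ ≤ q := Nat.le_ceil _
  refine ⟨b * q, fun F hF => ?_⟩
  obtain ⟨R₁, hR₁⟩ := ((hF.insert 1).image ℓ).bddAbove
  set R := ⌈R₁⌉₊ with hR
  have hR₁' : ∀ a ∈ insert 1 F, ℓ a ≤ R := fun a ha =>
    (hR₁ ⟨a, ha, rfl⟩).trans (Nat.le_ceil _)
  have hpow : ∀ k : ℕ, ∀ a ∈ (insert 1 F) ^ 2 ^ k, ℓ a ≤ (R + q * k : ℕ) := by
    intro k
    induction k with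
    | zero => intro a ha; simpa using hR₁' a (by simpa using ha)
    | succ k ih =>
      intro a ha
      rw [pow_succ, mul_two, pow_add] at ha
      obtain ⟨x, hx, y, hy, rfl⟩ := ha
      have h1 := ih x hx
      have h2 := ih y hy
      have h3 := h.mul_le_max_add (h.sq_le_of_stableLength_eq_zero (h0 x))
        (h.sq_le_of_stableLength_eq_zero (h0 y)) (h.sq_le_of_stableLength_eq_zero (h0 (x * y)))
      have h4 := max_le h1 h2
      push_cast at h4 ⊢
      change ℓ (x * y) ≤ _
      linarith
  refine ⟨A * 2 ^ (b * R) * 2 ^ (b * q), fun n => ?_⟩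
  set k := Nat.clog 2 (n + 1) with hk
  have hk1 : n + 1 ≤ 2 ^ k := Nat.le_pow_clog one_lt_two _
  have hk2 : 2 ^ k ≤ 2 * (n + 1) := by
    rcases Nat.eq_zero_or_pos n with rfl | hn
    · simp [hk]
    · have := Nat.pow_pred_clog_lt_self one_lt_two (show 1 < n + 1 by omega)
      have hk0 : 0 < k := Nat.clog_pos one_lt_two (by omega)
      rw [← hk] at this
      obtain ⟨j, hj⟩ : ∃ j, k = j + 1 := ⟨k - 1, by omega⟩
      rw [hj, Nat.pred_succ] at this
      rw [hj, pow_succ]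
      omega
  calc (F ^ n).ncard ≤ {a | ℓ a ≤ (R + q * k : ℕ)}.ncard := by
        refine Set.ncard_le_ncard (fun a ha => hpow k a ?_) (h.finite _)
        exact Set.pow_subset_pow_right (Set.mem_insert _ _) (by omega)
          (Set.pow_subset_pow_left (Set.subset_insert _ _) ha)
    _ ≤ A * 2 ^ (b * (R + q * k)) := hA _
    _ = A * 2 ^ (b * R) * (2 ^ k) ^ (b * q) := by
        rw [mul_add, pow_add, ← pow_mul, mul_assoc, show b * (q * k) = k * (b * q) by ring]
    _ ≤ A * 2 ^ (b * R) * (2 * (n + 1)) ^ (b * q) := by gcongr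
    _ = _ := by rw [mul_pow, mul_assoc (A * _)]

theorem exists_pow_sq_gt (h : IsHypLength ℓ δ) {a : G} (ha : stableLength ℓ a ≠ 0) :
    ∃ n : ℕ, 0 < n ∧ ℓ (a ^ n) + 8 * δ < ℓ ((a ^ n) ^ 2) := by
  by_contra! hcon
  have hpos : 0 < stableLength ℓ a := lt_of_le_of_ne (h.stableLength_nonneg a) ha.symm
  have hk : ∀ k : ℕ, ℓ (a ^ 2 ^ k) ≤ ℓ a + 8 * δ * k := by
    intro k
    induction k with
    | zero => simp
    | succ k ih =>
      have := hcon (2 ^ k) (by positivity)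
      rw [← pow_mul, ← pow_succ] at this
      push_cast
      linarith
  have h1 : Tendsto (fun k : ℕ => ℓ a * ((1 : ℝ) / 2 ^ k) + 8 * δ * ((k : ℝ) ^ 1 / 2 ^ k)) atTop
      (𝓝 (ℓ a * 0 + 8 * δ * 0)) := by
    refine Tendsto.add (Tendsto.const_mul _ ?_) (Tendsto.const_mul _ ?_)
    · simpa using tendsto_pow_const_div_const_pow_of_one_lt 0 (one_lt_two (α := ℝ))
    · exact tendsto_pow_const_div_const_pow_of_one_lt 1 one_lt_two
  rw [mul_zero, mul_zero, add_zero] at h1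
  have h2 : stableLength ℓ a ≤ 0 := by
    refine ge_of_tendsto' h1 fun k => ?_
    have h3 := h.mul_stableLength_le a (2 ^ k)
    have h4 := hk k
    have h5 : (0 : ℝ) < 2 ^ k := by positivity
    push_cast at h3
    have e : ℓ a * ((1 : ℝ) / 2 ^ k) + 8 * δ * ((k : ℝ) ^ 1 / 2 ^ k) =
        (ℓ a + 8 * δ * k) / 2 ^ k := by field_simp
    rw [e, le_div_iff₀ h5]
    linarith
  linarith

section Good

variable {z : G}

theorem good_inv (h : IsHypLength ℓ δ) (hz : ℓ z + 8 * δ < ℓ (z ^ 2)) :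
    ℓ z⁻¹ + 8 * δ < ℓ (z⁻¹ ^ 2) := by
  rwa [inv_pow, h.map_inv, h.map_inv]

theorem good_pow_succ_ge (h : IsHypLength ℓ δ) (hz : ℓ z + 8 * δ < ℓ (z ^ 2)) (n : ℕ) :
    ℓ (z ^ n) + (ℓ (z ^ 2) - ℓ z - 2 * δ) ≤ ℓ (z ^ (n + 1)) := by
  have hδ := h.delta_nonneg
  exact h.pow_succ_ge (by linarith) (by linarith) n

theorem good_tendsto (h : IsHypLength ℓ δ) (hz : ℓ z + 8 * δ < ℓ (z ^ 2)) :
    Tendsto (fun n : ℕ => ℓ (z ^ n)) atTop atTop := by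
  have hδ := h.delta_nonneg
  have ht : 0 < ℓ (z ^ 2) - ℓ z - 2 * δ := by linarith
  refine tendsto_atTop_mono (fun n => ?_)
    (tendsto_natCast_atTop_atTop.atTop_mul_const ht)
  induction n with
  | zero => simp [h.map_one]
  | succ n ih =>
    have := h.good_pow_succ_ge hz n
    push_cast
    linarith

theorem lt_gromovProd_pow (h : IsHypLength ℓ δ) (hz : ℓ z + 8 * δ < ℓ (z ^ 2)) (n : ℕ) :
    ℓ z / 2 + 3 * δ < gromovProd ℓ z (z ^ (n + 1)) := by
  have := h.good_pow_succ_ge hz n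
  rw [gromovProd, pow_succ' z n, inv_mul_cancel_left, ← pow_succ']
  linarith

theorem gromovProd_pow_inv_pow_le (h : IsHypLength ℓ δ) (hz : ℓ z + 8 * δ < ℓ (z ^ 2))
    (n m : ℕ) : gromovProd ℓ (z ^ (n + 1)) (z⁻¹ ^ (m + 1)) ≤ ℓ z / 2 - 2 * δ := by
  by_contra! hlt
  have hδ := h.delta_nonneg
  have h1 := h.lt_gromovProd_pow hz n
  have h2 := h.lt_gromovProd_pow (h.good_inv hz) m
  rw [h.map_inv, h.gromovProd_comm] at h2
  have h3 : gromovProd ℓ z z⁻¹ < ℓ z / 2 - 4 * δ := by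
    have e : z⁻¹ * z⁻¹ = (z ^ 2)⁻¹ := by group
    rw [gromovProd, e, h.map_inv, h.map_inv]
    linarith
  set r := min (gromovProd ℓ (z ^ (n + 1)) (z⁻¹ ^ (m + 1))) (ℓ z / 2 + 3 * δ) with hr
  have hr1 : ℓ z / 2 - 2 * δ < r ∨ (δ = 0 ∧ r = ℓ z / 2) := by
    rcases hδ.eq_or_lt with h0 | h0
    · right
      refine ⟨h0.symm, ?_⟩
      rw [hr, ← h0, min_eq_right] <;> [ring; linarith]
    · left
      exact lt_min hlt (by linarith)
  have h4 := h.le_gromovProd (r := r) ((min_le_right _ _).trans h1.le) (min_le_left _ _)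
  have hr2 : r ≤ ℓ z / 2 + 3 * δ := min_le_right _ _
  have h5 := h.le_gromovProd (r := r - δ) h4 (by linarith)
  rcases hr1 with h6 | ⟨h6, h7⟩ <;> linarith

theorem gromovProd_pow_le (h : IsHypLength ℓ δ) (hz : ℓ z + 8 * δ < ℓ (z ^ 2)) {w : G}
    (hw : ℓ w ≤ ℓ (z⁻¹ * w)) (n : ℕ) : gromovProd ℓ w (z ^ (n + 1)) ≤ ℓ z / 2 + δ := by
  by_contra! hlt
  have hδ := h.delta_nonneg
  have h1 := h.lt_gromovProd_pow hz n
  rw [h.gromovProd_comm] at h1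
  have h2 : gromovProd ℓ w z ≤ ℓ z / 2 := by
    rw [gromovProd, h.dist_comm]
    linarith
  have h3 := h.min_gromovProd_le w (z ^ (n + 1)) z
  have h4 : ℓ z / 2 + δ < min (gromovProd ℓ w (z ^ (n + 1))) (gromovProd ℓ (z ^ (n + 1)) z) :=
    lt_min hlt (by linarith)
  linarith

theorem exists_mul_zpow_le (h : IsHypLength ℓ δ) (hz : ℓ z + 8 * δ < ℓ (z ^ 2)) {w : G}
    (hw : w * z * w⁻¹ = z ∨ w * z * w⁻¹ = z⁻¹) : ∃ j : ℤ, ℓ (w * z ^ j) ≤ ℓ z + 3 * δ := by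
  have hδ := h.delta_nonneg
  obtain ⟨_, ⟨⟨j, rfl⟩, _⟩, hmin⟩ := Set.exists_min_image
    ((Set.range fun j : ℤ => w * z ^ j) ∩ {a | ℓ a ≤ ℓ w}) ℓ ((h.finite _).inter_of_right _)
    ⟨w, ⟨0, by simp⟩, le_refl (ℓ w)⟩
  have hmin' : ∀ i : ℤ, ℓ (w * z ^ j) ≤ ℓ (w * z ^ i) := by
    intro i
    rcases le_total (ℓ (w * z ^ i)) (ℓ w) with h1 | h1
    · exact hmin _ ⟨⟨i, rfl⟩, h1⟩
    · exact (hmin w ⟨⟨0, by simp⟩, le_refl (ℓ w)⟩).trans h1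
  refine ⟨j, ?_⟩
  have hconj : ∀ a : G, w * z ^ j * a * (w * z ^ j)⁻¹ = w * (z ^ j * a * (z ^ j)⁻¹) * w⁻¹ :=
    fun a => by group
  set v := w * z ^ j with hv
  set y := w * z * w⁻¹ with hy
  have hvy : v * z = y * v := by
    rw [hv, hy]; group
  have hyl : ∀ n : ℕ, ℓ (y ^ n) = ℓ (z ^ n) := by
    intro n
    rcases hw with e | e <;> rw [e]
    rw [inv_pow, h.map_inv]
  have hyg : ℓ y + 8 * δ < ℓ (y ^ 2) := by
    have := hyl 1
    rw [pow_one, pow_one] at this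
    rwa [this, hyl]
  have hpow : ∀ n : ℕ, v * z ^ n = y ^ n * v := by
    intro n
    induction n with
    | zero => simp
    | succ n ih => rw [pow_succ, ← mul_assoc, ih, mul_assoc, hvy, ← mul_assoc, ← pow_succ]
  have hm1 : ℓ v ≤ ℓ (y⁻¹ * v) := by
    have e : y⁻¹ * v = w * z ^ (j - 1) := by
      rw [inv_mul_eq_iff_eq_mul, hy, hv, zpow_sub_one]; group
    rw [e]
    exact hmin' _
  have hm2 : ℓ v⁻¹ ≤ ℓ (z⁻¹ * v⁻¹) := by
    have e : z⁻¹ * v⁻¹ = (w * z ^ (j + 1))⁻¹ := by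
      rw [zpow_add_one, ← mul_assoc, mul_inv_rev (w * z ^ j)]
    rw [e, h.map_inv, h.map_inv]
    exact hmin' _
  obtain ⟨n, hn⟩ := (((tendsto_add_atTop_iff_nat 1).2 (h.good_tendsto hz)).eventually_gt_atTop
    (ℓ z + 3 * δ)).exists
  have h1 := h.gromovProd_pow_le hyg hm1 n
  have h2 := h.gromovProd_pow_le hz hm2 n
  have hy1 := hyl 1
  rw [pow_one, pow_one] at hy1
  rw [gromovProd, hyl, hy1] at h1
  rw [gromovProd, inv_inv, h.map_inv] at h2
  have h4 := h.four_point 1 (v * z ^ (n + 1)) v (y ^ (n + 1))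
  have e1 : (v * z ^ (n + 1))⁻¹ * y ^ (n + 1) = v⁻¹ := by rw [hpow]; group
  have e2 : (v * z ^ (n + 1))⁻¹ * v = (z ^ (n + 1))⁻¹ := by group
  rw [e1, e2, inv_one, one_mul, one_mul, one_mul, h.map_inv, h.map_inv, hyl] at h4
  rcases le_max_iff.1 (sub_le_iff_le_add.2 h4) with h5 | h5 <;> linarith

theorem finite_mul_zpow (h : IsHypLength ℓ δ) (hz : ℓ z + 8 * δ < ℓ (z ^ 2)) :
    ∃ (B : Set G), B.Finite ∧ ∀ w : G, (w * z * w⁻¹ = z ∨ w * z * w⁻¹ = z⁻¹) →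
      ∃ j : ℤ, w * z ^ j ∈ B :=
  ⟨_, h.finite _, fun _ hw => h.exists_mul_zpow_le hz hw⟩

theorem exists_zpow_eq_zpow_of_commute (h : IsHypLength ℓ δ)
    (htf : ∀ a : G, a ≠ 1 → ¬ IsOfFinOrder a) (hz : ℓ z + 8 * δ < ℓ (z ^ 2)) {w : G}
    (hw : Commute w z) (hw1 : w ≠ 1) : ∃ i j : ℤ, i ≠ 0 ∧ j ≠ 0 ∧ w ^ i = z ^ j := by
  obtain ⟨B, hB, hBw⟩ := h.finite_mul_zpow hz
  have hc : ∀ n : ℕ, ∃ j : ℤ, w ^ n * z ^ j ∈ B := fun n => hBw _ (Or.inl (by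
    rw [(hw.pow_left n).eq, mul_inv_cancel_right]))
  choose j hj using hc
  have := hB.to_subtype
  obtain ⟨n, m, hnm, he⟩ := Finite.exists_ne_map_eq_of_infinite
    (fun n => (⟨_, hj n⟩ : B))
  have he' : w ^ n * z ^ j n = w ^ m * z ^ j m := congrArg Subtype.val he
  have key : w ^ ((n : ℤ) - m) = z ^ (j m - j n) := by
    have e1 : (w ^ m)⁻¹ * w ^ n = z ^ j m * (z ^ j n)⁻¹ := by
      rw [inv_mul_eq_iff_eq_mul, ← mul_assoc, ← he', mul_inv_cancel_right]
    rw [zpow_sub, zpow_sub, zpow_natCast, zpow_natCast, ← e1]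
    exact ((Commute.refl w).pow_pow n m).inv_right.eq
  have hi : (n : ℤ) - m ≠ 0 := by
    intro h0
    exact hnm (by omega)
  refine ⟨_, _, hi, fun h0 => ?_, key⟩
  rw [h0, zpow_zero] at key
  exact htf w hw1 (isOfFinOrder_iff_zpow_eq_one.2 ⟨_, hi, key⟩)

theorem isVirtuallyNilpotent_of_normalizing (h : IsHypLength ℓ δ)
    (hz : ℓ z + 8 * δ < ℓ (z ^ 2)) (H : Subgroup G)
    (hH : ∀ w ∈ H, w * z * w⁻¹ = z ∨ w * z * w⁻¹ = z⁻¹) : IsVirtuallyNilpotent H := by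
  obtain ⟨B, hB, hBw⟩ := h.finite_mul_zpow hz
  choose j hj using fun w : H => hBw w.1 (hH _ w.2)
  refine ⟨(Subgroup.zpowers z).subgroupOf H, ?_, ?_⟩
  · rw [Subgroup.finiteIndex_iff_finite_quotient]
    have := hB.to_subtype
    refine Finite.of_injective (fun q : H ⧸ (Subgroup.zpowers z).subgroupOf H =>
      (⟨_, hj q.out⟩ : B)) fun q q' hq => ?_
    have hq' : (q.out : G) * z ^ j q.out = q'.out * z ^ j q'.out := congrArg Subtype.val hq
    rw [← q.out_eq', ← q'.out_eq']
    refine QuotientGroup.eq.2 (Subgroup.mem_subgroupOf.2 ⟨j q.out - j q'.out, ?_⟩)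
    change z ^ _ = (q.out : G)⁻¹ * q'.out
    rw [eq_inv_mul_iff_mul_eq, zpow_sub, ← mul_assoc, hq', mul_inv_cancel_right]
  · have : Group.IsNilpotent (Subgroup.zpowers z) := by
      refine (Group.isNilpotent_iff _).2 ⟨1, ?_⟩
      rw [Subgroup.upperCentralSeries_one, eq_top_iff]
      intro a _
      refine Subgroup.mem_center_iff.2 fun b => Subtype.ext ?_
      obtain ⟨_, i, rfl⟩ := a
      obtain ⟨_, k, rfl⟩ := b
      exact (zpow_mul_comm z k i)
    refine Group.isNilpotent_of_injective (Q := Subgroup.zpowers z)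
      ((H.subtype.comp (Subgroup.subtype _)).codRestrict (Subgroup.zpowers z) fun a => a.2) ?_
    intro a b hab
    have hab' : ((a : H) : G) = b := congrArg (fun q : Subgroup.zpowers z => (q : G)) hab
    exact Subtype.ext (Subtype.ext hab')

end Good

end IsHypLength

namespace IsHypLength

variable {G : Type*} [Group G] {ℓ : G → ℝ} {δ : ℝ}

theorem tendsto_pow (h : IsHypLength ℓ δ) (htf : ∀ a : G, a ≠ 1 → ¬ IsOfFinOrder a) {u : G}
    (hu : u ≠ 1) : Tendsto (fun n : ℕ => ℓ (u ^ n)) atTop atTop := by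
  refine tendsto_atTop.2 fun b => ?_
  have hinj := injective_pow_iff_not_isOfFinOrder.2 (htf u hu)
  have hfin := (h.finite b).preimage hinj.injOn
  rw [← Nat.cofinite_eq_atTop]
  filter_upwards [hfin.compl_mem_cofinite] with n hn
  exact (not_le.1 (show ¬ ℓ (u ^ n) ≤ b from hn)).le

theorem zpow_ne_one (htf : ∀ a : G, a ≠ 1 → ¬ IsOfFinOrder a) {u : G} (hu : u ≠ 1) {k : ℤ}
    (hk : k ≠ 0) : u ^ k ≠ 1 :=
  fun e => htf u hu (isOfFinOrder_iff_zpow_eq_one.2 ⟨k, hk, e⟩)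

theorem stableLength_pow_ne_zero (h : IsHypLength ℓ δ) {a : G} (ha : stableLength ℓ a ≠ 0)
    {n : ℕ} (hn : n ≠ 0) : stableLength ℓ (a ^ n) ≠ 0 := by
  rw [h.stableLength_pow]
  exact mul_ne_zero (Nat.cast_ne_zero.2 hn) ha

theorem stableLength_zpow_ne_zero (h : IsHypLength ℓ δ) {a : G} (ha : stableLength ℓ a ≠ 0)
    {n : ℤ} (hn : n ≠ 0) : stableLength ℓ (a ^ n) ≠ 0 := by
  rw [h.stableLength_zpow]
  exact mul_ne_zero (abs_ne_zero.2 (Int.cast_ne_zero.2 hn)) ha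

theorem eq_or_eq_neg_of_conj (h : IsHypLength ℓ δ) {u : G} (hu : stableLength ℓ u ≠ 0)
    {a : G} {p q : ℤ} (he : a * u ^ p * a⁻¹ = u ^ q) : q = p ∨ q = -p := by
  have := h.stableLength_conj (u ^ p) a
  rw [he, h.stableLength_zpow, h.stableLength_zpow] at this
  have := mul_right_cancel₀ hu this
  exact abs_eq_abs.1 (by exact_mod_cast this)

/-- The elements conjugating some nontrivial power of `u` to a nontrivial power of `u`. -/
def powerCommensurator (u : G) : Subgroup G where
  carrier := {a | ∃ p q : ℤ, p ≠ 0 ∧ q ≠ 0 ∧ a * u ^ p * a⁻¹ = u ^ q}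
  one_mem' := ⟨1, 1, one_ne_zero, one_ne_zero, by group⟩
  mul_mem' := by
    rintro a b ⟨p, q, hp, hq, e⟩ ⟨r, t, hr, ht, e'⟩
    refine ⟨r * p, q * t, mul_ne_zero hr hp, mul_ne_zero hq ht, ?_⟩
    have e1 : a * b * u ^ (r * p) * (a * b)⁻¹ = a * (b * u ^ r * b⁻¹) ^ p * a⁻¹ := by
      rw [conj_zpow, zpow_mul]; group
    rw [e1, e', ← zpow_mul, mul_comm t p, zpow_mul, ← conj_zpow, e, zpow_mul]
  inv_mem' := by
    rintro a ⟨p, q, hp, hq, e⟩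
    exact ⟨q, p, hq, hp, by rw [← e]; group⟩

theorem mem_powerCommensurator_of_conj (h : IsHypLength ℓ δ)
    (htf : ∀ a : G, a ≠ 1 → ¬ IsOfFinOrder a) {u : G} (hu : stableLength ℓ u ≠ 0) (hu1 : u ≠ 1)
    {a : G} {k : ℤ} (hk : k ≠ 0) (ha : a * u ^ k * a⁻¹ ∈ powerCommensurator u) :
    a ∈ powerCommensurator u := by
  obtain ⟨p, q, hp, hq, e⟩ := ha
  set v := a * u ^ k * a⁻¹ with hv
  have hv2 : v ^ 2 = a * u ^ (k * 2) * a⁻¹ := by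
    rw [hv, conj_pow, zpow_mul]; norm_cast
  have hv1 : v ^ 2 ≠ 1 := by
    rw [hv2, Ne, conj_eq_one_iff]
    exact zpow_ne_one htf hu1 (by omega)
  have hcomm : Commute (v ^ 2) (u ^ p) := by
    have e2 : v ^ 2 * u ^ p * (v ^ 2)⁻¹ = u ^ p := by
      have e3 : v ^ 2 * u ^ p * (v ^ 2)⁻¹ = v * (v * u ^ p * v⁻¹) * v⁻¹ := by
        rw [sq]; group
      rw [e3, e]
      rcases h.eq_or_eq_neg_of_conj hu e with rfl | rfl
      · exact e
      · rw [zpow_neg, ← conj_inv, e, zpow_neg, inv_inv]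
    exact mul_inv_eq_iff_eq_mul.1 e2
  obtain ⟨n, hn, hz⟩ := h.exists_pow_sq_gt (h.stableLength_zpow_ne_zero hu hp)
  obtain ⟨i, j, hi, hj, hij⟩ := h.exists_zpow_eq_zpow_of_commute htf hz (hcomm.pow_right n) hv1
  refine ⟨k * 2 * i, p * n * j, by simp [hk, hi], by simp [hp, hn.ne', hj], ?_⟩
  rw [zpow_mul, ← conj_zpow, ← hv2, hij, zpow_mul, zpow_mul, zpow_natCast]

theorem isVirtuallyNilpotent_of_le_powerCommensurator (h : IsHypLength ℓ δ) {u : G}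
    (hu : stableLength ℓ u ≠ 0) {H : Subgroup G} (hH : H ≤ powerCommensurator u) (hfg : H.FG) :
    IsVirtuallyNilpotent H := by
  obtain ⟨S, rfl⟩ := hfg
  have hS : ∀ s ∈ S, ∃ p : ℤ, p ≠ 0 ∧ (s * u ^ p * s⁻¹ = u ^ p ∨ s * u ^ p * s⁻¹ = (u ^ p)⁻¹) := by
    intro s hs
    obtain ⟨p, q, hp, hq, e⟩ := hH (Subgroup.subset_closure hs)
    refine ⟨p, hp, ?_⟩
    rcases h.eq_or_eq_neg_of_conj hu e with rfl | rfl
    · exact Or.inl e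
    · exact Or.inr (by rw [e, zpow_neg])
  choose! p hp hpS using hS
  set Q : ℤ := ∏ s ∈ S, p s with hQ
  have hQ0 : Q ≠ 0 := Finset.prod_ne_zero_iff.2 hp
  obtain ⟨n, hn, hz⟩ := h.exists_pow_sq_gt (h.stableLength_zpow_ne_zero hu hQ0)
  refine h.isVirtuallyNilpotent_of_normalizing hz _ fun w hw => ?_
  induction hw using Subgroup.closure_induction with
  | mem s hs =>
    obtain ⟨c, hc⟩ := Finset.dvd_prod_of_mem p hs
    rw [← hQ] at hc
    rw [hc, zpow_mul, ← conj_pow, ← conj_zpow]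
    rcases hpS s hs with e | e
    · exact Or.inl (by rw [e])
    · exact Or.inr (by rw [e, inv_zpow, inv_pow])
  | one => exact Or.inl (by group)
  | mul x y _ _ hx hy =>
    set z := (u ^ Q) ^ n
    have e : x * y * z * (x * y)⁻¹ = x * (y * z * y⁻¹) * x⁻¹ := by group
    rw [e]
    rcases hy with hy | hy <;> rw [hy]
    · exact hx
    · rw [← conj_inv, inv_inj]
      rcases hx with hx | hx <;> rw [hx]
      · exact Or.inr rfl
      · exact Or.inl (inv_inv _)
  | inv x _ hx =>
    set z := (u ^ Q) ^ n
    rcases hx with hx | hx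
    · left
      nth_rewrite 1 [← hx]; group
    · right
      have e : z = x * z⁻¹ * x⁻¹ := by rw [← conj_inv, hx, inv_inv]
      nth_rewrite 1 [e]; group

section Parabolic

variable {u : G}

theorem exists_parabolic (h : IsHypLength ℓ δ)
    (hu : Tendsto (fun n : ℕ => ℓ (u ^ n)) atTop atTop) :
    ∃ E : Subgroup G, ∀ a, a ∈ E ↔
      Tendsto (fun n : ℕ => gromovProd ℓ (u ^ n) (a * u ^ n)) atTop atTop := by
  refine ⟨⟨⟨⟨{a | Tendsto (fun n : ℕ => gromovProd ℓ (u ^ n) (a * u ^ n)) atTop atTop}, ?_⟩,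
    ?_⟩, ?_⟩, fun a => Iff.rfl⟩
  · intro a b ha hb
    refine tendsto_atTop.2 fun r => ?_
    filter_upwards [tendsto_atTop.1 ha (r + δ), tendsto_atTop.1 hb (r + δ + ℓ a)] with n h1 h2
    have h3 := h.gromovProd_mul_left a (u ^ n) (b * u ^ n)
    have h4 := h.le_gromovProd h1 (c := a * (b * u ^ n)) (by linarith)
    rw [mul_assoc]
    linarith
  · refine hu.congr fun n => ?_
    rw [one_mul, gromovProd, inv_mul_cancel, h.map_one]
    ring
  · intro a ha
    refine tendsto_atTop_mono (fun n => ?_) (tendsto_atTop_add_const_right _ (-ℓ a) ha)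
    have h1 := h.gromovProd_mul_left a⁻¹ (a * u ^ n) (u ^ n)
    rw [inv_mul_cancel_left, h.gromovProd_comm, h.map_inv] at h1
    linarith

variable {E : Subgroup G}

theorem le_gromovProd_zpow_of_good (h : IsHypLength ℓ δ)
    (hE : ∀ a, a ∈ E ↔ Tendsto (fun n : ℕ => gromovProd ℓ (u ^ n) (a * u ^ n)) atTop atTop)
    (hu : Tendsto (fun n : ℕ => ℓ (u ^ n)) atTop atTop) {z : G}
    (hz : ℓ z + 8 * δ < ℓ (z ^ 2)) (hzE : z ∈ E)
    (hfr : ∃ᶠ n : ℕ in atTop, gromovProd ℓ (u ^ n) z⁻¹ ≤ ℓ z / 2 - δ) (N : ℕ) :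
    ℓ ((z ^ (N + 1))⁻¹ * u * z ^ (N + 1)) ≤ 3 * ℓ u + ℓ z + 6 * δ := by
  have hδ := h.delta_nonneg
  set y := z ^ (N + 1) with hy
  have hyE : y ∈ E := pow_mem hzE _
  have hgood := h.lt_gromovProd_pow (h.good_inv hz) N
  rw [inv_pow, ← hy, h.map_inv] at hgood
  obtain ⟨n, hn1, hn2, hn3⟩ := (hfr.and_eventually
    ((tendsto_atTop.1 ((hE y).1 hyE) (ℓ y)).and (tendsto_atTop.1 hu (ℓ y)))).exists
  have h1 : gromovProd ℓ (u ^ n) y⁻¹ ≤ ℓ z / 2 := by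
    by_contra! hlt
    have := h.min_gromovProd_le (u ^ n) y⁻¹ z⁻¹
    have h2 : ℓ z / 2 < min (gromovProd ℓ (u ^ n) y⁻¹) (gromovProd ℓ y⁻¹ z⁻¹) :=
      lt_min hlt (by rw [h.gromovProd_comm y⁻¹]; linarith)
    linarith
  have hlz : 0 ≤ ℓ z := h.nonneg z
  have hlu : 0 ≤ ℓ u := h.nonneg u
  have h2 : gromovProd ℓ (u ^ n) y⁻¹ + gromovProd ℓ (y * u ^ n) y = ℓ y := by
    rw [h.gromovProd_comm, gromovProd, gromovProd, inv_inv, h.map_inv,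
      show (y * u ^ n)⁻¹ * y = (u ^ n)⁻¹ by group, h.map_inv]
    ring
  have h3 := h.le_gromovProd (r := ℓ y - ℓ z / 2) (by linarith : _ ≤ gromovProd ℓ (u ^ n) (y * u ^ n))
    (by linarith : _ ≤ gromovProd ℓ (y * u ^ n) y)
  have h4 := h.gromovProd_mul_left u (u ^ n) y
  have h5 := h.gromovProd_self_mul (u ^ n) u
  rw [← pow_succ, pow_succ'] at h5
  have h6 := h.le_gromovProd (r := ℓ y - ℓ z / 2 - δ - ℓ u)
    (by linarith : _ ≤ gromovProd ℓ (u ^ n) (u * u ^ n))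
    (by linarith : _ ≤ gromovProd ℓ (u * u ^ n) (u * y))
  have h7 := h.le_gromovProd (r := ℓ y - ℓ z / 2 - δ - ℓ u - δ) (a := y)
    (by rw [h.gromovProd_comm]; linarith) h6
  rw [gromovProd, ← mul_assoc] at h7
  have h8 := h.map_mul_le u y
  linarith

theorem stableLength_eq_zero_of_mem_parabolic (h : IsHypLength ℓ δ)
    (htf : ∀ a : G, a ≠ 1 → ¬ IsOfFinOrder a)
    (hE : ∀ a, a ∈ E ↔ Tendsto (fun n : ℕ => gromovProd ℓ (u ^ n) (a * u ^ n)) atTop atTop)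
    (hu1 : u ≠ 1) (hu : stableLength ℓ u = 0) {x : G} (hx : x ∈ E) : stableLength ℓ x = 0 := by
  by_contra hx0
  have hδ := h.delta_nonneg
  have htend := h.tendsto_pow htf hu1
  obtain ⟨n, hn, hz⟩ := h.exists_pow_sq_gt hx0
  have hz0 := h.stableLength_pow_ne_zero hx0 hn.ne'
  have hzE : x ^ n ∈ E := pow_mem hx n
  set z := x ^ n
  obtain ⟨z, hz, hz0, hzE, hfr⟩ : ∃ z : G, ℓ z + 8 * δ < ℓ (z ^ 2) ∧ stableLength ℓ z ≠ 0 ∧ z ∈ E ∧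
      ∃ᶠ n : ℕ in atTop, gromovProd ℓ (u ^ n) z⁻¹ ≤ ℓ z / 2 - δ := by
    by_cases hf : ∃ᶠ n : ℕ in atTop, gromovProd ℓ (u ^ n) z⁻¹ ≤ ℓ z / 2 - δ
    · exact ⟨z, hz, hz0, hzE, hf⟩
    · refine ⟨z⁻¹, h.good_inv hz, by rwa [h.stableLength_inv], inv_mem hzE,
        (Eventually.mono (not_frequently.1 hf) fun m hm => ?_).frequently⟩
      rw [inv_inv, h.map_inv]
      by_contra! hlt
      have h1 := h.min_gromovProd_le z (u ^ m) z⁻¹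
      have h2 := h.gromovProd_pow_inv_pow_le hz 0 0
      simp only [zero_add, pow_one] at h2
      have h3 : ℓ z / 2 - δ < min (gromovProd ℓ z (u ^ m)) (gromovProd ℓ (u ^ m) z⁻¹) :=
        lt_min (by rwa [h.gromovProd_comm]) (not_le.1 hm)
      linarith
  have hfin := h.finite (3 * ℓ u + ℓ z + 6 * δ)
  have := hfin.to_subtype
  obtain ⟨N, M, hNM, he⟩ := Finite.exists_ne_map_eq_of_infinite (fun N =>
    (⟨_, h.le_gromovProd_zpow_of_good hE htend hz hzE hfr N⟩ :
      {a | ℓ a ≤ 3 * ℓ u + ℓ z + 6 * δ}))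
  have he' : (z ^ (N + 1))⁻¹ * u * z ^ (N + 1) = (z ^ (M + 1))⁻¹ * u * z ^ (M + 1) :=
    congrArg Subtype.val he
  have hcomm : Commute u (z ^ ((N : ℤ) - M)) := by
    have e1 : z ^ ((N : ℤ) - M) = z ^ (N + 1) * (z ^ (M + 1))⁻¹ := by
      rw [← zpow_natCast, ← zpow_natCast, ← zpow_neg, ← zpow_add]
      congr 1
      push_cast
      ring
    have e2 : u * z ^ (N + 1) = z ^ (N + 1) * ((z ^ (M + 1))⁻¹ * u * z ^ (M + 1)) := by
      rw [← he']; group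
    rw [e1, commute_iff_eq, ← mul_assoc, e2]
    group
  obtain ⟨m, hm, ht⟩ := h.exists_pow_sq_gt
    (h.stableLength_zpow_ne_zero hz0 (sub_ne_zero.2 (Nat.cast_injective.ne hNM)))
  obtain ⟨i, j, hi, hj, hij⟩ := h.exists_zpow_eq_zpow_of_commute htf ht (hcomm.pow_right m) hu1
  have h1 : stableLength ℓ (u ^ i) ≠ 0 := by
    rw [hij]
    exact h.stableLength_zpow_ne_zero (h.stableLength_pow_ne_zero
      (h.stableLength_zpow_ne_zero hz0 (sub_ne_zero.2 (Nat.cast_injective.ne hNM))) hm.ne') hj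
  rw [h.stableLength_zpow, hu, mul_zero] at h1
  exact h1 rfl

theorem mem_parabolic_of_conj (h : IsHypLength ℓ δ)
    (htf : ∀ a : G, a ≠ 1 → ¬ IsOfFinOrder a)
    (hE : ∀ a, a ∈ E ↔ Tendsto (fun n : ℕ => gromovProd ℓ (u ^ n) (a * u ^ n)) atTop atTop)
    (hu1 : u ≠ 1) (hu : stableLength ℓ u = 0) (huE : u ∈ E) {a : G} {k : ℤ} (hk : k ≠ 0)
    (ha : a * u ^ k * a⁻¹ ∈ E) : a ∈ E := by
  have hδ := h.delta_nonneg
  have hsq : ∀ x ∈ E, ℓ (x ^ 2) ≤ ℓ x + 2 * δ := fun x hx =>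
    h.sq_le_of_stableLength_eq_zero (h.stableLength_eq_zero_of_mem_parabolic htf hE hu1 hu hx)
  have hmin : ∀ r : ℝ, ∀ x ∈ E, ∀ y ∈ E, 2 * r + 6 * δ ≤ ℓ x → 2 * r + 6 * δ ≤ ℓ y →
      r ≤ gromovProd ℓ x y := by
    intro r x hx y hy h1 h2
    have h3 := h.mul_le_max_add (hsq _ (inv_mem hx)) (hsq _ hy) (hsq _ (mul_mem (inv_mem hx) hy))
    rw [h.map_inv] at h3
    rw [gromovProd]
    rcases le_max_iff.1 (sub_le_iff_le_add.2 h3) with h4 | h4 <;> linarith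
  set w := a * u ^ k * a⁻¹ with hw
  have huk := zpow_ne_one htf hu1 hk
  have hw1 : w ≠ 1 := by rwa [hw, Ne, conj_eq_one_iff]
  refine (hE a).2 (tendsto_atTop.2 fun r => ?_)
  set R := 2 * (r + 2 * δ + ℓ a) + 6 * δ with hR
  have hla := h.nonneg a
  filter_upwards [tendsto_atTop.1 (h.tendsto_pow htf hu1) R,
    tendsto_atTop.1 (h.tendsto_pow htf huk) R, tendsto_atTop.1 (h.tendsto_pow htf hw1) R,
    tendsto_atTop.1 (h.tendsto_pow htf hw1) (r + 2 * δ + ℓ a)] with n h1 h2 h3 h4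
  have h5 := hmin _ _ (pow_mem huE n) _ (pow_mem ha n) h1 h3
  have h6 := h.gromovProd_self_mul (w ^ n) a
  have h7 := hmin _ _ (pow_mem (zpow_mem huE k) n) _ (pow_mem huE n) h2 h1
  have h8 := h.gromovProd_mul_left a ((u ^ k) ^ n) (u ^ n)
  have e : w ^ n * a = a * (u ^ k) ^ n := by rw [hw, conj_pow]; group
  rw [e] at h6
  have h9 := h.le_gromovProd (r := r + 2 * δ) (a := u ^ n) (by linarith)
    (by linarith : _ ≤ gromovProd ℓ (w ^ n) (a * (u ^ k) ^ n))
  have h10 := h.le_gromovProd (r := r + δ) (a := u ^ n) (by linarith)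
    (by linarith : _ ≤ gromovProd ℓ (a * (u ^ k) ^ n) (a * u ^ n))
  linarith

end Parabolic

/-- Every nontrivial element `u` lies in a subgroup `E` which is locally virtually nilpotent and
contains every element conjugating a nontrivial power of `u` into `E`. -/
theorem exists_elementary_subgroup (h : IsHypLength ℓ δ)
    (htf : ∀ a : G, a ≠ 1 → ¬ IsOfFinOrder a) {A b : ℕ}
    (hA : ∀ R : ℕ, {a | ℓ a ≤ R}.ncard ≤ A * 2 ^ (b * R)) {u : G} (hu : u ≠ 1) :
    ∃ E : Subgroup G, u ∈ E ∧ (∀ a, ∀ k : ℤ, k ≠ 0 → a * u ^ k * a⁻¹ ∈ E → a ∈ E) ∧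
      ∀ H ≤ E, H.FG → IsVirtuallyNilpotent H := by
  by_cases hs : stableLength ℓ u = 0
  · obtain ⟨E, hE⟩ := h.exists_parabolic (h.tendsto_pow htf hu)
    have huE : u ∈ E := by
      refine (hE u).2 (tendsto_atTop_mono (fun n => ?_)
        (tendsto_atTop_add_const_right _ (-ℓ u) (h.tendsto_pow htf hu)))
      have := h.gromovProd_self_mul (u ^ n) u
      rwa [← pow_succ, pow_succ'] at this
    refine ⟨E, huE, fun a k hk ha => h.mem_parabolic_of_conj htf hE hu hs huE hk ha,
      fun H hH hfg => ?_⟩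
    have hinj : Function.Injective H.subtype := Subtype.coe_injective
    have h' := h.comp_injective H.subtype hinj
    obtain ⟨D, hD⟩ := h'.polyGrowth_of_stableLength_eq_zero (A := A) (b := b) (fun R => by
      refine le_trans ?_ (hA R)
      rw [← Set.ncard_image_of_injective _ hinj]
      refine Set.ncard_le_ncard ?_ (h.finite _)
      rintro _ ⟨x, hx, rfl⟩
      exact hx) fun x => h.stableLength_eq_zero_of_mem_parabolic htf hE hu hs (hH x.2)
    have : Group.FG H := (Group.fg_iff_subgroup_fg H).2 hfg
    exact (gromov_polynomial_growth D hD).1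
  · refine ⟨powerCommensurator u, ⟨1, 1, one_ne_zero, one_ne_zero, by group⟩,
      fun a k hk ha => h.mem_powerCommensurator_of_conj htf hs hu hk ha,
      fun H hH hfg => h.isVirtuallyNilpotent_of_le_powerCommensurator hs hH hfg⟩

end IsHypLength

/-- Every `r`-separated set of elements of length at most `R` has at most `N` elements. -/
def SepBound {G : Type*} [Group G] (ℓ : G → ℝ) (R r N : ℝ) : Prop :=
  ∀ S : Finset G, (∀ a ∈ S, ℓ a ≤ R) → (∀ a ∈ S, ∀ b ∈ S, a ≠ b → r < ℓ (a⁻¹ * b)) →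
    (S.card : ℝ) ≤ N

theorem Subgroup.mem_of_iterate_commutator_mem {G : Type*} [Group G] {E : Subgroup G} {t : G}
    (htE : t ∈ E) (ht : ∀ a, a * t⁻¹ * a⁻¹ ∈ E → a ∈ E) (c : ℕ) (x : G)
    (hx : (fun y => ⁅t, y⁆)^[c] x ∈ E) : x ∈ E := by
  induction c generalizing x with
  | zero => exact hx
  | succ c ih =>
    have h1 : ⁅t, x⁆ ∈ E := ih _ hx
    refine ht x ?_
    rw [commutatorElement_def, mul_assoc, mul_assoc, E.mul_mem_cancel_left htE, ← mul_assoc] at h1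
    exact h1

namespace IsHypLength

variable {G : Type*} [Group G] {ℓ : G → ℝ} {δ : ℝ}

theorem pos (h : IsHypLength ℓ δ) (htf : ∀ a : G, a ≠ 1 → ¬ IsOfFinOrder a) {u : G}
    (hu : u ≠ 1) : 0 < ℓ u := by
  by_contra! hle
  obtain ⟨n, hn⟩ := ((h.tendsto_pow htf hu).eventually_gt_atTop 0).exists
  have : ∀ n : ℕ, ℓ (u ^ n) ≤ 0 := by
    intro n
    induction n with
    | zero => rw [pow_zero, h.map_one]
    | succ n ih =>
      rw [pow_succ]
      linarith [h.map_mul_le (u ^ n) u]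
  linarith [this n]

theorem pow_le (h : IsHypLength ℓ δ) (u : G) (n : ℕ) : ℓ (u ^ n) ≤ n * ℓ u := by
  induction n with
  | zero => rw [pow_zero, h.map_one]; simp
  | succ n ih =>
    rw [pow_succ]
    push_cast
    linarith [h.map_mul_le (u ^ n) u]

theorem le_of_mem_pow (h : IsHypLength ℓ δ) {T : Set G} {R : ℝ} (hT : ∀ a ∈ T, ℓ a ≤ R) (n : ℕ) :
    ∀ a ∈ T ^ n, ℓ a ≤ n * R := by
  induction n with
  | zero =>
    intro a ha
    rw [pow_zero, Set.mem_one] at ha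
    rw [ha, h.map_one]
    simp
  | succ n ih =>
    rintro _ ha
    rw [pow_succ] at ha
    obtain ⟨x, hx, y, hy, rfl⟩ := ha
    have := ih x hx
    have := hT y hy
    push_cast
    linarith [h.map_mul_le x y]

theorem mem_of_le_two_mul (h : IsHypLength ℓ δ) (htf : ∀ a : G, a ≠ 1 → ¬ IsOfFinOrder a)
    {g : G} (hg : g ≠ 1) {E : Subgroup G}
    (hE : ∀ a, ∀ k : ℤ, k ≠ 0 → a * g ^ k * a⁻¹ ∈ E → a ∈ E) {ρ N : ℝ}
    (hsep : SepBound ℓ (3 * ρ) ρ N) (hN : N * ℓ g ≤ ρ) (hρ : ∀ a, ℓ a ≤ ρ → a ∈ E)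
    {a : G} (ha : ℓ a ≤ 2 * ρ) : a ∈ E := by
  classical
  by_contra haE
  have hinj : Function.Injective fun i : ℕ => g ^ i * a := fun i j hij =>
    injective_pow_iff_not_isOfFinOrder.2 (htf g hg) (mul_right_cancel hij)
  have hN0 : 0 ≤ N := by
    have := hsep ∅ (by simp) (by simp)
    simpa using this
  have hcard := hsep ((Finset.range (⌊N⌋₊ + 1)).image fun i : ℕ => g ^ i * a) (by
    intro b hb
    obtain ⟨i, hi, rfl⟩ := Finset.mem_image.1 hb
    have h1 : (i : ℝ) ≤ N :=
      (Nat.cast_le.2 (Nat.lt_succ_iff.1 (Finset.mem_range.1 hi))).trans (Nat.floor_le hN0)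
    have h2 := h.pow_le g i
    have h3 := h.map_mul_le (g ^ i) a
    have h4 := mul_le_mul_of_nonneg_right h1 (h.nonneg g)
    linarith) (by
    intro b hb c hc hbc
    obtain ⟨i, -, rfl⟩ := Finset.mem_image.1 hb
    obtain ⟨j, -, rfl⟩ := Finset.mem_image.1 hc
    by_contra! hle
    have hij : i ≠ j := fun e => hbc (by rw [e])
    have h1 := hE a⁻¹ ((j : ℤ) - i) (sub_ne_zero.2 (Nat.cast_injective.ne hij.symm)) (by
      have e : (g ^ i * a)⁻¹ * (g ^ j * a) = a⁻¹ * g ^ ((j : ℤ) - i) * a⁻¹⁻¹ := by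
        rw [zpow_sub, zpow_natCast, zpow_natCast,
          ((Commute.refl g).pow_pow j i).inv_right.eq]
        group
      rw [← e]
      exact hρ _ hle)
    exact haE (by simpa using E.inv_mem h1))
  rw [Finset.card_image_of_injective _ hinj, Finset.card_range] at hcard
  have := Nat.lt_floor_add_one N
  push_cast at hcard
  linarith

end IsHypLength

theorem ncard_pow_le_of_sepBound {G : Type*} [Group G] {ℓ : G → ℝ} {δ : ℝ}
    (h : IsHypLength ℓ δ) {q M n : ℕ} (hM : 0 < M) {s : ℝ} (hs : 0 < s)
    (hmin : ∀ a, a ≠ 1 → s ≤ ℓ a)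
    (hsep : ∀ i : ℕ, SepBound ℓ ((n + 1) * M * s) ((n + 1) * M * s / 2 ^ i) ((2 ^ q) ^ (i + 1)))
    {T : Set G} (hT : ∀ a ∈ T, ℓ a ≤ M * s) :
    (T ^ n).ncard ≤ (4 * M) ^ q * (n + 1) ^ q := by
  set i := Nat.log 2 ((n + 1) * M) + 1 with hi
  have hlt : (n + 1) * M < 2 ^ i := Nat.lt_pow_succ_log_self (by norm_num) _
  have hle : 2 ^ i ≤ 2 * ((n + 1) * M) := by
    rw [hi, pow_succ, mul_comm]
    exact Nat.mul_le_mul_left 2 (Nat.pow_log_le_self 2 (by positivity))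
  have hball : ∀ a ∈ T ^ n, ℓ a ≤ (n + 1) * M * s := by
    intro a ha
    have := h.le_of_mem_pow hT n a ha
    have : 0 ≤ M * s := by positivity
    nlinarith
  have hfin : (T ^ n).Finite := (h.finite _).subset hball
  have hcard := hsep i hfin.toFinset (fun a ha => hball a (hfin.mem_toFinset.1 ha)) (by
    intro a _ b _ hab
    refine lt_of_lt_of_le ?_ (hmin _ fun e => hab (inv_mul_eq_one.1 e))
    rw [div_lt_iff₀ (by positivity), mul_comm s]
    exact mul_lt_mul_of_pos_right (by exact_mod_cast hlt) hs)
  rw [← Set.ncard_eq_toFinset_card _ hfin] at hcard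
  have hcard' : (T ^ n).ncard ≤ (2 ^ q) ^ (i + 1) := by exact_mod_cast hcard
  refine hcard'.trans ?_
  rw [← mul_pow, ← pow_mul, mul_comm q, pow_mul]
  refine Nat.pow_le_pow_left ?_ q
  rw [pow_succ]
  nlinarith

/-- If the minimal length `ℓ g` of a nontrivial element is exponentially small in `Δ`, then the
elements of length at most `Δ + 1` generate a virtually nilpotent group. -/
theorem exists_systole_constant (q : ℕ) {Λ κ r₀ : ℝ} (hΛ : 1 ≤ Λ) (hκ : 0 ≤ κ) (hr₀ : 0 < r₀) :
    ∃ H : ℝ, 0 < H ∧ ∀ (G : Type*) [Group G] (ℓ : G → ℝ) (δ : ℝ), IsHypLength ℓ δ →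
      (∀ a : G, a ≠ 1 → ¬ IsOfFinOrder a) →
      (∃ A b : ℕ, ∀ R : ℕ, {a | ℓ a ≤ R}.ncard ≤ A * 2 ^ (b * R)) →
      (∀ R, 0 < R → R ≤ r₀ → ∀ i : ℕ, SepBound ℓ R (R / 2 ^ i) ((2 ^ q) ^ (i + 1))) →
      (∀ ρ, 0 < ρ → SepBound ℓ (3 * ρ) ρ (Λ * Real.exp (κ * ρ))) →
      ∀ g : G, g ≠ 1 → (∀ a, a ≠ 1 → ℓ g ≤ ℓ a) → ∀ Δ : ℝ, 0 ≤ Δ →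
        ℓ g < (1 / H) * Real.exp (-H * Δ) →
        IsVirtuallyNilpotent (Subgroup.closure {a : G | ℓ a ≤ Δ + 1}) := by
  set M₀ := Λ * Real.exp κ with hM₀
  have hM₀1 : 1 ≤ M₀ := one_le_mul_of_one_le_of_one_le hΛ (Real.one_le_exp hκ)
  set M := ⌈2 * M₀ + 1⌉₊ with hM
  have hMM₀ : 2 * M₀ + 1 ≤ M := Nat.le_ceil _
  have hMpos : 0 < M := by
    have : (0 : ℝ) < M := by linarith
    exact_mod_cast this
  obtain ⟨n₀, hn₀⟩ := exists_engel_of_growth ((4 * M) ^ q) q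
  have hX : 0 ≤ (n₀ + 1) * M / r₀ := by positivity
  refine ⟨κ + M₀ + (n₀ + 1) * M / r₀, by linarith, ?_⟩
  intro G _ ℓ δ h htf hA hsmall hdoub g hg hmin Δ hΔ hlt
  obtain ⟨A, b, hA⟩ := hA
  set H := κ + M₀ + (n₀ + 1) * M / r₀ with hH
  have hHpos : 0 < H := by linarith
  set s := ℓ g with hs
  have hspos : 0 < s := h.pos htf hg
  have hsH : s * H < Real.exp (-H * Δ) := by
    rwa [one_div, inv_mul_eq_div, lt_div_iff₀ hHpos] at hlt
  have hsH1 : s * H < 1 := hsH.trans_le (Real.exp_le_one_iff.2 (by nlinarith))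
  have hsM : s * M₀ < Real.exp (-κ * Δ) := by
    refine lt_of_le_of_lt (mul_le_mul_of_nonneg_left (by linarith) hspos.le)
      (hsH.trans_le (Real.exp_le_exp.2 ?_))
    have : κ ≤ H := by linarith
    nlinarith
  have hsM1 : M₀ * s < 1 := by nlinarith
  have hsr : (n₀ + 1) * M * s ≤ r₀ := by
    have h1 : s * ((n₀ + 1) * M / r₀) ≤ 1 :=
      (mul_le_mul_of_nonneg_left (by linarith) hspos.le).trans hsH1.le
    rw [mul_div_assoc', div_le_one hr₀] at h1
    linarith
  obtain ⟨E, hgE, hE, hnil⟩ := h.exists_elementary_subgroup htf hA hg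
  have hbase : ∀ a, ℓ a ≤ M₀ * s → a ∈ E := by
    intro a ha
    have hv : ℓ (a * g * a⁻¹) ≤ M * s := by
      have h1 := h.map_mul_le (a * g) a⁻¹
      have h2 := h.map_mul_le a g
      rw [h.map_inv] at h1
      nlinarith
    have hu : ℓ g ≤ M * s := by nlinarith
    obtain ⟨m, c, hm, hc⟩ := hn₀ G g (a * g * a⁻¹) fun n hn => by
      refine ncard_pow_le_of_sepBound h hMpos hspos hmin (fun i => hsmall _ (by positivity) ?_ i) ?_
      · refine le_trans ?_ hsr
        gcongr
      · rintro x (rfl | rfl | rfl | rfl | rfl)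
        · rw [h.map_one]; positivity
        · exact hu
        · rwa [h.map_inv]
        · exact hv
        · rwa [h.map_inv]
    have h1 := Subgroup.mem_of_iterate_commutator_mem (pow_mem hgE m) (fun x hx => hE x (-m)
      (by simpa using hm.ne') (by rwa [zpow_neg, zpow_natCast])) c _ (hc ▸ E.one_mem)
    rw [conj_pow] at h1
    exact hE a m (by simpa using hm.ne') (by rwa [zpow_natCast])
  have hstep : ∀ k : ℕ, ∀ a, ℓ a ≤ min (2 ^ k * (M₀ * s)) (Δ + 1) → a ∈ E := by
    intro k
    induction k with
    | zero =>
      intro a ha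
      exact hbase a (by simpa using ha.trans (min_le_left _ _))
    | succ k ih =>
      intro a ha
      set ρ := min (2 ^ k * (M₀ * s)) (Δ + 1) with hρ
      have hM₀s : 0 < M₀ * s := by positivity
      have hρ1 : M₀ * s ≤ ρ := by
        refine le_min ?_ (by linarith)
        exact le_mul_of_one_le_left hM₀s.le (one_le_pow₀ (by norm_num))
      have hρ2 : ρ ≤ Δ + 1 := min_le_right _ _
      refine h.mem_of_le_two_mul htf hg hE (hdoub ρ (by linarith)) ?_ ih ?_
      · rcases le_total ρ 1 with h1 | h1
        · refine le_trans ?_ hρ1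
          rw [hM₀]
          gcongr
          nlinarith
        · have h2 : Real.exp (κ * ρ) ≤ Real.exp κ * Real.exp (κ * Δ) := by
            rw [← Real.exp_add]
            refine Real.exp_le_exp.2 ?_
            nlinarith
          have h3 : Λ * Real.exp (κ * ρ) * s ≤ s * M₀ * Real.exp (κ * Δ) := by
            rw [hM₀]
            have := mul_le_mul_of_nonneg_left h2 (by positivity : 0 ≤ Λ * s)
            linarith
          have h4 : s * M₀ * Real.exp (κ * Δ) ≤ 1 := by
            have h5 := mul_le_mul_of_nonneg_right hsM.le (Real.exp_pos (κ * Δ)).le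
            rwa [← Real.exp_add, show -κ * Δ + κ * Δ = 0 by ring, Real.exp_zero] at h5
          linarith
      · have h1 : ℓ a ≤ 2 ^ (k + 1) * (M₀ * s) := ha.trans (min_le_left _ _)
        have h2 : ℓ a ≤ Δ + 1 := ha.trans (min_le_right _ _)
        rw [pow_succ] at h1
        rcases min_choice (2 ^ k * (M₀ * s)) (Δ + 1) with e | e <;> rw [hρ, e] <;> linarith
  have hall : ∀ a, ℓ a ≤ Δ + 1 → a ∈ E := by
    intro a ha
    obtain ⟨k, hk⟩ := pow_unbounded_of_one_lt ((Δ + 1) / (M₀ * s)) (by norm_num : (1 : ℝ) < 2)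
    refine hstep k a (le_min (ha.trans ?_) ha)
    rw [div_lt_iff₀ (by positivity)] at hk
    exact hk.le
  refine hnil _ ((Subgroup.closure_le E).2 hall) ?_
  exact (Subgroup.fg_iff _).2 ⟨_, rfl, h.finite _⟩

/-- Every ball of radius `R` is covered by at most `N` balls of radius `r`. -/
def CoverBound (X : Type*) [MetricSpace X] (R r : ℝ) (N : ℕ) : Prop :=
  ∀ y : X, ∃ T : Finset X, T.card ≤ N ∧ ∀ z, dist y z ≤ R → ∃ t ∈ T, dist t z ≤ r

section Cover

variable {X : Type*} [MetricSpace X]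

theorem CoverBound.mono {R r R' r' : ℝ} {N N' : ℕ} (h : CoverBound X R r N) (hR : R' ≤ R)
    (hr : r ≤ r') (hN : N ≤ N') : CoverBound X R' r' N' := by
  intro y
  obtain ⟨T, hT, hc⟩ := h y
  refine ⟨T, hT.trans hN, fun z hz => ?_⟩
  obtain ⟨t, ht, htz⟩ := hc z (hz.trans hR)
  exact ⟨t, ht, htz.trans hr⟩

theorem CoverBound.comp {R r r' : ℝ} {N N' : ℕ} (h : CoverBound X R r N)
    (h' : CoverBound X r r' N') : CoverBound X R r' (N * N') := by
  classical
  intro y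
  obtain ⟨T, hT, hc⟩ := h y
  choose U hU hUc using h'
  refine ⟨T.biUnion U, ?_, fun z hz => ?_⟩
  · exact (Finset.card_biUnion_le_card_mul T U N' fun t _ => hU t).trans
      (Nat.mul_le_mul_right _ hT)
  · obtain ⟨t, ht, htz⟩ := hc z hz
    obtain ⟨u, hu, huz⟩ := hUc t z htz
    exact ⟨u, Finset.mem_biUnion.2 ⟨t, ht, hu⟩, huz⟩

theorem IsPacked.coverBound {P ρ : ℝ} (h : IsPacked X P ρ) (hρ : 0 < ρ) :
    CoverBound X (3 * ρ) (2 * ρ) ⌈P⌉₊ := by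
  classical
  intro y
  set A : Set ℕ := {n | ∃ S : Finset X, ↑S ⊆ closedBall y (3 * ρ) ∧
    (∀ a ∈ S, ∀ b ∈ S, a ≠ b → 2 * ρ < dist a b) ∧ S.card = n} with hA
  have hbdd : ∀ n ∈ A, n ≤ ⌈P⌉₊ := by
    rintro _ ⟨S, hS, hsep, rfl⟩
    exact_mod_cast (h y S hS hsep).trans (Nat.le_ceil P)
  have hBdd : BddAbove A := ⟨_, hbdd⟩
  obtain ⟨S, hS, hsep, hcard⟩ := Nat.sSup_mem (s := A) ⟨0, ∅, by simp, by simp, rfl⟩ hBdd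
  refine ⟨S, hbdd _ ⟨S, hS, hsep, rfl⟩, fun z hz => ?_⟩
  by_contra! hfar
  have hzS : z ∉ S := fun hzS => by
    have := hfar z hzS
    rw [dist_self] at this
    linarith
  have hmem : S.card + 1 ∈ A := by
    refine ⟨insert z S, ?_, ?_, Finset.card_insert_of_notMem hzS⟩
    · rw [Finset.coe_insert, Set.insert_subset_iff]
      exact ⟨by rwa [mem_closedBall, dist_comm], hS⟩
    · intro a ha b hb hab
      rcases Finset.mem_insert.1 ha with ha' | ha' <;>
        rcases Finset.mem_insert.1 hb with hb' | hb'
      · exact absurd (ha'.trans hb'.symm) hab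
      · rw [ha', dist_comm]; exact hfar b hb'
      · rw [hb']; exact hfar a ha'
      · exact hsep a ha' b hb' hab
  have := le_csSup hBdd hmem
  omega

theorem IsGCB.isPacked_of_le {σ : X → X → ℝ → X} (hσ : IsGCB σ) {P r ρ : ℝ}
    (h : IsPacked X P r) (hρ : 0 < ρ) (hρr : ρ ≤ r) : IsPacked X P ρ := by
  classical
  intro x S hS hsep
  have hr : 0 < r := hρ.trans_le hρr
  set t := ρ / r with ht
  have ht0 : 0 < t := div_pos hρ hr
  have ht1 : t ≤ 1 := (div_le_one hr).2 hρr
  have htr : t * r = ρ := div_mul_cancel₀ _ hr.ne'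
  have hext : ∀ s : X, ∃ s' : X, σ x s' t = s ∧ t * dist x s' = dist x s := by
    intro s
    obtain ⟨γ, hγ, hγσ, hγs⟩ := hσ.geodComplete x s
    have h0 : γ 0 = x := by
      rw [← hσ.source x s, hγs 0 ⟨le_rfl, zero_le_one⟩, zero_mul]
    have h1 : γ (dist x s) = s := by
      have := hγs 1 ⟨zero_le_one, le_rfl⟩
      rwa [hσ.target, one_mul, eq_comm] at this
    refine ⟨γ (dist x s / t), ?_, ?_⟩
    · have := hγσ 0 (dist x s / t) (by positivity) t ⟨ht0.le, ht1⟩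
      rw [h0, zero_add, sub_zero, mul_div_cancel₀ _ ht0.ne', h1] at this
      exact this
    · nth_rewrite 1 [← h0]
      rw [hγ.dist_eq, dist_zero_left, Real.norm_of_nonneg (by positivity),
        mul_div_cancel₀ _ ht0.ne']
  choose e he hed using hext
  have hdist : ∀ a b, dist a b ≤ t * dist (e a) (e b) := by
    intro a b
    have := (hσ.convex x (e a) x (e b)).2 (x := 0) (y := 1) ⟨le_rfl, zero_le_one⟩
      ⟨zero_le_one, le_rfl⟩ (sub_nonneg.2 ht1) ht0.le (by ring)
    simp only [smul_eq_mul, mul_zero, mul_one, zero_add, he, hσ.source, hσ.target, dist_self]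
      at this
    exact this
  have hinj : Function.Injective e := fun a b hab => by
    have := hdist a b
    rw [hab, dist_self, mul_zero] at this
    exact dist_le_zero.1 this
  have := h x (S.image e) (by
    intro b hb
    obtain ⟨a, ha, rfl⟩ := Finset.mem_image.1 (Finset.mem_coe.1 hb)
    have h1 : dist a x ≤ 3 * ρ := hS ha
    rw [dist_comm, ← hed, ← htr] at h1
    rw [mem_closedBall, dist_comm]
    exact le_of_mul_le_mul_left (by linarith) ht0) (by
    intro a' ha b' hb hab
    obtain ⟨a, haS, rfl⟩ := Finset.mem_image.1 ha
    obtain ⟨b, hbS, rfl⟩ := Finset.mem_image.1 hb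
    have h1 := hsep a haS b hbS fun e => hab (by rw [e])
    have h2 := hdist a b
    rw [← htr] at h1
    exact lt_of_mul_lt_mul_left (by linarith) ht0.le)
  rwa [Finset.card_image_of_injective _ hinj] at this

variable {σ : X → X → ℝ → X} {P r : ℝ} {p : ℕ}

theorem IsGCB.coverBound_two_pow (hσ : IsGCB σ) (h : IsPacked X P r) (hp : ⌈P⌉₊ ≤ 2 ^ p)
    {R : ℝ} (hR : 0 < R) (hRr : R ≤ 3 * r) (i : ℕ) :
    CoverBound X R (R / 2 ^ i) ((2 ^ (2 * p)) ^ i) := by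
  have hhalf : ∀ R, 0 < R → R ≤ 3 * r → CoverBound X R (R / 2) (2 ^ (2 * p)) := by
    intro R hR hRr
    have h1 := (hσ.isPacked_of_le h (ρ := R / 3) (by linarith) (by linarith)).coverBound
      (by linarith)
    have h2 := (hσ.isPacked_of_le h (ρ := 2 * R / 9) (by linarith) (by linarith)).coverBound
      (by linarith)
    have h3 := (h1.mono (R' := R) (r' := 3 * (2 * R / 9)) (by linarith) (by linarith) hp).comp
      (h2.mono le_rfl le_rfl hp)
    exact h3.mono le_rfl (by linarith) (by rw [two_mul, pow_add])
  induction i with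
  | zero =>
    intro y
    exact ⟨{y}, by simp, fun z hz => ⟨y, by simp, by simpa using hz⟩⟩
  | succ i ih =>
    have h1 := hhalf (R / 2 ^ i) (by positivity)
      ((div_le_self hR.le (one_le_pow₀ (by norm_num))).trans hRr)
    have h2 := ih.comp h1
    rwa [← pow_succ, div_div, ← pow_succ] at h2

theorem IsGCB.coverBound_large (hσ : IsGCB σ) (h : IsPacked X P r) (hr : 0 < r)
    (hp : ⌈P⌉₊ ≤ 2 ^ p) (k : ℕ) : CoverBound X ((k + 2) * r) (2 * r) ((2 ^ p) ^ k) := by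
  induction k with
  | zero =>
    intro y
    exact ⟨{y}, by simp, fun z hz => ⟨y, by simp, by simpa using hz⟩⟩
  | succ k ih =>
    have h1 : CoverBound X (((k + 1 : ℕ) + 2) * r) (3 * r) ((2 ^ p) ^ k) := by
      intro y
      obtain ⟨T, hT, hc⟩ := ih y
      refine ⟨T, hT, fun z hz => ?_⟩
      push_cast at hz
      by_cases hyz : dist y z ≤ (k + 2) * r
      · obtain ⟨t, ht, htz⟩ := hc z hyz
        exact ⟨t, ht, by linarith⟩
      · push Not at hyz
        have hd : 0 < dist y z := lt_of_le_of_lt (by positivity) hyz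
        set c := (k + 2) * r / dist y z with hcdef
        have hcd : c * dist y z = (k + 2) * r := div_mul_cancel₀ _ hd.ne'
        have hc0 : 0 ≤ c := by positivity
        have hc1 : c ≤ 1 := (div_le_one hd).2 hyz.le
        have h0 := hσ.geodesic y z 0 ⟨le_rfl, zero_le_one⟩ c ⟨hc0, hc1⟩
        have h1 := hσ.geodesic y z c ⟨hc0, hc1⟩ 1 ⟨zero_le_one, le_rfl⟩
        rw [hσ.source, zero_sub, abs_neg, abs_of_nonneg hc0, hcd] at h0
        rw [hσ.target, abs_sub_comm, abs_of_nonneg (sub_nonneg.2 hc1), sub_mul, hcd] at h1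
        obtain ⟨t, ht, htz⟩ := hc (σ y z c) h0.le
        exact ⟨t, ht, by linarith [dist_triangle t (σ y z c) z]⟩
    have h2 := h1.comp ((h.coverBound hr).mono le_rfl le_rfl hp)
    rwa [← pow_succ] at h2

end Cover

section Action

variable {X : Type*} [MetricSpace X] {Γ : Subgroup (X ≃ᵢ X)} {y : X}

theorem dist_smul_smul_eq (a b : Γ) (y : X) :
    dist ((a : X ≃ᵢ X) y) ((b : X ≃ᵢ X) y) = dist y (((a⁻¹ * b : Γ) : X ≃ᵢ X) y) := by
  have h := (a : X ≃ᵢ X).isometry.dist_eq y (((a⁻¹ * b : Γ) : X ≃ᵢ X) y)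
  have e : (a : X ≃ᵢ X) (((a⁻¹ * b : Γ) : X ≃ᵢ X) y) = (b : X ≃ᵢ X) y := by
    rw [← IsometryEquiv.mul_apply, ← Subgroup.coe_mul, mul_inv_cancel_left]
  rw [← h, e]

theorem IsDiscreteSubgroup.isHypLength {δ : ℝ} (hδ : IsDeltaHyperbolic X δ)
    (hΓ : IsDiscreteSubgroup Γ) (y : X) :
    IsHypLength (fun a : Γ => dist y ((a : X ≃ᵢ X) y)) δ where
  map_one := dist_self y
  map_inv a := by
    have := dist_smul_smul_eq a 1 y
    rw [mul_one] at this
    rw [← this, dist_comm]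
    rfl
  map_mul_le a b := by
    have := dist_smul_smul_eq a (a * b) y
    rw [inv_mul_cancel_left] at this
    rw [← this]
    exact dist_triangle _ _ _
  four_point a b c d := by
    simp only [← dist_smul_smul_eq]
    exact hδ _ _ _ _
  finite R := by
    refine Set.Finite.of_finite_image ((hΓ y R).subset ?_) Subtype.val_injective.injOn
    rintro _ ⟨a, ha, rfl⟩
    exact ⟨a.2, ha⟩

theorem CoverBound.sepBound {R r : ℝ} {N : ℕ} (h : CoverBound X R r N) (Γ : Subgroup (X ≃ᵢ X))
    (y : X) : SepBound (fun a : Γ => dist y ((a : X ≃ᵢ X) y)) R (2 * r) N := by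
  intro S hS hsep
  obtain ⟨T, hT, hc⟩ := h y
  refine Nat.cast_le.2 (le_trans ?_ hT)
  by_contra! hlt
  have : Nonempty X := ⟨y⟩
  choose! f hfT hf using fun a : Γ => fun ha : a ∈ S => hc _ (hS a ha)
  obtain ⟨a, ha, b, hb, hab, he⟩ := Finset.exists_ne_map_eq_of_card_lt_of_maps_to hlt hfT
  have h1 : 2 * r < dist y (((a⁻¹ * b : Γ) : X ≃ᵢ X) y) := hsep a ha b hb hab
  rw [← dist_smul_smul_eq] at h1
  have h2 := hf a ha
  have h3 := hf b hb
  rw [← he] at h3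
  linarith [dist_triangle_left ((a : X ≃ᵢ X) y) ((b : X ≃ᵢ X) y) (f a)]

theorem IsGCB.exists_ncard_le {σ : X → X → ℝ → X} (hσ : IsGCB σ) {P r : ℝ} {p : ℕ}
    (h : IsPacked X P r) (hr : 0 < r) (hp : ⌈P⌉₊ ≤ 2 ^ p) {δ : ℝ} (y : X)
    (hℓ : IsHypLength (fun a : Γ => dist y ((a : X ≃ᵢ X) y)) δ) :
    ∃ A b : ℕ, ∀ R : ℕ, {a : Γ | dist y ((a : X ≃ᵢ X) y) ≤ R}.ncard ≤ A * 2 ^ (b * R) := by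
  classical
  set n₀ := {a : Γ | dist y ((a : X ≃ᵢ X) y) ≤ 4 * r}.ncard with hn₀
  refine ⟨n₀, p * ⌈1 / r⌉₊, fun R => ?_⟩
  have hc : (1 : ℝ) ≤ ⌈1 / r⌉₊ * r := by
    rw [← div_le_iff₀ hr]
    exact Nat.le_ceil _
  obtain ⟨T, hT, hcov⟩ := hσ.coverBound_large h hr hp (⌈1 / r⌉₊ * R) y
  have hfin := hℓ.finite R
  have hcov' : ∀ a : Γ, a ∈ hfin.toFinset → ∃ t ∈ T, dist t ((a : X ≃ᵢ X) y) ≤ 2 * r := by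
    intro a ha
    refine hcov _ ((hfin.mem_toFinset.1 ha).trans ?_)
    push_cast
    nlinarith [(Nat.cast_nonneg R : (0 : ℝ) ≤ R)]
  have : Nonempty X := ⟨y⟩
  choose! f hfT hf using hcov'
  have := Finset.card_le_mul_card_image_of_maps_to hfT n₀ fun t _ => by
    rcases Finset.eq_empty_or_nonempty (hfin.toFinset.filter fun a => f a = t) with e | ⟨a, ha⟩
    · rw [e]; simp
    · obtain ⟨haR, rfl⟩ := Finset.mem_filter.1 ha
      rw [hn₀, ← Set.ncard_coe_finset, ← Set.ncard_image_of_injective _ (mul_right_injective a⁻¹)]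
      refine Set.ncard_le_ncard ?_ (hℓ.finite _)
      rintro _ ⟨b, hb, rfl⟩
      obtain ⟨hbR, he⟩ := Finset.mem_filter.1 hb
      change dist y (((a⁻¹ * b : Γ) : X ≃ᵢ X) y) ≤ 4 * r
      rw [← dist_smul_smul_eq]
      have h2 := hf a haR
      have h3 := hf b hbR
      rw [he] at h3
      linarith [dist_triangle_left ((a : X ≃ᵢ X) y) ((b : X ≃ᵢ X) y) (f a)]
  rw [Set.ncard_eq_toFinset_card _ hfin]
  refine this.trans (Nat.mul_le_mul_left _ (hT.trans ?_))
  rw [← pow_mul, mul_assoc]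

end Action

theorem IsGCB.coverBound_exp {X : Type*} [MetricSpace X] {σ : X → X → ℝ → X} (hσ : IsGCB σ)
    {P r : ℝ} {p : ℕ} (h : IsPacked X P r) (hr : 0 < r) (hp : ⌈P⌉₊ ≤ 2 ^ p) {ρ : ℝ} (hρ : 0 < ρ) :
    ∃ N : ℕ, CoverBound X (3 * ρ) (ρ / 2) N ∧
      (N : ℝ) ≤ Real.exp (8 * p) * Real.exp (3 * p / r * ρ) := by
  have hexp : ∀ n : ℕ, (2 : ℝ) ^ n ≤ Real.exp n := by
    intro n
    rw [← Real.exp_one_pow]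
    exact pow_le_pow_left₀ (by norm_num) (by linarith [Real.add_one_le_exp 1]) n
  rcases le_total ρ r with h1 | h1
  · refine ⟨_, (hσ.coverBound_two_pow h hp (R := 3 * ρ) (by linarith) (by linarith) 3).mono
      le_rfl (by linarith) le_rfl, ?_⟩
    rw [← pow_mul, ← Real.exp_add]
    push_cast
    refine (hexp _).trans (Real.exp_le_exp.2 ?_)
    push_cast
    have : 0 ≤ 3 * p / r * ρ := by positivity
    have : (0 : ℝ) ≤ p := Nat.cast_nonneg p
    linarith
  · have h2 := hσ.coverBound_two_pow h hp (R := 2 * r) (by linarith) (by linarith) 2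
    have h3 := (hσ.coverBound_large h hr hp ⌈3 * ρ / r⌉₊).comp h2
    have hk : 3 * ρ / r ≤ ⌈3 * ρ / r⌉₊ := Nat.le_ceil _
    have hk2 : (⌈3 * ρ / r⌉₊ : ℝ) ≤ 3 * ρ / r + 1 := (Nat.ceil_lt_add_one (by positivity)).le
    refine ⟨_, h3.mono ?_ (by linarith) le_rfl, ?_⟩
    · rw [div_le_iff₀ hr] at hk
      linarith
    · rw [← pow_mul, ← pow_mul, ← pow_add, ← Real.exp_add]
      push_cast
      refine (hexp _).trans (Real.exp_le_exp.2 ?_)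
      push_cast
      have h4 := mul_le_mul_of_nonneg_left hk2 (Nat.cast_nonneg (α := ℝ) p)
      have h5 : p * (3 * ρ / r + 1) = 3 * p / r * ρ + p := by ring
      have : (0 : ℝ) ≤ p := Nat.cast_nonneg p
      linarith

theorem IsVirtuallyNilpotent.map_of_injective {G Q : Type*} [Group G] [Group Q] {H : Subgroup G}
    (h : IsVirtuallyNilpotent H) (f : G →* Q) (hf : Function.Injective f) :
    IsVirtuallyNilpotent (H.map f) :=
  h.of_injective (H.equivMapOfInjective f hf).symm.toMonoidHom
    (H.equivMapOfInjective f hf).symm.injective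

theorem almostStabilizer_eq_map {X : Type*} [MetricSpace X] (Γ : Subgroup (X ≃ᵢ X)) (r : ℝ)
    (x : X) : almostStabilizer Γ r x =
      (Subgroup.closure {a : Γ | dist x ((a : X ≃ᵢ X) x) ≤ r}).map Γ.subtype := by
  rw [MonoidHom.map_closure, almostStabilizer]
  congr 1
  ext g
  constructor
  · rintro ⟨hg, hle⟩
    exact ⟨⟨g, hg⟩, hle, rfl⟩
  · rintro ⟨a, ha, rfl⟩
    exact ⟨a.2, ha⟩

/-- **Corollary 1.3**: global systolic estimate via the upper nilradius. -/
theorem global_systolic_estimate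
    (P₀ r₀ : ℝ) (hP₀ : 0 < P₀) (hr₀ : 0 < r₀) :
    ∃ ε₀ : ℝ, 0 < ε₀ ∧
      ∀ δ : ℝ, 0 < δ →
        ∃ H₀ : ℝ, 0 < H₀ ∧
          ∀ (X : Type*) [MetricSpace X] [CompleteSpace X] (σ : X → X → ℝ → X),
            IsGCB σ → IsDeltaHyperbolic X δ → IsPacked X P₀ r₀ →
            ∀ Γ : Subgroup (X ≃ᵢ X), (∀ g ∈ Γ, IsSigmaIsometry σ g) →
              IsDiscreteSubgroup Γ → IsNonElementary Γ →
              (∀ g ∈ Γ, g ≠ 1 → ¬ IsOfFinOrder g) →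
              ∀ Δ : ℝ,
                (∀ x : X, (∃ g ∈ Γ, g ≠ 1 ∧ dist x (g x) < ε₀) →
                  ∀ r : ℝ, 0 ≤ r →
                    IsVirtuallyNilpotent ↥(almostStabilizer Γ r x) → r ≤ Δ) →
                ∀ x : X, ∀ g ∈ Γ, g ≠ 1 →
                  min ε₀ ((1 / H₀) * Real.exp (-H₀ * Δ)) ≤ dist x (g x) := by
  refine ⟨1, one_pos, fun δ _ => ?_⟩
  set p := ⌈P₀⌉₊ with hpdef
  have hp : ⌈P₀⌉₊ ≤ 2 ^ p := Nat.lt_two_pow_self.le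
  obtain ⟨H, hH, hmain⟩ := exists_systole_constant (2 * p) (Λ := Real.exp (8 * p))
    (κ := 3 * p / r₀) (Real.one_le_exp (by positivity)) (by positivity) hr₀
  refine ⟨H, hH, ?_⟩
  intro X _ _ σ hσ hδ hpack Γ _ hΓ _ htors Δ hΔ x g hg hg1
  by_contra! hlt
  obtain ⟨hlt1, hlt2⟩ := lt_min_iff.1 hlt
  have hℓ := hΓ.isHypLength hδ x
  have htf : ∀ a : Γ, a ≠ 1 → ¬ IsOfFinOrder a := fun a ha hfin =>
    htors a a.2 (fun e => ha (Subtype.ext e)) (Γ.subtype.isOfFinOrder hfin)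
  obtain ⟨a, ⟨ha1, hale⟩, hamin⟩ := Set.exists_min_image
    ({a : Γ | a ≠ 1} ∩ {a : Γ | dist x ((a : X ≃ᵢ X) x) ≤ dist x (g x)})
    (fun a : Γ => dist x ((a : X ≃ᵢ X) x)) ((hℓ.finite _).inter_of_right _)
    ⟨⟨g, hg⟩, fun e => hg1 (congrArg Subtype.val e), le_refl (dist x (g x))⟩
  have hale : dist x ((a : X ≃ᵢ X) x) ≤ dist x (g x) := hale
  have hamin' : ∀ b : Γ, b ≠ 1 → dist x ((a : X ≃ᵢ X) x) ≤ dist x ((b : X ≃ᵢ X) x) := by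
    intro b hb
    rcases le_total (dist x ((b : X ≃ᵢ X) x)) (dist x (g x)) with h1 | h1
    · exact hamin b ⟨hb, h1⟩
    · exact hale.trans h1
  have hthin := hΔ x ⟨g, hg, hg1, hlt1⟩
  have hΔ0 : 0 ≤ Δ := by
    refine hthin 0 le_rfl ?_
    rw [almostStabilizer_eq_map]
    refine IsVirtuallyNilpotent.map_of_injective ?_ _ Γ.subtype_injective
    have e : Subgroup.closure {a : Γ | dist x ((a : X ≃ᵢ X) x) ≤ 0} = ⊥ := by
      refine Subgroup.closure_eq_bot_iff.2 fun b hb => ?_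
      by_contra hb1
      exact absurd hb (not_le.2 (hℓ.pos htf hb1))
    rw [e]
    exact ⟨⊤, inferInstance, inferInstance⟩
  have hvn := hmain Γ _ δ hℓ htf (hσ.exists_ncard_le hpack hr₀ hp x hℓ)
    (fun R hR hRr i => by
      have := (hσ.coverBound_two_pow hpack hp hR (by linarith) (i + 1)).sepBound Γ x
      push_cast at this
      rwa [pow_succ (2 : ℝ) i, ← div_div, mul_div_cancel₀ _ two_ne_zero] at this)
    (fun ρ hρ => by
      obtain ⟨N, hN, hNle⟩ := hσ.coverBound_exp hpack hr₀ hp hρ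
      have := hN.sepBound Γ x
      rw [mul_div_cancel₀ _ two_ne_zero] at this
      exact fun S hS hsep => (this S hS hsep).trans hNle)
    a ha1 hamin' Δ hΔ0 (hale.trans_lt hlt2)
  have := hthin (Δ + 1) (by linarith) (by
    rw [almostStabilizer_eq_map]
    exact hvn.map_of_injective _ Γ.subtype_injective)
  linarith
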